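/- arXiv:2001.09962 — 2 statements merged into one kernel-verified Lean document; each statement's English description precedes it below -/
import Mathlib

section
/- Let Φ be a unital positive linear map on B(H) and let f, g : (0,∞) → (0,∞) be continuous functions such that f² and g² are operator concave and the function t ↦ t·f(t)·g(t) is operator convex. Then for every positive invertible operator A ∈ B(H) there exists a partial isometry U such that |Φ(f(A)) Φ(A) Φ(g(A))| ≤ U* Φ(f(A) A g(A)) U. -/
open scoped NNReal

variable {H : Type*} [NormedAddCommGroup H] [InnerProductSpace ℂ H] [CompleteSpace H]

/-- The absolute value `|X| = (X*X)^(1/2)` of a bounded operator `X` on a Hilbert space. -/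
noncomputable def opAbs (X : H →L[ℂ] H) : H →L[ℂ] H := CFC.sqrt (star X * X)

/-- `Φ` is a unital positive linear map on `B(H)`: `Φ(I) = I` and `Φ(X) ≥ 0` whenever `X ≥ 0`
(with respect to the Löwner order). -/
def IsUnitalPositiveMap (Φ : (H →L[ℂ] H) →ₗ[ℂ] (H →L[ℂ] H)) : Prop :=
  Φ 1 = 1 ∧ ∀ X : H →L[ℂ] H, 0 ≤ X → 0 ≤ Φ X

/-- `f : (0,∞) → (0,∞)` is operator convex: for all positive invertible operators `A, B` on `H`
and all `c ∈ [0,1]`, `f(cA + (1-c)B) ≤ c f(A) + (1-c) f(B)` in the Löwner order, where `f(A)` is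
given by the continuous functional calculus. -/
def IsOperatorConvexOn (H : Type*) [NormedAddCommGroup H] [InnerProductSpace ℂ H]
    [CompleteSpace H] (f : ℝ → ℝ) : Prop :=
  ∀ (A B : H →L[ℂ] H), 0 ≤ A → IsUnit A → 0 ≤ B → IsUnit B →
    ∀ c : ℝ, c ∈ Set.Icc (0 : ℝ) 1 →
      cfc f (c • A + (1 - c) • B) ≤ c • cfc f A + (1 - c) • cfc f B

/-- `f : (0,∞) → (0,∞)` is operator concave if `-f` is operator convex. -/
def IsOperatorConcaveOn (H : Type*) [NormedAddCommGroup H] [InnerProductSpace ℂ H]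
    [CompleteSpace H] (f : ℝ → ℝ) : Prop :=
  IsOperatorConvexOn H (fun t => -(f t))

section Auxiliary

open Polynomial

theorem exists_iteratedDeriv_eq_zero_of_strictMono (m : ℕ) :
    ∀ (G : ℝ → ℝ), ContDiff ℝ m G → ∀ t : Fin (m + 1) → ℝ, StrictMono t →
      (∀ i, G (t i) = 0) → ∃ ξ, t 0 ≤ ξ ∧ iteratedDeriv m G ξ = 0 := by
  induction m with
  | zero => intro G _ t _ h; exact ⟨t 0, le_rfl, by simpa using h 0⟩
  | succ m ih =>
    intro G hG t ht h
    have hd : Differentiable ℝ G := hG.differentiable (by simp)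
    have key : ∀ i : Fin (m + 1), ∃ c ∈ Set.Ioo (t i.castSucc) (t i.succ), deriv G c = 0 := by
      intro i
      exact exists_deriv_eq_zero (ht Fin.castSucc_lt_succ) hd.continuous.continuousOn
        (by rw [h, h])
    choose c hc hc0 using key
    have hmono : StrictMono c := by
      rw [Fin.strictMono_iff_lt_succ]
      intro i
      exact (hc _).2.trans (by simpa using (hc i.succ).1)
    obtain ⟨ξ, h1, h2⟩ := ih (deriv G) (by
      have : ContDiff ℝ (m + 1) G := by exact_mod_cast hG
      exact (contDiff_succ_iff_deriv.mp this).2.2) c hmono hc0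
    refine ⟨ξ, ?_, by rw [iteratedDeriv_succ', h2]⟩
    exact ((hc 0).1.le.trans h1)

theorem Polynomial.contDiff_eval (P : ℝ[X]) {m : WithTop ℕ∞} : ContDiff ℝ m fun x => P.eval x := by
  simpa using P.contDiff_aeval (𝕜 := ℝ) m

theorem Polynomial.iteratedDeriv_eval (P : ℝ[X]) (m : ℕ) (x : ℝ) :
    iteratedDeriv m (fun x => P.eval x) x = (derivative^[m] P).eval x := by
  induction m generalizing P with
  | zero => simp
  | succ m ih =>
    rw [iteratedDeriv_succ', Function.iterate_succ_apply, ← ih]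
    congr 1
    ext y
    simp

theorem Polynomial.eval_iterate_derivative_eq_factorial_mul_taylor (P : ℝ[X]) (m : ℕ) (a : ℝ) :
    (derivative^[m] P).eval a = m.factorial * (taylor a P).coeff m := by
  rw [taylor_coeff, ← factorial_smul_hasseDeriv]
  simp

/-- The divided difference of `G` at the nodes of `S`. -/
noncomputable def dividedDiff (S : Finset ℝ) (G : ℝ → ℝ) : ℝ :=
  ∑ t ∈ S, G t / ∏ u ∈ S.erase t, (t - u)

theorem exists_iteratedDeriv_eq_dividedDiff {m : ℕ} {G : ℝ → ℝ} (hG : ContDiff ℝ m G)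
    {S : Finset ℝ} (hS : S.card = m + 1) :
    ∃ ξ, (∃ t ∈ S, t ≤ ξ) ∧ iteratedDeriv m G ξ = m.factorial * dividedDiff S G := by
  set P : ℝ[X] := Lagrange.interpolate S id G with hP
  have hinj : Set.InjOn (id : ℝ → ℝ) S := Function.injective_id.injOn
  have hdeg : P.degree < S.card := Lagrange.degree_interpolate_lt _ hinj
  have hev : ∀ t ∈ S, P.eval t = G t := fun t ht =>
    Lagrange.eval_interpolate_at_node (v := id) G hinj ht
  obtain ⟨ξ, h1, h2⟩ := exists_iteratedDeriv_eq_zero_of_strictMono m (fun x => G x - P.eval x)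
    (hG.sub P.contDiff_eval) (S.orderEmbOfFin hS) (S.orderEmbOfFin hS).strictMono
    (fun i => by simp [hev _ (S.orderEmbOfFin_mem hS i)])
  refine ⟨ξ, ⟨_, S.orderEmbOfFin_mem hS 0, h1⟩, ?_⟩
  rw [iteratedDeriv_fun_sub hG.contDiffAt P.contDiff_eval.contDiffAt, sub_eq_zero] at h2
  rw [h2, Polynomial.iteratedDeriv_eval,
    Lagrange.eval_iterate_derivative_eq_sum hinj hdeg (k := m) (by omega), dividedDiff]
  congr 1
  refine Finset.sum_congr rfl fun t ht => ?_
  have hc : S.card - (m + 1) = 0 := by omega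
  simp [hc, hev t ht]

theorem iteratedDeriv_mul_eval_eq_sum {F : ℝ → ℝ} {m : ℕ} (hF : ContDiff ℝ m F) (P : ℝ[X])
    (a : ℝ) :
    iteratedDeriv m (fun x => F x * P.eval x) a =
      m.factorial * ∑ k ∈ Finset.range (m + 1),
        iteratedDeriv k F a / k.factorial * (taylor a P).coeff (m - k) := by
  rw [iteratedDeriv_fun_mul hF.contDiffAt P.contDiff_eval.contDiffAt, Finset.mul_sum]
  refine Finset.sum_congr rfl fun k hk => ?_
  have hk : k ≤ m := by simpa [Nat.lt_succ_iff] using hk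
  rw [Polynomial.iteratedDeriv_eval, Polynomial.eval_iterate_derivative_eq_factorial_mul_taylor,
    Nat.cast_choose ℝ hk]
  have := Nat.factorial_ne_zero k
  have := Nat.factorial_ne_zero (m - k)
  field_simp

theorem Polynomial.eval_nonneg_of_forall_ne {M : ℝ[X]} {z : ℝ}
    (h : ∀ s, 0 < s → s ≠ z → 0 ≤ M.eval s) {s : ℝ} (hs : 0 < s) : 0 ≤ M.eval s := by
  by_cases hz : s = z
  · have ht : Filter.Tendsto (fun s => M.eval s) (nhdsWithin s {s}ᶜ) (nhds (M.eval s)) :=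
      M.continuous.continuousAt.tendsto.mono_left nhdsWithin_le_nhds
    refine ge_of_tendsto ht ?_
    have h1 : ∀ᶠ u in nhdsWithin s {s}ᶜ, 0 < u :=
      nhdsWithin_le_nhds (lt_mem_nhds hs)
    filter_upwards [h1, self_mem_nhdsWithin] with u hu hu'
    exact h u hu (by rw [← hz]; exact hu')
  · exact h s hs hz

/-- A real polynomial that is nonnegative on the half line is `σ + X τ` with `σ`, `τ` sums of
squares. -/
theorem Polynomial.exists_isSumSq_of_nonneg (d : ℕ) : ∀ N : ℝ[X], N.natDegree ≤ d →
    (∀ s, 0 < s → 0 ≤ N.eval s) →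
      ∃ σ τ : ℝ[X], IsSumSq σ ∧ IsSumSq τ ∧ N = σ + X * τ := by
  have hsq : ∀ p : ℝ[X], IsSumSq (p ^ 2) := fun p => by
    rw [pow_two]; exact IsSumSq.mul_self p
  have hC : ∀ c : ℝ, 0 ≤ c → IsSumSq (C c) := fun c hc => by
    have := hsq (C (Real.sqrt c)); rwa [← C_pow, Real.sq_sqrt hc] at this
  have hX : IsSumSq (1 : ℝ[X]) := by simp
  have hmul : ∀ p q σ τ σ' τ' : ℝ[X], IsSumSq σ → IsSumSq τ → IsSumSq σ' → IsSumSq τ' →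
      p = σ + X * τ → q = σ' + X * τ' →
      ∃ σ τ : ℝ[X], IsSumSq σ ∧ IsSumSq τ ∧ p * q = σ + X * τ := by
    intro p q σ τ σ' τ' h1 h2 h3 h4 hp hq
    refine ⟨σ * σ' + X ^ 2 * (τ * τ'), σ * τ' + τ * σ',
      (h1.mul h3).add ((hsq X).mul (h2.mul h4)), (h1.mul h4).add (h2.mul h3), ?_⟩
    rw [hp, hq]; ring
  induction d using Nat.strong_induction_on with
  | _ d ih =>
  intro N hd hN
  by_cases h0 : N.natDegree = 0
  · obtain ⟨c, rfl⟩ := natDegree_eq_zero.mp h0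
    exact ⟨C c, 0, hC c (by simpa using hN 1 one_pos), IsSumSq.zero, by simp⟩
  have hN0 : N ≠ 0 := by rintro rfl; simp at h0
  obtain ⟨z, hz⟩ : ∃ z : ℂ, aeval z N = 0 := by
    have := Complex.exists_root (f := N.map (algebraMap ℝ ℂ)) (by
      rw [degree_map]; exact natDegree_pos_iff_degree_pos.mp (Nat.pos_of_ne_zero h0))
    obtain ⟨z, hz⟩ := this
    exact ⟨z, by rw [aeval_def, ← eval_map]; exact hz⟩
  by_cases him : z.im = 0
  · obtain ⟨x, rfl⟩ : ∃ x : ℝ, z = x := ⟨z.re, by apply Complex.ext <;> simp [him]⟩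
    have hx : N.IsRoot x := by
      have : ((N.eval x : ℝ) : ℂ) = 0 := by
        rw [← hz]; simpa using (aeval_algebraMap_apply ℂ x N).symm
      exact_mod_cast this
    obtain ⟨M, hM⟩ := dvd_iff_isRoot.mpr hx
    have hM0 : M ≠ 0 := by rintro rfl; simp at hM; exact hN0 hM
    have hdM : N.natDegree = 1 + M.natDegree := by
      rw [hM, natDegree_mul (X_sub_C_ne_zero x) hM0, natDegree_X_sub_C]
    have hev : ∀ s, N.eval s = (s - x) * M.eval s := fun s => by rw [hM]; simp
    rcases le_or_gt x 0 with hx0 | hx0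
    · obtain ⟨σ, τ, h1, h2, h3⟩ := ih (d - 1) (by omega) M (by omega) (fun s hs => by
        have := hN s hs
        rw [hev] at this
        exact nonneg_of_mul_nonneg_right this (by linarith))
      have := hmul (X - C x) M (C (-x)) 1 σ τ (hC _ (by linarith)) hX h1 h2
        (by simp; ring) h3
      rwa [← hM] at this
    · have hMx : M.IsRoot x := by
        have hlt : Filter.Tendsto (fun s => M.eval s) (nhdsWithin x (Set.Iio x))
          (nhds (M.eval x)) := M.continuous.continuousAt.tendsto.mono_left nhdsWithin_le_nhds
        have hgt : Filter.Tendsto (fun s => M.eval s) (nhdsWithin x (Set.Ioi x))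
          (nhds (M.eval x)) := M.continuous.continuousAt.tendsto.mono_left nhdsWithin_le_nhds
        apply le_antisymm
        · refine le_of_tendsto hlt ?_
          have h1 : ∀ᶠ u in nhdsWithin x (Set.Iio x), 0 < u :=
            nhdsWithin_le_nhds (lt_mem_nhds hx0)
          filter_upwards [h1, self_mem_nhdsWithin] with u hu hu'
          have := hN u hu
          rw [hev] at this
          have hu'' : u - x < 0 := sub_neg.mpr hu'
          nlinarith
        · refine ge_of_tendsto hgt ?_
          filter_upwards [self_mem_nhdsWithin] with u hu'
          have hu'' : 0 < u - x := sub_pos.mpr hu'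
          have := hN u (by linarith)
          rw [hev] at this
          exact nonneg_of_mul_nonneg_right this hu''
      obtain ⟨K, hK⟩ := dvd_iff_isRoot.mpr hMx
      have hK0 : K ≠ 0 := by rintro rfl; simp at hK; exact hM0 hK
      have hdK : M.natDegree = 1 + K.natDegree := by
        rw [hK, natDegree_mul (X_sub_C_ne_zero x) hK0, natDegree_X_sub_C]
      have hNK : N = (X - C x) ^ 2 * K := by rw [hM, hK]; ring
      obtain ⟨σ, τ, h1, h2, h3⟩ := ih (d - 1) (by omega) K (by omega) (fun s hs => by
        refine eval_nonneg_of_forall_ne (z := x) (fun s hs hsx => ?_) hs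
        have := hN s hs
        rw [hNK] at this
        simp only [eval_mul, eval_pow, eval_sub, eval_X, eval_C] at this
        exact nonneg_of_mul_nonneg_right this (by have := sub_ne_zero.mpr hsx; positivity))
      have := hmul ((X - C x) ^ 2) K _ 0 σ τ (hsq (X - C x)) IsSumSq.zero h1 h2 (by simp) h3
      rwa [← hNK] at this
  · obtain ⟨K, hK⟩ := quadratic_dvd_of_aeval_eq_zero_im_ne_zero N hz him
    have hq : (X ^ 2 - C (2 * z.re) * X + C (‖z‖ ^ 2) : ℝ[X]) =
        (X - C z.re) ^ 2 + C (z.im ^ 2) := by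
      have : ‖z‖ ^ 2 = z.re ^ 2 + z.im ^ 2 := by
        rw [← Complex.normSq_eq_norm_sq, Complex.normSq_apply]; ring
      rw [this]; simp only [map_mul, map_add, map_pow, map_ofNat]; ring
    rw [hq] at hK
    have hK0 : K ≠ 0 := by rintro rfl; simp at hK; exact hN0 hK
    have hq0 : ((X - C z.re) ^ 2 + C (z.im ^ 2) : ℝ[X]).natDegree = 2 := by
      rw [natDegree_add_C, natDegree_pow, natDegree_X_sub_C]
    have hdK : N.natDegree = 2 + K.natDegree := by
      rw [hK, natDegree_mul (by intro h; rw [h] at hq0; simp at hq0) hK0, hq0]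
    obtain ⟨σ, τ, h1, h2, h3⟩ := ih (d - 1) (by omega) K (by omega) (fun s hs => by
      have := hN s hs
      rw [hK] at this
      simp only [eval_mul, eval_add, eval_pow, eval_sub, eval_X, eval_C] at this
      exact nonneg_of_mul_nonneg_right this (by positivity))
    have := hmul ((X - C z.re) ^ 2 + C (z.im ^ 2)) K _ 0 σ τ
      ((hsq (X - C z.re)).add (hC (z.im ^ 2) (by positivity))) IsSumSq.zero h1 h2
      (by rw [mul_zero, add_zero]) h3
    rwa [← hK] at this

theorem Polynomial.natDegree_le_natDegree_add {P Q : ℝ[X]} (hP : 0 ≤ P.leadingCoeff)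
    (hQ : 0 ≤ Q.leadingCoeff) :
    0 ≤ (P + Q).leadingCoeff ∧ P.natDegree ≤ (P + Q).natDegree ∧
      Q.natDegree ≤ (P + Q).natDegree := by
  rcases lt_trichotomy P.degree Q.degree with h | h | h
  · rw [leadingCoeff_add_of_degree_lt h, natDegree_add_eq_right_of_degree_lt h]
    exact ⟨hQ, natDegree_le_natDegree h.le, le_rfl⟩
  · by_cases hP0 : P = 0
    · simp [hP0, hQ]
    have hQ0 : Q ≠ 0 := by rintro rfl; simp at h; exact hP0 h
    have hlP := lt_of_le_of_ne hP (leadingCoeff_ne_zero.mpr hP0).symm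
    have hlQ := lt_of_le_of_ne hQ (leadingCoeff_ne_zero.mpr hQ0).symm
    have hne : P.leadingCoeff + Q.leadingCoeff ≠ 0 := by positivity
    have hd := degree_add_eq_of_leadingCoeff_add_ne_zero hne
    rw [h, max_self] at hd
    rw [leadingCoeff_add_of_degree_eq h hne, natDegree_eq_of_degree_eq hd,
      natDegree_eq_of_degree_eq h]
    exact ⟨by positivity, le_rfl, le_rfl⟩
  · rw [leadingCoeff_add_of_degree_lt' h, natDegree_add_eq_left_of_degree_lt h]
    exact ⟨hP, le_rfl, natDegree_le_natDegree h.le⟩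

theorem Polynomial.leadingCoeff_nonneg_of_isSumSq {σ : ℝ[X]} (h : IsSumSq σ) :
    0 ≤ σ.leadingCoeff := by
  induction h with
  | zero => simp
  | sq_add a _ ih =>
    exact (natDegree_le_natDegree_add (by rw [leadingCoeff_mul]; exact mul_self_nonneg _) ih).1

theorem Polynomial.map_nonneg_of_isSumSq {n : ℕ} (Λ : ℝ[X] →ₗ[ℝ] ℝ)
    (h : ∀ r : ℝ[X], r.natDegree < n → 0 ≤ Λ (r ^ 2)) {σ : ℝ[X]} (hσ : IsSumSq σ)
    (hd : σ.natDegree < 2 * n) : 0 ≤ Λ σ := by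
  induction hσ with
  | zero => simp
  | sq_add a hs ih =>
    obtain ⟨-, h1, h2⟩ := natDegree_le_natDegree_add (P := a * a)
      (by rw [leadingCoeff_mul]; exact mul_self_nonneg _) (leadingCoeff_nonneg_of_isSumSq hs)
    rw [map_add]
    refine add_nonneg ?_ (ih (by omega))
    rw [← pow_two]
    refine h a ?_
    rw [← pow_two, natDegree_pow] at h1
    rw [← pow_two] at hd
    omega

/-- A linear functional that is nonnegative on `r²` and `X r²` for `deg r < n` is nonnegative on
the polynomials of degree `< 2n` that are nonnegative on the half line. -/
theorem Polynomial.map_nonneg_of_eval_nonneg {n : ℕ} (Λ : ℝ[X] →ₗ[ℝ] ℝ)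
    (h1 : ∀ r : ℝ[X], r.natDegree < n → 0 ≤ Λ (r ^ 2))
    (h2 : ∀ r : ℝ[X], r.natDegree < n → 0 ≤ Λ (X * r ^ 2)) {N : ℝ[X]}
    (hd : N.natDegree < 2 * n) (hN : ∀ s, 0 < s → 0 ≤ N.eval s) : 0 ≤ Λ N := by
  obtain ⟨σ, τ, hσ, hτ, rfl⟩ := exists_isSumSq_of_nonneg _ N le_rfl hN
  obtain ⟨-, h3, h4⟩ := natDegree_le_natDegree_add (P := σ) (Q := X * τ)
    (leadingCoeff_nonneg_of_isSumSq hσ) (by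
      rw [leadingCoeff_mul, leadingCoeff_X, one_mul]; exact leadingCoeff_nonneg_of_isSumSq hτ)
  rw [map_add]
  refine add_nonneg (map_nonneg_of_isSumSq Λ h1 hσ (by omega)) ?_
  by_cases hτ0 : τ = 0
  · simp [hτ0]
  rw [natDegree_X_mul hτ0] at h4
  exact map_nonneg_of_isSumSq (Λ.comp (LinearMap.mulLeft ℝ X)) h2 hτ (by omega)

theorem dividedDiff_insert {S : Finset ℝ} {T : ℝ} (hT : T ∉ S) (G : ℝ → ℝ) :
    dividedDiff (insert T S) G =
      G T / ∏ u ∈ S, (T - u) + ∑ t ∈ S, G t / (∏ u ∈ S.erase t, (t - u)) * (t - T)⁻¹ := by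
  rw [dividedDiff, Finset.sum_insert hT, Finset.erase_insert hT]
  congr 1
  refine Finset.sum_congr rfl fun t ht => ?_
  have hne : T ≠ t := fun h => hT (h ▸ ht)
  rw [Finset.erase_insert_of_ne hne, Finset.prod_insert (by simp [hT])]
  rw [mul_comm, ← div_div, div_eq_mul_inv]

theorem sum_inv_sub_nonpos_of_dividedDiff_nonpos {n : ℕ} {F : ℝ → ℝ} (hF : ∀ t, 0 < t → 0 < F t)
    (hdd : ∀ S : Finset ℝ, (∀ t ∈ S, 0 < t) → S.card = 2 * n + 1 → ∀ r : ℝ[X], r.natDegree < n →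
      dividedDiff S (fun t => F t * r.eval t ^ 2) ≤ 0)
    {S : Finset ℝ} (hS : ∀ t ∈ S, 0 < t) (hcard : S.card = 2 * n)
    {r : ℝ[X]} (hr : r.natDegree < n) {T : ℝ}
    (hT : 0 < T) (hpos : 0 < ∏ u ∈ S, (T - u)) :
    ∑ t ∈ S, F t * r.eval t ^ 2 / (∏ u ∈ S.erase t, (t - u)) * (t - T)⁻¹ ≤ 0 := by
  have hTS : T ∉ S := fun h => by
    rw [Finset.prod_eq_zero h (sub_self T)] at hpos; exact lt_irrefl _ hpos
  have h := hdd (insert T S) (by simpa [hT] using hS) (by rw [Finset.card_insert_of_notMem hTS,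
    hcard]) r hr
  rw [dividedDiff_insert hTS] at h
  have : 0 ≤ F T * r.eval T ^ 2 / ∏ u ∈ S, (T - u) := by have := hF T hT; positivity
  linarith

theorem sum_div_nonpos_of_dividedDiff_nonpos {n : ℕ} {F : ℝ → ℝ} (hF : ∀ t, 0 < t → 0 < F t)
    (hdd : ∀ S : Finset ℝ, (∀ t ∈ S, 0 < t) → S.card = 2 * n + 1 → ∀ r : ℝ[X], r.natDegree < n →
      dividedDiff S (fun t => F t * r.eval t ^ 2) ≤ 0)
    {S : Finset ℝ} (hS : ∀ t ∈ S, 0 < t) (hcard : S.card = 2 * n)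
    {r : ℝ[X]} (hr : r.natDegree < n) :
    ∑ t ∈ S, F t * r.eval t ^ 2 / (∏ u ∈ S.erase t, (t - u)) * t⁻¹ ≤ 0 := by
  have hlim : Filter.Tendsto (fun T : ℝ =>
      ∑ t ∈ S, F t * r.eval t ^ 2 / (∏ u ∈ S.erase t, (t - u)) * (t - T)⁻¹)
      (nhdsWithin 0 (Set.Ioi 0))
      (nhds (∑ t ∈ S, F t * r.eval t ^ 2 / (∏ u ∈ S.erase t, (t - u)) * t⁻¹)) := by
    refine tendsto_finsetSum _ fun t ht => ?_
    refine Filter.Tendsto.const_mul _ ?_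
    have : ContinuousAt (fun T : ℝ => (t - T)⁻¹) 0 :=
      ContinuousAt.inv₀ (by fun_prop) (by simpa using (hS t ht).ne')
    simpa using this.tendsto.mono_left nhdsWithin_le_nhds
  refine le_of_tendsto hlim ?_
  have hev : ∀ᶠ T : ℝ in nhdsWithin 0 (Set.Ioi 0), ∀ u ∈ S, T < u := by
    refine nhdsWithin_le_nhds ?_
    exact (Finset.eventually_all S).mpr fun u hu => gt_mem_nhds (hS u hu)
  filter_upwards [hev, self_mem_nhdsWithin] with T hT hT0
  refine sum_inv_sub_nonpos_of_dividedDiff_nonpos hF hdd hS hcard hr hT0 ?_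
  have : ∏ u ∈ S, (T - u) = ∏ u ∈ S, (u - T) := by
    have h1 : ∀ u ∈ S, T - u = -1 * (u - T) := fun u _ => by ring
    rw [Finset.prod_congr rfl h1, Finset.prod_mul_distrib, Finset.prod_const, hcard]
    simp
  rw [this]
  exact Finset.prod_pos fun u hu => sub_pos.mpr (hT u hu)

theorem sum_nonneg_of_dividedDiff_nonpos {n : ℕ} {F : ℝ → ℝ} (hF : ∀ t, 0 < t → 0 < F t)
    (hdd : ∀ S : Finset ℝ, (∀ t ∈ S, 0 < t) → S.card = 2 * n + 1 → ∀ r : ℝ[X], r.natDegree < n →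
      dividedDiff S (fun t => F t * r.eval t ^ 2) ≤ 0)
    {S : Finset ℝ} (hS : ∀ t ∈ S, 0 < t) (hcard : S.card = 2 * n)
    {r : ℝ[X]} (hr : r.natDegree < n) :
    0 ≤ ∑ t ∈ S, F t * r.eval t ^ 2 / ∏ u ∈ S.erase t, (t - u) := by
  have hlim : Filter.Tendsto (fun T : ℝ =>
      T * ∑ t ∈ S, F t * r.eval t ^ 2 / (∏ u ∈ S.erase t, (t - u)) * (t - T)⁻¹)
      Filter.atTop
      (nhds (∑ t ∈ S, F t * r.eval t ^ 2 / (∏ u ∈ S.erase t, (t - u)) * (-1))) := by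
    simp_rw [Finset.mul_sum]
    refine tendsto_finsetSum _ fun t ht => ?_
    have h1 : Filter.Tendsto (fun T : ℝ => (t * T⁻¹ - 1)⁻¹) Filter.atTop (nhds (-1)) := by
      have := (tendsto_inv_atTop_zero (𝕜 := ℝ)).const_mul t |>.sub_const 1
      have := this.inv₀ (by norm_num)
      norm_num at this
      exact this
    refine (h1.const_mul _).congr' ?_
    filter_upwards [Filter.eventually_gt_atTop t, Filter.eventually_gt_atTop 0] with T hT hT0
    have : t - T ≠ 0 := by linarith
    have h2 : t * T⁻¹ - 1 = (t - T) / T := by field_simp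
    rw [h2]
    field_simp
  have : ∑ t ∈ S, F t * r.eval t ^ 2 / (∏ u ∈ S.erase t, (t - u)) * (-1) ≤ 0 := by
    refine le_of_tendsto hlim ?_
    have hev : ∀ᶠ T : ℝ in Filter.atTop, ∀ u ∈ S, u < T :=
      (Finset.eventually_all S).mpr fun u _ => Filter.eventually_gt_atTop u
    filter_upwards [hev, Filter.eventually_gt_atTop 0] with T hT hT0
    exact mul_nonpos_of_nonneg_of_nonpos hT0.le
      (sum_inv_sub_nonpos_of_dividedDiff_nonpos hF hdd hS hcard hr hT0
        (Finset.prod_pos fun u hu => sub_pos.mpr (hT u hu)))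
  rw [← Finset.sum_mul] at this
  linarith

/-- A functional supported on `2n` points that is nonnegative on all `t ↦ t / (t + s)` is
nonnegative on `F`. -/
theorem sum_mul_nonneg_of_dividedDiff_nonpos {n : ℕ} {F : ℝ → ℝ} (hF : ∀ t, 0 < t → 0 < F t)
    (hdd : ∀ S : Finset ℝ, (∀ t ∈ S, 0 < t) → S.card = 2 * n + 1 → ∀ r : ℝ[X], r.natDegree < n →
      dividedDiff S (fun t => F t * r.eval t ^ 2) ≤ 0)
    {S : Finset ℝ} (hS : ∀ t ∈ S, 0 < t) (hcard : S.card = 2 * n)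
    (a : ℝ → ℝ)
    (ha : ∀ s, 0 < s → 0 ≤ ∑ t ∈ S, a t * (t / (t + s))) : 0 ≤ ∑ t ∈ S, a t * F t := by
  rcases Nat.eq_zero_or_pos n with rfl | hn
  · have : S = ∅ := by simpa using hcard
    simp [this]
  set N : ℝ[X] := ∑ t ∈ S, C (a t * t) * ∏ u ∈ S.erase t, (X + C u) with hN
  have hNdeg : N.natDegree < 2 * n := by
    refine lt_of_le_of_lt (b := 2 * n - 1) ?_ (by omega)
    refine natDegree_sum_le_of_forall_le _ _ fun t ht => ?_
    refine (natDegree_C_mul_le _ _).trans ((natDegree_prod_le _ _).trans ?_)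
    simp [Finset.card_erase_of_mem ht, hcard]
  have hNpos : ∀ s, 0 < s → 0 ≤ N.eval s := by
    intro s hs
    have hprod : 0 < ∏ u ∈ S, (s + u) := Finset.prod_pos fun u hu => by
      have := hS u hu; positivity
    have : N.eval s = (∏ u ∈ S, (s + u)) * ∑ t ∈ S, a t * (t / (t + s)) := by
      rw [hN, eval_finsetSum, Finset.mul_sum]
      refine Finset.sum_congr rfl fun t ht => ?_
      have ht0 := hS t ht
      rw [← Finset.mul_prod_erase S _ ht]
      simp only [eval_mul, eval_C, eval_prod, eval_add, eval_X]
      have : t + s ≠ 0 := by positivity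
      have : s + t ≠ 0 := by positivity
      field_simp
      ring
    rw [this]
    exact mul_nonneg hprod.le (ha s hs)
  let Λ : ℝ[X] →ₗ[ℝ] ℝ := ∑ t ∈ S,
    (-(F t / (∏ u ∈ S.erase t, (t - u)) * t⁻¹)) • (leval (-t))
  have hΛ : ∀ p, Λ p = -∑ t ∈ S, F t * p.eval (-t) / (∏ u ∈ S.erase t, (t - u)) * t⁻¹ := by
    intro p
    simp only [Λ, LinearMap.sum_apply, LinearMap.smul_apply, leval_apply, smul_eq_mul,
      ← Finset.sum_neg_distrib]
    refine Finset.sum_congr rfl fun t ht => ?_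
    ring
  have hcomp : ∀ r : ℝ[X], r.natDegree < n → (r.comp (-X)).natDegree < n := fun r hr => by
    rw [natDegree_comp, natDegree_neg, natDegree_X, mul_one]; exact hr
  have hmain : 0 ≤ Λ N := by
    refine map_nonneg_of_eval_nonneg Λ (fun r hr => ?_) (fun r hr => ?_) hNdeg hNpos
    · have := sum_div_nonpos_of_dividedDiff_nonpos hF hdd hS hcard (hcomp r hr)
      rw [hΛ]
      simpa using this
    · have := sum_nonneg_of_dividedDiff_nonpos hF hdd hS hcard (hcomp r hr)
      rw [hΛ, ← Finset.sum_neg_distrib]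
      refine this.trans_eq (Finset.sum_congr rfl fun t ht => ?_)
      have := (hS t ht).ne'
      simp only [eval_mul, eval_X, eval_pow, eval_comp, eval_neg]
      field_simp
  rw [hΛ, ← Finset.sum_neg_distrib] at hmain
  refine hmain.trans_eq (Finset.sum_congr rfl fun t ht => ?_)
  have hNt : N.eval (-t) = -(a t * t * ∏ u ∈ S.erase t, (t - u)) := by
    rw [hN, eval_finsetSum, Finset.sum_eq_single_of_mem t ht]
    · simp only [eval_mul, eval_C, eval_prod, eval_add, eval_X]
      have h1 : ∀ u ∈ S.erase t, -t + u = -1 * (t - u) := fun u _ => by ring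
      rw [Finset.prod_congr rfl h1, Finset.prod_mul_distrib, Finset.prod_const,
        Finset.card_erase_of_mem ht, hcard, Odd.neg_one_pow ⟨n - 1, by omega⟩]
      ring
    · intro u hu hut
      rw [eval_mul, eval_prod, Finset.prod_eq_zero (i := t)]
      · simp
      · simp [ht, hut.symm]
      · simp
  have hD : ∏ u ∈ S.erase t, (t - u) ≠ 0 := by
    refine Finset.prod_ne_zero_iff.mpr fun u hu => sub_ne_zero.mpr ?_
    exact (Finset.ne_of_mem_erase hu).symm
  have := (hS t ht).ne'
  rw [hNt]
  field_simp

/-- First order term of `(J + B) ^ k` in `B`. -/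
def powDerivOne {R : Type*} [Ring R] (J B : R) : ℕ → R
  | 0 => 0
  | k + 1 => J * powDerivOne J B k + B * J ^ k

/-- Second order term of `(J + B) ^ k` in `B`. -/
def powDerivTwo {R : Type*} [Ring R] (J B : R) : ℕ → R
  | 0 => 0
  | k + 1 => J * powDerivTwo J B k + B * powDerivOne J B k

section powDeriv

theorem powDerivOne_neg {R : Type*} [Ring R] (J B : R) (k : ℕ) :
    powDerivOne J (-B) k = -powDerivOne J B k := by
  induction k with
  | zero => simp [powDerivOne]
  | succ k ih => rw [powDerivOne, powDerivOne, ih]; noncomm_ring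

theorem powDerivTwo_neg {R : Type*} [Ring R] (J B : R) (k : ℕ) :
    powDerivTwo J (-B) k = powDerivTwo J B k := by
  induction k with
  | zero => simp [powDerivTwo]
  | succ k ih => rw [powDerivTwo, powDerivTwo, ih, powDerivOne_neg]; noncomm_ring

theorem powDerivOne_smul {R : Type*} [Ring R] [Algebra ℝ R] (J B : R) (s : ℝ) (k : ℕ) :
    powDerivOne J (s • B) k = s • powDerivOne J B k := by
  induction k with
  | zero => simp [powDerivOne]
  | succ k ih => rw [powDerivOne, powDerivOne, ih]; simp [smul_add]

theorem powDerivTwo_smul {R : Type*} [Ring R] [Algebra ℝ R] (J B : R) (s : ℝ) (k : ℕ) :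
    powDerivTwo J (s • B) k = s ^ 2 • powDerivTwo J B k := by
  induction k with
  | zero => simp [powDerivTwo]
  | succ k ih =>
    rw [powDerivTwo, powDerivTwo, ih, powDerivOne_smul]
    simp [smul_add, smul_smul, pow_two]

variable {R : Type*} [NormedRing R]

theorem exists_norm_powDerivOne_le (J : R) (k : ℕ) :
    ∃ C, 0 ≤ C ∧ ∀ B, ‖powDerivOne J B k‖ ≤ C * ‖B‖ := by
  induction k with
  | zero => exact ⟨0, le_rfl, fun B => by simp [powDerivOne]⟩
  | succ k ih =>
    obtain ⟨C, hC, h⟩ := ih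
    refine ⟨‖J‖ * C + ‖J ^ k‖, by positivity, fun B => ?_⟩
    calc _ ≤ ‖J‖ * ‖powDerivOne J B k‖ + ‖B‖ * ‖J ^ k‖ :=
          (norm_add_le _ _).trans (add_le_add (norm_mul_le _ _) (norm_mul_le _ _))
      _ ≤ ‖J‖ * (C * ‖B‖) + ‖B‖ * ‖J ^ k‖ := by gcongr; exact h B
      _ = _ := by ring

theorem exists_norm_powDerivTwo_le (J : R) (k : ℕ) :
    ∃ C, 0 ≤ C ∧ ∀ B, ‖powDerivTwo J B k‖ ≤ C * ‖B‖ ^ 2 := by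
  induction k with
  | zero => exact ⟨0, le_rfl, fun B => by simp [powDerivTwo]⟩
  | succ k ih =>
    obtain ⟨C, hC, h⟩ := ih
    obtain ⟨C', hC', h'⟩ := exists_norm_powDerivOne_le J k
    refine ⟨‖J‖ * C + C', by positivity, fun B => ?_⟩
    calc _ ≤ ‖J‖ * ‖powDerivTwo J B k‖ + ‖B‖ * ‖powDerivOne J B k‖ :=
          (norm_add_le _ _).trans (add_le_add (norm_mul_le _ _) (norm_mul_le _ _))
      _ ≤ ‖J‖ * (C * ‖B‖ ^ 2) + ‖B‖ * (C' * ‖B‖) := by gcongr; exacts [h B, h' B]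
      _ = _ := by ring

theorem exists_norm_add_pow_sub_le (J : R) (k : ℕ) :
    ∃ C, 0 ≤ C ∧ ∀ B, ‖B‖ ≤ 1 →
      ‖(J + B) ^ k - J ^ k - powDerivOne J B k - powDerivTwo J B k‖ ≤ C * ‖B‖ ^ 3 := by
  induction k with
  | zero => exact ⟨0, le_rfl, fun B _ => by simp [powDerivOne, powDerivTwo]⟩
  | succ k ih =>
    obtain ⟨C, hC, h⟩ := ih
    obtain ⟨C', hC', h'⟩ := exists_norm_powDerivTwo_le J k
    refine ⟨(‖J‖ + 1) * C + C', by positivity, fun B hB => ?_⟩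
    have : (J + B) ^ (k + 1) - J ^ (k + 1) - powDerivOne J B (k + 1) - powDerivTwo J B (k + 1) =
        (J + B) * ((J + B) ^ k - J ^ k - powDerivOne J B k - powDerivTwo J B k) +
          B * powDerivTwo J B k := by
      rw [powDerivOne, powDerivTwo, pow_succ', pow_succ']
      noncomm_ring
    rw [this]
    calc _ ≤ ‖J + B‖ * ‖(J + B) ^ k - J ^ k - powDerivOne J B k - powDerivTwo J B k‖ +
          ‖B‖ * ‖powDerivTwo J B k‖ :=
          (norm_add_le _ _).trans (add_le_add (norm_mul_le _ _) (norm_mul_le _ _))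
      _ ≤ (‖J‖ + 1) * (C * ‖B‖ ^ 3) + ‖B‖ * (C' * ‖B‖ ^ 2) := by
          gcongr
          · exact (norm_add_le _ _).trans (by gcongr)
          · exact h B hB
          · exact h' B
      _ = _ := by ring

theorem exists_norm_second_diff_pow_le (J : R) (k : ℕ) :
    ∃ C, 0 ≤ C ∧ ∀ B, ‖B‖ ≤ 1 →
      ‖(J + B) ^ k + (J - B) ^ k - (2 : ℤ) • J ^ k - (2 : ℤ) • powDerivTwo J B k‖ ≤
        C * ‖B‖ ^ 3 := by
  obtain ⟨C, hC, h⟩ := exists_norm_add_pow_sub_le J k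
  refine ⟨C + C, by positivity, fun B hB => ?_⟩
  have h1 := h B hB
  have h2 := h (-B) (by simpa using hB)
  rw [powDerivOne_neg, powDerivTwo_neg, norm_neg, ← sub_eq_add_neg] at h2
  have : (J + B) ^ k + (J - B) ^ k - (2 : ℤ) • J ^ k - (2 : ℤ) • powDerivTwo J B k =
      ((J + B) ^ k - J ^ k - powDerivOne J B k - powDerivTwo J B k) +
      ((J - B) ^ k - J ^ k - -powDerivOne J B k - powDerivTwo J B k) := by
    rw [two_zsmul, two_zsmul]; abel
  rw [this, add_mul]
  exact (norm_add_le _ _).trans (add_le_add h1 h2)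

end powDeriv

theorem powDerivOne_apply_of_forall {J V : H →L[ℂ] H} {x e u : H} {θ : ℕ → ℝ} {δ : ℝ}
    (hJe : J e = 0)
    (hV0 : V x = (θ 0 : ℂ) • e + (δ : ℂ) • u)
    (hV : ∀ k, V ((J ^ (k + 1)) x) = (θ (k + 1) : ℂ) • e) (k : ℕ) :
    powDerivOne J V (k + 1) x = (θ k : ℂ) • e + (δ : ℂ) • (J ^ k) u := by
  induction k with
  | zero => simp [powDerivOne, hV0]
  | succ k ih =>
    rw [powDerivOne, add_apply, mul_apply_eq_comp,
      mul_apply_eq_comp, ih, hV, map_add, map_smul, map_smul, hJe, pow_succ' J k,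
      mul_apply_eq_comp]
    module

theorem inner_powDerivTwo_apply {J V : H →L[ℂ] H} (hJ : IsSelfAdjoint J) (hVsa : IsSelfAdjoint V)
    {x e u : H} {θ : ℕ → ℝ} {δ : ℝ} (hJe : J e = 0) (hee : inner ℂ e e = 1)
    (heu : inner ℂ e u = 0)
    (hV0 : V x = (θ 0 : ℂ) • e + (δ : ℂ) • u)
    (hV : ∀ k, V ((J ^ (k + 1)) x) = (θ (k + 1) : ℂ) • e) (k : ℕ) : ∀ q : ℕ,
    inner ℂ ((J ^ q) x) (powDerivTwo J V (k + 2) x) =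
      (∑ j ∈ Finset.range (k + 1), θ (k - j) * θ (q + j) : ℝ) +
        if q = 0 then (δ : ℂ) ^ 2 * inner ℂ u ((J ^ k) u) else 0 := by
  have hue : inner ℂ u e = 0 := by rw [← inner_conj_symm, heu, map_zero]
  have hJmove : ∀ v w, inner ℂ v (J w) = inner ℂ (J v) w := fun v w => by
    rw [← ContinuousLinearMap.adjoint_inner_left, ← ContinuousLinearMap.star_eq_adjoint, hJ.star_eq]
  have hVmove : ∀ v w, inner ℂ v (V w) = inner ℂ (V v) w := fun v w => by
    rw [← ContinuousLinearMap.adjoint_inner_left, ← ContinuousLinearMap.star_eq_adjoint,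
      hVsa.star_eq]
  have heJ : ∀ k, inner ℂ e ((J ^ k) u) = 0 := by
    intro k
    cases k with
    | zero => simpa using heu
    | succ k => rw [pow_succ', mul_apply_eq_comp, hJmove, hJe, inner_zero_left]
  have hstep : ∀ k q, inner ℂ ((J ^ q) x) (powDerivTwo J V (k + 2) x) =
      inner ℂ ((J ^ (q + 1)) x) (powDerivTwo J V (k + 1) x) + ((θ k * θ q : ℝ) +
        if q = 0 then (δ : ℂ) ^ 2 * inner ℂ u ((J ^ k) u) else 0) := by
    intro k q
    rw [powDerivTwo, add_apply, mul_apply_eq_comp,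
      mul_apply_eq_comp, inner_add_right, hJmove, ← mul_apply_eq_comp J,
      ← pow_succ', hVmove, powDerivOne_apply_of_forall hJe hV0 hV]
    congr 1
    cases q with
    | zero =>
      rw [pow_zero, one_apply_eq_self, hV0]
      simp only [inner_add_left, inner_add_right, inner_smul_left, inner_smul_right, hee, heJ, hue]
      simp
      ring
    | succ q =>
      rw [hV]
      simp only [inner_add_right, inner_smul_left, inner_smul_right, hee, heJ]
      simp
  induction k with
  | zero =>
    intro q
    rw [hstep]
    simp [powDerivTwo, powDerivOne]
  | succ k ih =>
    intro q
    rw [hstep, ih, Finset.sum_range_succ' _ (k + 1)]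
    simp only [Nat.add_sub_add_right, Nat.sub_zero, add_zero]
    simp only [Nat.add_eq_zero_iff, one_ne_zero, and_false, if_false, add_zero]
    push_cast
    rw [add_assoc]
    congr 1
    refine Finset.sum_congr rfl fun j _ => ?_
    rw [add_assoc, add_comm 1 j]

theorem isSelfAdjoint_rankOne_add (a b : H) :
    IsSelfAdjoint (InnerProductSpace.rankOne ℂ a b + InnerProductSpace.rankOne ℂ b a) := by
  rw [IsSelfAdjoint, ContinuousLinearMap.star_eq_adjoint, map_add,
    InnerProductSpace.adjoint_rankOne, InnerProductSpace.adjoint_rankOne, add_comm]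

theorem isSelfAdjoint_rankOne_self (a : H) :
    IsSelfAdjoint (InnerProductSpace.rankOne ℂ a a) := by
  rw [IsSelfAdjoint, ContinuousLinearMap.star_eq_adjoint, InnerProductSpace.adjoint_rankOne]

theorem exists_dual_powers (m : ℕ) : ∃ z : ℕ → Fin (m + 1) → ℝ, ∀ l, l ≤ m → ∀ p, p ≤ m →
    ∑ i : Fin (m + 1), (i : ℝ) ^ p * z l i = if p = l then 1 else 0 := by
  let v : Fin (m + 1) → ℝ := fun i => (i : ℝ)
  have hdet : (Matrix.vandermonde v).det ≠ 0 := by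
    rw [Matrix.det_vandermonde_ne_zero_iff]
    intro i j h
    exact Fin.ext (by simpa [v] using h)
  have hmul := Matrix.nonsing_inv_mul _ (isUnit_iff_ne_zero.mpr hdet)
  refine ⟨fun l i => if hl : l < m + 1 then (Matrix.vandermonde v)⁻¹ ⟨l, hl⟩ i else 0, ?_⟩
  intro l hl p hp
  have h := congrFun (congrFun hmul ⟨l, by omega⟩) ⟨p, by omega⟩
  rw [Matrix.mul_apply, Matrix.one_apply] at h
  simp only [Matrix.vandermonde_apply, Fin.mk.injEq, v] at h
  simp only [show l < m + 1 by omega, dif_pos, eq_comm (a := p)]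
  rw [← h]
  exact Finset.sum_congr rfl fun i _ => mul_comm _ _

theorem exists_number_operator [FiniteDimensional ℂ H] {m : ℕ}
    (hn : Module.finrank ℂ H = m + 1) :
    ∃ (J : H →L[ℂ] H) (vec : (Fin (m + 1) → ℝ) → H), IsSelfAdjoint J ∧
      (∀ k y, (J ^ k) (vec y) = vec (fun i => (i : ℝ) ^ k * y i)) ∧
      (∀ y y', inner ℂ (vec y) (vec y') = ((∑ i, y i * y' i : ℝ) : ℂ)) ∧
      ∀ y, ‖vec y‖ ≤ ∑ i, |y i| := by
  let b : OrthonormalBasis (Fin (m + 1)) ℂ H :=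
    (stdOrthonormalBasis ℂ H).reindex (finCongr hn)
  have hb : ∀ i j, inner ℂ (b i) (b j) = if i = j then (1 : ℂ) else 0 :=
    fun i j => orthonormal_iff_ite.mp b.orthonormal i j
  let J : H →L[ℂ] H := ∑ i : Fin (m + 1), (i : ℝ) • InnerProductSpace.rankOne ℂ (b i) (b i)
  have hJ : IsSelfAdjoint J :=
    isSelfAdjoint_sum _ fun i _ => (IsSelfAdjoint.all _).smul (isSelfAdjoint_rankOne_self (b i))
  have hJb : ∀ i, J (b i) = (i : ℂ) • b i := by
    intro i
    simp only [J, sum_apply, smul_apply,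
      InnerProductSpace.rankOne_apply, hb]
    rw [Finset.sum_eq_single_of_mem i (Finset.mem_univ i)]
    · simp [← Complex.coe_smul]
    · intro j _ hji
      simp [hji]
  let vec : (Fin (m + 1) → ℝ) → H := fun y => ∑ i, (y i : ℂ) • b i
  have hJvec : ∀ k y, (J ^ k) (vec y) = vec (fun i => (i : ℝ) ^ k * y i) := by
    intro k
    induction k with
    | zero => intro y; simp
    | succ k ih =>
      intro y
      rw [pow_succ, mul_apply_eq_comp]
      have : J (vec y) = vec (fun i => (i : ℝ) * y i) := by
        simp only [vec, map_sum, map_smul, hJb, smul_smul]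
        refine Finset.sum_congr rfl fun i _ => ?_
        push_cast
        rw [mul_comm]
      rw [this, ih]
      congr 1
      funext i
      ring
  have hinner : ∀ y y', inner ℂ (vec y) (vec y') = ((∑ i, y i * y' i : ℝ) : ℂ) := by
    intro y y'
    simp only [vec, sum_inner, inner_sum, inner_smul_left, inner_smul_right, hb]
    push_cast
    refine Finset.sum_congr rfl fun i _ => ?_
    simp [mul_comm]
  have hvecnorm : ∀ y, ‖vec y‖ ≤ ∑ i, |y i| := by
    intro y
    refine (norm_sum_le _ _).trans (le_of_eq (Finset.sum_congr rfl fun i _ => ?_))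
    rw [norm_smul, b.orthonormal.1 i]
    simp
  exact ⟨J, vec, hJ, hJvec, hinner, hvecnorm⟩

/-- Rank two perturbations and test vectors that isolate prescribed Hankel sections. -/
theorem exists_perturbation_family [FiniteDimensional ℂ H] {m : ℕ}
    (hn : Module.finrank ℂ H = m + 1) (ρ : ℕ → ℝ) :
    ∃ (J : H →L[ℂ] H) (ω : ℕ → ℝ) (C : ℝ) (K : ℕ → ℝ), IsSelfAdjoint J ∧ 0 < C ∧
      ∀ ε : ℝ, 0 < ε → ε ≤ 1 → ∃ (V : H →L[ℂ] H) (x : H) (θ : ℕ → ℝ), IsSelfAdjoint V ∧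
        ‖x‖ ≤ C ∧ ε ^ (m + 1) * ‖V‖ ≤ C ∧ (∀ p, |θ p| ≤ K p) ∧
        (∀ p, p ≤ m → ε ^ (p + 1) * θ p = ε ^ (m + 1) * ρ p) ∧
        ∀ k, (inner ℂ x (powDerivTwo J V (k + 2) x)).re =
          ∑ j ∈ Finset.range (k + 1), θ (k - j) * θ j + (ε ^ (m + 1)) ^ 2 * ω k := by
  obtain ⟨z, hz⟩ := exists_dual_powers m
  obtain ⟨J, vec, hJ, hJvec, hinner, hvecnorm⟩ := exists_number_operator hn
  obtain ⟨e, he⟩ : ∃ e : H, e = vec (Pi.single 0 1) := ⟨_, rfl⟩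
  obtain ⟨u, hu⟩ : ∃ u : H, u = vec (fun i => if i = 0 then 0 else 1) := ⟨_, rfl⟩
  have hJe : J e = 0 := by
    have h0 : vec 0 = 0 := by simpa using hvecnorm 0
    have := hJvec 1 (Pi.single 0 1)
    rw [pow_one, ← he] at this
    rw [this, ← h0]
    congr 1
    funext i
    by_cases h : i = 0 <;> simp [h]
  have hee : inner ℂ e e = 1 := by
    rw [he, hinner, Finset.sum_eq_single_of_mem 0 (Finset.mem_univ _)]
    · simp
    · intro j _ hj; simp [hj]
  have heu : inner ℂ e u = 0 := by
    simp only [he, hu, hinner]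
    rw [Finset.sum_eq_zero]
    · simp
    · intro i _
      by_cases h : i = 0 <;> simp [h]
  let Y : Fin (m + 1) → ℝ := fun i => ∑ l ∈ Finset.range (m + 1), |ρ l| * |z l i|
  have hY : ∀ i, 0 ≤ Y i := fun i => Finset.sum_nonneg fun l _ => by positivity
  refine ⟨J, fun k => (inner ℂ u ((J ^ k) u)).re, 1 + ∑ i, Y i + Y 0 * ‖e‖ ^ 2 + 2 * ‖e‖ * ‖u‖,
    fun p => ∑ i : Fin (m + 1), (i : ℝ) ^ p * Y i, hJ, ?_, ?_⟩
  · have : 0 ≤ ∑ i, Y i := Finset.sum_nonneg fun i _ => hY i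
    have := hY 0
    positivity
  intro ε hε hε1
  let y : Fin (m + 1) → ℝ := fun i => ∑ l ∈ Finset.range (m + 1), ε ^ (m - l) * ρ l * z l i
  have hyY : ∀ i, |y i| ≤ Y i := by
    intro i
    refine (Finset.abs_sum_le_sum_abs _ _).trans (Finset.sum_le_sum fun l _ => ?_)
    rw [abs_mul, abs_mul, abs_of_pos (pow_pos hε _)]
    have : ε ^ (m - l) ≤ 1 := pow_le_one₀ hε.le hε1
    calc _ ≤ 1 * |ρ l| * |z l i| := by gcongr
      _ = _ := by ring
  let δ : ℝ := ε ^ (m + 1)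
  have hδ : 0 < δ := pow_pos hε _
  have hδ1 : δ ≤ 1 := pow_le_one₀ hε.le hε1
  let x : H := vec (Function.update y 0 δ)
  let θ : ℕ → ℝ := fun p => ∑ i : Fin (m + 1), (i : ℝ) ^ p * y i
  let V : H →L[ℂ] H := (y 0 / δ) • InnerProductSpace.rankOne ℂ e e +
    (InnerProductSpace.rankOne ℂ e u + InnerProductSpace.rankOne ℂ u e)
  have hVsa : IsSelfAdjoint V :=
    ((IsSelfAdjoint.all _).smul (isSelfAdjoint_rankOne_self e)).add (isSelfAdjoint_rankOne_add e u)
  have hVw : ∀ w, V w = (((y 0 / δ : ℝ) : ℂ) * inner ℂ e w + inner ℂ u w) • e +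
      inner ℂ e w • u := by
    intro w
    simp only [V, add_apply, smul_apply,
      InnerProductSpace.rankOne_apply, add_smul, mul_smul, Complex.coe_smul]
    module
  have hV0 : V x = (θ 0 : ℂ) • e + (δ : ℂ) • u := by
    have h1 : inner ℂ e x = (δ : ℂ) := by
      simp only [he, x, hinner]
      rw [Finset.sum_eq_single_of_mem 0 (Finset.mem_univ _)]
      · simp
      · intro j _ hj; simp [hj]
    have h2 : inner ℂ u x = ((∑ i ∈ Finset.univ.erase 0, y i : ℝ) : ℂ) := by
      simp only [hu, x, hinner]
      rw [← Finset.add_sum_erase _ _ (Finset.mem_univ (0 : Fin (m + 1)))]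
      congr 1
      rw [if_pos rfl, zero_mul, zero_add]
      refine Finset.sum_congr rfl fun i hi => ?_
      have := Finset.ne_of_mem_erase hi
      simp [this]
    rw [hVw, h1, h2]
    congr 2
    simp only [θ]
    rw [← Finset.add_sum_erase _ _ (Finset.mem_univ (0 : Fin (m + 1)))]
    have : (δ : ℂ) ≠ 0 := by exact_mod_cast hδ.ne'
    push_cast
    field_simp
  have hV : ∀ k, V ((J ^ (k + 1)) x) = (θ (k + 1) : ℂ) • e := by
    intro k
    have h1 : inner ℂ e ((J ^ (k + 1)) x) = 0 := by
      simp only [he, x, hJvec, hinner]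
      rw [Finset.sum_eq_zero]
      · simp
      · intro j _
        by_cases h : j = 0 <;> simp [h]
    have h2 : inner ℂ u ((J ^ (k + 1)) x) = (θ (k + 1) : ℂ) := by
      simp only [hu, x, hJvec, hinner, θ]
      congr 1
      refine Finset.sum_congr rfl fun i _ => ?_
      by_cases h : i = 0 <;> simp [h]
    rw [hVw, h1, h2]
    simp
  have hθ : ∀ p, |θ p| ≤ ∑ i : Fin (m + 1), (i : ℝ) ^ p * Y i := by
    intro p
    refine (Finset.abs_sum_le_sum_abs _ _).trans (Finset.sum_le_sum fun i _ => ?_)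
    rw [abs_mul, abs_of_nonneg (by positivity)]
    gcongr
    exact hyY i
  have hsumY : 0 ≤ ∑ i, Y i := Finset.sum_nonneg fun i _ => hY i
  have hY0 := hY 0
  refine ⟨V, x, θ, hVsa, ?_, ?_, hθ, ?_, ?_⟩
  · have : ‖x‖ ≤ 1 + ∑ i, Y i := by
      refine (hvecnorm _).trans ?_
      rw [← Finset.add_sum_erase _ _ (Finset.mem_univ (0 : Fin (m + 1)))]
      refine add_le_add (by simpa [abs_of_pos hδ] using hδ1) ?_
      refine (Finset.sum_le_sum (g := Y) fun i hi => ?_).trans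
        (Finset.sum_le_sum_of_subset_of_nonneg (Finset.subset_univ _) fun i _ _ => hY i)
      rw [Function.update_of_ne (Finset.ne_of_mem_erase hi)]
      exact hyY i
    have : 0 ≤ Y 0 * ‖e‖ ^ 2 := by positivity
    have : 0 ≤ 2 * ‖e‖ * ‖u‖ := by positivity
    linarith
  · have h1 : ‖V‖ ≤ |y 0| / δ * ‖e‖ ^ 2 + 2 * ‖e‖ * ‖u‖ := by
      refine (norm_add_le _ _).trans (add_le_add ?_ ((norm_add_le _ _).trans ?_))
      · rw [norm_smul, InnerProductSpace.norm_rankOne, Real.norm_eq_abs, abs_div, abs_of_pos hδ,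
          pow_two]
      · rw [InnerProductSpace.norm_rankOne, InnerProductSpace.norm_rankOne]
        exact le_of_eq (by ring)
    calc δ * ‖V‖ ≤ δ * (|y 0| / δ * ‖e‖ ^ 2 + 2 * ‖e‖ * ‖u‖) := by gcongr
      _ = |y 0| * ‖e‖ ^ 2 + δ * (2 * ‖e‖ * ‖u‖) := by field_simp
      _ ≤ Y 0 * ‖e‖ ^ 2 + 1 * (2 * ‖e‖ * ‖u‖) := by gcongr; exact hyY 0
      _ ≤ _ := by linarith
  · intro p hp
    have : θ p = ε ^ (m - p) * ρ p := by
      simp only [θ, y, Finset.mul_sum]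
      rw [Finset.sum_comm]
      have h1 : ∀ l ∈ Finset.range (m + 1),
          ∑ i : Fin (m + 1), (i : ℝ) ^ p * (ε ^ (m - l) * ρ l * z l i) =
            if p = l then ε ^ (m - l) * ρ l else 0 := by
        intro l hl
        have := hz l (by simpa [Nat.lt_succ_iff] using hl) p hp
        calc _ = ε ^ (m - l) * ρ l * ∑ i : Fin (m + 1), (i : ℝ) ^ p * z l i := by
              rw [Finset.mul_sum]; exact Finset.sum_congr rfl fun i _ => by ring
          _ = _ := by rw [this]; simp
      rw [Finset.sum_congr rfl h1, Finset.sum_ite_eq, if_pos (by simp; omega)]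
    rw [this, ← mul_assoc, ← pow_add]
    congr 2
    omega
  · intro k
    have := inner_powDerivTwo_apply hJ hVsa hJe hee heu hV0 hV k 0
    rw [pow_zero, one_apply_eq_self, if_pos rfl] at this
    rw [this, Complex.add_re, Complex.ofReal_re]
    congr 1
    · simp
    · rw [← Complex.ofReal_pow, Complex.re_ofReal_mul]

theorem abs_re_inner_apply_le (T : H →L[ℂ] H) (x : H) :
    |(inner ℂ x (T x)).re| ≤ ‖T‖ * ‖x‖ ^ 2 := by
  refine (Complex.abs_re_le_norm _).trans ((norm_inner_le_norm _ _).trans ?_)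
  calc ‖x‖ * ‖T x‖ ≤ ‖x‖ * (‖T‖ * ‖x‖) := by gcongr; exact T.le_opNorm x
    _ = _ := by ring

theorem norm_cfc_sub_sum_smul_pow_le {G : ℝ → ℝ} {c : ℕ → ℝ} (hG : Continuous G) {N : ℕ}
    {K r : ℝ} (hK : 0 ≤ K)
    (hT : ∀ t, |t| ≤ r → |G t - ∑ k ∈ Finset.range N, c k * t ^ k| ≤ K * |t| ^ N)
    {X : H →L[ℂ] H} (hX : IsSelfAdjoint X) (hXr : ‖X‖ ≤ r) :
    ‖cfc G X - ∑ k ∈ Finset.range N, c k • X ^ k‖ ≤ K * ‖X‖ ^ N := by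
  have h1 : ∑ k ∈ Finset.range N, c k • X ^ k =
      cfc (fun t => ∑ k ∈ Finset.range N, c k * t ^ k) X := by
    have h := cfc_sum (fun (k : ℕ) (t : ℝ) => c k * t ^ k) X (Finset.range N)
      (fun k _ => by fun_prop)
    rw [Finset.sum_fn] at h
    rw [h]
    refine Finset.sum_congr rfl fun k _ => ?_
    rw [cfc_const_mul (c k) (fun t => t ^ k) X (by fun_prop), cfc_pow_id X k]
  rw [h1, ← cfc_sub G _ X (by fun_prop) (by fun_prop)]
  refine norm_cfc_le (by positivity) fun t ht => ?_
  have : |t| ≤ ‖X‖ := by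
    rcases subsingleton_or_nontrivial H with h | h
    · rw [spectrum.of_subsingleton] at ht; exact ht.elim
    simpa using spectrum.norm_le_norm_of_mem ht
  refine (hT t (this.trans hXr)).trans ?_
  gcongr

theorem sum_coeff_sq_nonpos_of_midpoint_concave [FiniteDimensional ℂ H] {m : ℕ}
    (hn : Module.finrank ℂ H = m + 1) {G : ℝ → ℝ} {c : ℕ → ℝ} (hG : Continuous G)
    (hT : ∀ N : ℕ, ∃ K r, 0 ≤ K ∧ 0 < r ∧
      ∀ t, |t| ≤ r → |G t - ∑ k ∈ Finset.range N, c k * t ^ k| ≤ K * |t| ^ N)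
    {r₀ : ℝ} (hr₀ : 0 < r₀)
    (hconc : ∀ X B : H →L[ℂ] H, IsSelfAdjoint X → IsSelfAdjoint B → ‖X‖ ≤ r₀ → ‖B‖ ≤ r₀ → ∀ x : H,
      (inner ℂ x (cfc G (X + B) x)).re + (inner ℂ x (cfc G (X - B) x)).re ≤
        2 * (inner ℂ x (cfc G X x)).re)
    {Q : ℝ[X]} (hQ : Q.natDegree ≤ m) :
    ∑ k ∈ Finset.range (2 * m + 1), c (k + 2) * (Q * Q).coeff k ≤ 0 := by
  obtain ⟨J, ω, C, D, hJ, hC, hfam⟩ := exists_perturbation_family hn Q.coeff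
  set b := 5 * (m + 1) + 1 with hb
  set N := 2 * (m + 1) + 2 * b - 1 with hN
  obtain ⟨K, r, hK, hr, hKr⟩ := hT (N + 2)
  choose E hE0 hE using exists_norm_second_diff_pow_le J
  set L := ‖J‖ + 1 with hL
  have hLpos : 0 < L := by positivity
  set M := 4 * K * L ^ (N + 2) * C ^ 2 + ∑ k ∈ Finset.range (N + 2), |c k| * (E k * C ^ 5) with hM
  -- the quantitative inequality
  have key : ∀ ε : ℝ, 0 < ε → ε ≤ 1 → ε * C ≤ 1 → ε * L ≤ r → ε * L ≤ r₀ →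
      ∃ η : ℕ → ℝ, (∀ p, p ≤ m → η p = Q.coeff p) ∧ (∀ p, m < p → |η p| ≤ ε * D p) ∧
      ∑ k ∈ Finset.range N, c (k + 2) * (2 * (∑ j ∈ Finset.range (k + 1), η (k - j) * η j +
        ε ^ (k + 2) * ω k)) ≤ M * ε := by
    intro ε hε hε1 hεC hεr hεr₀
    obtain ⟨V, x, θ, hV, hx, hVn, hθ, hθ', hD2⟩ := hfam ε hε hε1
    set W := ε ^ b • V with hW
    have hWsa : IsSelfAdjoint W := (IsSelfAdjoint.all _).smul hV
    have hWn : ‖W‖ ≤ ε ^ (4 * (m + 1) + 1) * C := by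
      rw [hW, norm_smul, Real.norm_eq_abs, abs_of_pos (pow_pos hε _)]
      calc _ = ε ^ (4 * (m + 1) + 1) * (ε ^ (m + 1) * ‖V‖) := by rw [hb]; ring
        _ ≤ _ := by gcongr
    have hW1 : ‖W‖ ≤ 1 := by
      refine hWn.trans (le_trans ?_ hεC)
      gcongr
      exact (pow_le_of_le_one hε.le hε1 (by omega))
    have hW3 : ‖W‖ ^ 3 ≤ (ε ^ b) ^ 2 * (ε ^ (2 * (m + 1) + 1) * C ^ 3) := by
      calc ‖W‖ ^ 3 ≤ (ε ^ (4 * (m + 1) + 1) * C) ^ 3 := by gcongr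
        _ = _ := by rw [hb]; ring
    have hnorm : ∀ T : H →L[ℂ] H, ‖T‖ ≤ L → ‖ε • T‖ ≤ ε * L := fun T hT' => by
      rw [norm_smul, Real.norm_eq_abs, abs_of_pos hε]; gcongr
    let q : (H →L[ℂ] H) →ₗ[ℝ] ℝ :=
      { toFun := fun T => (inner ℂ x (T x)).re
        map_add' := fun S T => by simp
        map_smul' := fun a T => by
          simp only [smul_apply, RingHom.id_apply, smul_eq_mul]
          rw [← Complex.coe_smul, inner_smul_right, Complex.re_ofReal_mul] }
    have hq : ∀ T, |q T| ≤ ‖T‖ * C ^ 2 := fun T =>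
      (abs_re_inner_apply_le T x).trans (by gcongr)
    have hP : ∀ T : H →L[ℂ] H, IsSelfAdjoint T → ‖T‖ ≤ L →
        |q (cfc G (ε • T)) - ∑ k ∈ Finset.range (N + 2), c k * (ε ^ k * q (T ^ k))| ≤
          K * L ^ (N + 2) * ε ^ (N + 2) * C ^ 2 := by
      intro T hTsa hTL
      have h1 := norm_cfc_sub_sum_smul_pow_le hG hK hKr ((IsSelfAdjoint.all ε).smul hTsa)
        ((hnorm T hTL).trans hεr)
      have h2 := hq (cfc G (ε • T) - ∑ k ∈ Finset.range (N + 2), c k • (ε • T) ^ k)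
      simp only [map_sub, map_sum, map_smul, _root_.smul_pow, smul_eq_mul] at h2
      refine h2.trans ?_
      gcongr
      simp only [_root_.smul_pow] at h1
      refine h1.trans ?_
      calc K * ‖ε • T‖ ^ (N + 2) ≤ K * (ε * L) ^ (N + 2) := by gcongr; exact hnorm T hTL
        _ = _ := by rw [mul_pow]; ring
    have hJL : ‖J‖ ≤ L := by simp [hL]
    have hc := hconc (ε • J) (ε • W) ((IsSelfAdjoint.all ε).smul hJ)
      ((IsSelfAdjoint.all ε).smul hWsa) ((hnorm _ hJL).trans hεr₀)
      ((hnorm _ (hW1.trans (by simp [hL]))).trans hεr₀) x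
    rw [← smul_add, ← smul_sub] at hc
    change q _ + q _ ≤ 2 * q _ at hc
    have hp1 := abs_le.mp (hP (J + W) (hJ.add hWsa) ((norm_add_le _ _).trans (by rw [hL]; gcongr)))
    have hp2 := abs_le.mp (hP (J - W) (hJ.sub hWsa) ((norm_sub_le _ _).trans (by rw [hL]; gcongr)))
    have hp3 := abs_le.mp (hP J hJ hJL)
    set R := K * L ^ (N + 2) * ε ^ (N + 2) * C ^ 2 with hR
    have hsum : ∑ k ∈ Finset.range (N + 2), c k * (ε ^ k *
        (q ((J + W) ^ k) + q ((J - W) ^ k) - 2 * q (J ^ k))) ≤ 4 * R := by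
      have : ∑ k ∈ Finset.range (N + 2), c k * (ε ^ k *
        (q ((J + W) ^ k) + q ((J - W) ^ k) - 2 * q (J ^ k))) =
        ∑ k ∈ Finset.range (N + 2), c k * (ε ^ k * q ((J + W) ^ k)) +
        ∑ k ∈ Finset.range (N + 2), c k * (ε ^ k * q ((J - W) ^ k)) -
        2 * ∑ k ∈ Finset.range (N + 2), c k * (ε ^ k * q (J ^ k)) := by
        rw [Finset.mul_sum, ← Finset.sum_add_distrib, ← Finset.sum_sub_distrib]
        exact Finset.sum_congr rfl fun k _ => by ring
      rw [this]
      linarith [hp1.1, hp1.2, hp2.1, hp2.2, hp3.1, hp3.2]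
    have herr : ∀ k, |q ((J + W) ^ k) + q ((J - W) ^ k) - 2 * q (J ^ k) -
        2 * ((ε ^ b) ^ 2 * q (powDerivTwo J V k))| ≤
          (ε ^ b) ^ 2 * (ε ^ (2 * (m + 1) + 1) * (E k * C ^ 5)) := by
      intro k
      have h1 := hq ((J + W) ^ k + (J - W) ^ k - (2 : ℤ) • J ^ k - (2 : ℤ) • powDerivTwo J W k)
      have hD : powDerivTwo J W k = (ε ^ b) ^ 2 • powDerivTwo J V k := powDerivTwo_smul _ _ _ _
      rw [map_sub, map_sub, map_add, map_zsmul, map_zsmul, hD, map_smul, smul_eq_mul,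
        zsmul_eq_mul, zsmul_eq_mul, ← hD] at h1
      push_cast at h1
      refine h1.trans ?_
      calc _ ≤ E k * ‖W‖ ^ 3 * C ^ 2 := by
            gcongr
            exact hE k W hW1
        _ ≤ E k * ((ε ^ b) ^ 2 * (ε ^ (2 * (m + 1) + 1) * C ^ 3)) * C ^ 2 := by
            gcongr
            exact hE0 k
        _ = _ := by ring
    have hsum2 : ∑ k ∈ Finset.range (N + 2), c k * (ε ^ k * (2 * q (powDerivTwo J V k))) ≤
        M * ε ^ (2 * (m + 1) + 1) := by
      have hbpos : 0 < (ε ^ b) ^ 2 := by positivity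
      refine le_of_mul_le_mul_left ?_ hbpos
      have h1 : ∀ k ∈ Finset.range (N + 2),
          c k * (ε ^ k * (2 * ((ε ^ b) ^ 2 * q (powDerivTwo J V k)))) ≤
          c k * (ε ^ k * (q ((J + W) ^ k) + q ((J - W) ^ k) - 2 * q (J ^ k))) +
          |c k| * ((ε ^ b) ^ 2 * (ε ^ (2 * (m + 1) + 1) * (E k * C ^ 5))) := by
        intro k _
        have h2 : |c k * (ε ^ k * (q ((J + W) ^ k) + q ((J - W) ^ k) - 2 * q (J ^ k) -
            2 * ((ε ^ b) ^ 2 * q (powDerivTwo J V k))))| ≤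
            |c k| * ((ε ^ b) ^ 2 * (ε ^ (2 * (m + 1) + 1) * (E k * C ^ 5))) := by
          rw [abs_mul, abs_mul, abs_of_pos (pow_pos hε k)]
          refine mul_le_mul_of_nonneg_left ?_ (abs_nonneg _)
          refine (mul_le_of_le_one_left (abs_nonneg _) (pow_le_one₀ hε.le hε1)).trans (herr k)
        have h3 := (abs_le.mp h2).1
        linear_combination h3
      calc _ = ∑ k ∈ Finset.range (N + 2),
            c k * (ε ^ k * (2 * ((ε ^ b) ^ 2 * q (powDerivTwo J V k)))) := by
            rw [Finset.mul_sum]; exact Finset.sum_congr rfl fun k _ => by ring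
        _ ≤ _ := Finset.sum_le_sum h1
        _ ≤ 4 * R + ∑ k ∈ Finset.range (N + 2),
            |c k| * ((ε ^ b) ^ 2 * (ε ^ (2 * (m + 1) + 1) * (E k * C ^ 5))) := by
            rw [Finset.sum_add_distrib]; gcongr
        _ = _ := by
            have hpow : ε ^ (N + 2) = (ε ^ b) ^ 2 * ε ^ (2 * (m + 1) + 1) := by
              rw [← pow_mul, ← pow_add]; congr 1; omega
            have h5 : ∑ k ∈ Finset.range (N + 2),
                |c k| * ((ε ^ b) ^ 2 * (ε ^ (2 * (m + 1) + 1) * (E k * C ^ 5))) =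
                (ε ^ b) ^ 2 * ε ^ (2 * (m + 1) + 1) *
                  ∑ k ∈ Finset.range (N + 2), |c k| * (E k * C ^ 5) := by
              rw [Finset.mul_sum]; exact Finset.sum_congr rfl fun k _ => by ring
            rw [h5, hM, hR, hpow]; ring
    rw [Finset.sum_range_succ', Finset.sum_range_succ'] at hsum2
    have hD0 : powDerivTwo J V 0 = 0 := rfl
    have hD1 : powDerivTwo J V (0 + 1) = 0 := by simp [powDerivTwo, powDerivOne]
    rw [hD0, hD1, map_zero, mul_zero, mul_zero, mul_zero, add_zero, mul_zero, mul_zero,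
      add_zero] at hsum2
    have hεm : 0 < ε ^ (m + 1) := pow_pos hε _
    refine ⟨fun p => ε ^ (p + 1) * θ p / ε ^ (m + 1), fun p hp => ?_, fun p hp => ?_, ?_⟩
    · beta_reduce
      rw [hθ' p hp, mul_div_cancel_left₀ _ hεm.ne']
    · rw [abs_div, abs_mul, abs_of_pos hεm, abs_of_pos (pow_pos hε _), div_le_iff₀ hεm]
      calc ε ^ (p + 1) * |θ p| ≤ ε ^ (m + 1 + 1) * D p := by
            have : ε ^ (p + 1) ≤ ε ^ (m + 1 + 1) := pow_le_pow_of_le_one hε.le hε1 (by omega)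
            gcongr
            exact hθ p
        _ = _ := by ring
    · refine le_of_mul_le_mul_left ?_ (pow_pos hεm 2)
      calc _ = ∑ k ∈ Finset.range N, c (k + 2) *
            (ε ^ (k + 2) * (2 * q (powDerivTwo J V (k + 2)))) := by
            rw [Finset.mul_sum]
            refine Finset.sum_congr rfl fun k _ => ?_
            have h1 : q (powDerivTwo J V (k + 2)) = _ := hD2 k
            rw [h1]
            have h2 : ∑ j ∈ Finset.range (k + 1), ε ^ (k - j + 1) * θ (k - j) / ε ^ (m + 1) *
                (ε ^ (j + 1) * θ j / ε ^ (m + 1)) = ε ^ (k + 2) / (ε ^ (m + 1)) ^ 2 *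
                  ∑ j ∈ Finset.range (k + 1), θ (k - j) * θ j := by
              rw [Finset.mul_sum]
              refine Finset.sum_congr rfl fun j hj => ?_
              have hj' : k - j + j = k := Nat.sub_add_cancel (by simp at hj; omega)
              have : ε ^ (k + 2) = ε ^ (k - j + 1) * ε ^ (j + 1) := by
                rw [← pow_add]; congr 1; omega
              rw [this]; field_simp
            rw [h2]; field_simp
        _ ≤ M * ε ^ (2 * (m + 1) + 1) := hsum2
        _ = _ := by ring
  -- passage to the limit
  obtain ⟨ε₀, hε₀, hε₀'⟩ : ∃ ε₀ : ℝ, 0 < ε₀ ∧ ∀ ε, 0 < ε → ε ≤ ε₀ →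
      ε ≤ 1 ∧ ε * C ≤ 1 ∧ ε * L ≤ r ∧ ε * L ≤ r₀ := by
    refine ⟨min (min 1 (1 / C)) (min (r / L) (r₀ / L)), by positivity, fun ε hε h => ?_⟩
    simp only [le_min_iff] at h
    obtain ⟨⟨h1, h2⟩, h3, h4⟩ := h
    rw [le_div_iff₀ (by positivity)] at h2 h3 h4
    exact ⟨h1, h2, h3, h4⟩
  have key' : ∀ ε : ℝ, ∃ η : ℕ → ℝ, 0 < ε → ε ≤ ε₀ → (∀ p, p ≤ m → η p = Q.coeff p) ∧
      (∀ p, m < p → |η p| ≤ ε * D p) ∧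
      ∑ k ∈ Finset.range N, c (k + 2) * (2 * (∑ j ∈ Finset.range (k + 1), η (k - j) * η j +
        ε ^ (k + 2) * ω k)) ≤ M * ε := by
    intro ε
    by_cases h : 0 < ε ∧ ε ≤ ε₀
    · obtain ⟨h1, h2, h3, h4⟩ := hε₀' ε h.1 h.2
      obtain ⟨η, hη⟩ := key ε h.1 h1 h2 h3 h4
      exact ⟨η, fun _ _ => hη⟩
    · exact ⟨0, fun h1 h2 => (h ⟨h1, h2⟩).elim⟩
  choose η hη using key'
  have hev : ∀ᶠ ε : ℝ in nhdsWithin 0 (Set.Ioi 0), 0 < ε ∧ ε ≤ ε₀ := by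
    filter_upwards [self_mem_nhdsWithin, nhdsWithin_le_nhds (Iic_mem_nhds hε₀)] with ε h1 h2
    exact ⟨h1, h2⟩
  have hid : Filter.Tendsto (fun ε : ℝ => ε) (nhdsWithin 0 (Set.Ioi 0)) (nhds 0) :=
    nhdsWithin_le_nhds
  have hηlim : ∀ p, Filter.Tendsto (fun ε => η ε p) (nhdsWithin 0 (Set.Ioi 0))
      (nhds (Q.coeff p)) := by
    intro p
    by_cases hp : p ≤ m
    · refine tendsto_const_nhds.congr' ?_
      filter_upwards [hev] with ε hε
      exact ((hη ε hε.1 hε.2).1 p hp).symm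
    · rw [coeff_eq_zero_of_natDegree_lt (by omega)]
      refine squeeze_zero_norm' (a := fun ε => ε * D p) ?_ (by simpa using hid.mul_const (D p))
      filter_upwards [hev] with ε hε
      exact (hη ε hε.1 hε.2).2.1 p (by omega)
  have hlim : Filter.Tendsto (fun ε => ∑ k ∈ Finset.range N, c (k + 2) *
      (2 * (∑ j ∈ Finset.range (k + 1), η ε (k - j) * η ε j + ε ^ (k + 2) * ω k)))
      (nhdsWithin 0 (Set.Ioi 0)) (nhds (∑ k ∈ Finset.range N, c (k + 2) *
      (2 * (∑ j ∈ Finset.range (k + 1), Q.coeff (k - j) * Q.coeff j + 0 ^ (k + 2) * ω k)))) := by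
    refine tendsto_finsetSum _ fun k _ => Filter.Tendsto.const_mul _ (Filter.Tendsto.const_mul _ ?_)
    refine Filter.Tendsto.add (tendsto_finsetSum _ fun j _ => (hηlim _).mul (hηlim _)) ?_
    exact (hid.pow _).mul_const _
  have hfin := le_of_tendsto_of_tendsto hlim (by simpa using hid.const_mul M)
    (by filter_upwards [hev] with ε hε using (hη ε hε.1 hε.2).2.2)
  have hcoeff : ∀ k, ∑ j ∈ Finset.range (k + 1), Q.coeff (k - j) * Q.coeff j = (Q * Q).coeff k := by
    intro k
    rw [coeff_mul, Finset.Nat.sum_antidiagonal_eq_sum_range_succ_mk]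
    exact Finset.sum_congr rfl fun j _ => mul_comm _ _
  have hsub : ∑ k ∈ Finset.range (2 * m + 1), c (k + 2) * (Q * Q).coeff k =
      ∑ k ∈ Finset.range N, c (k + 2) * (Q * Q).coeff k := by
    refine Finset.sum_subset (Finset.range_subset_range.mpr (by omega)) fun k _ hk => ?_
    rw [coeff_eq_zero_of_natDegree_lt, mul_zero]
    refine natDegree_mul_le.trans_lt ?_
    simp at hk
    omega
  rw [hsub]
  simp only [hcoeff, ne_eq, Nat.add_eq_zero_iff, OfNat.ofNat_ne_zero, and_false,
    not_false_eq_true, zero_pow, zero_mul, add_zero] at hfin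
  have h2 : ∑ k ∈ Finset.range N, c (k + 2) * (2 * (Q * Q).coeff k) =
      2 * ∑ k ∈ Finset.range N, c (k + 2) * (Q * Q).coeff k := by
    rw [Finset.mul_sum]; exact Finset.sum_congr rfl fun k _ => by ring
  linarith

theorem exists_eigenvector_of_mem_spectrum [FiniteDimensional ℂ H] {T : H →L[ℂ] H} {t : ℝ}
    (ht : t ∈ spectrum ℝ T) : ∃ v : H, v ≠ 0 ∧ T v = (t : ℂ) • v := by
  by_contra! hcon
  refine ht ?_
  rw [spectrum.mem_resolventSet_iff, ContinuousLinearMap.isUnit_iff_bijective]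
  have hinj : Function.Injective (algebraMap ℝ (H →L[ℂ] H) t - T) := by
    rw [injective_iff_map_eq_zero]
    intro v hv
    by_contra hv0
    refine hcon v hv0 ?_
    rw [sub_apply, Algebra.algebraMap_eq_smul_one, smul_apply, one_apply_eq_self,
      sub_eq_zero] at hv
    rw [← hv, Complex.coe_smul]
  exact ⟨hinj, LinearMap.surjective_of_injective
    (f := ((algebraMap ℝ (H →L[ℂ] H) t - T : H →L[ℂ] H) : H →ₗ[ℂ] H)) hinj⟩

theorem card_le_finrank_of_subset_spectrum [FiniteDimensional ℂ H] {T : H →L[ℂ] H}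
    {S : Finset ℝ} (hS : (S : Set ℝ) ⊆ spectrum ℝ T) : S.card ≤ Module.finrank ℂ H := by
  choose v hv0 hv using fun t : S => exists_eigenvector_of_mem_spectrum (hS t.2)
  have hli : LinearIndependent ℂ v :=
    Module.End.eigenvectors_linearIndependent' (T : H →ₗ[ℂ] H) (fun t : S => ((t : ℝ) : ℂ))
      (fun a b h => Subtype.ext (by simpa using h)) v
      (fun t => ⟨by simpa [Module.End.mem_eigenspace_iff] using hv t, hv0 t⟩)
  simpa using hli.fintype_card_le_finrank

theorem spectrum_finite [FiniteDimensional ℂ H] (T : H →L[ℂ] H) : (spectrum ℝ T).Finite := by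
  by_contra h
  obtain ⟨S, hS, hc⟩ := Set.Infinite.exists_subset_card_eq h (Module.finrank ℂ H + 1)
  have := card_le_finrank_of_subset_spectrum hS
  omega

theorem cfc_eq_sum_single [FiniteDimensional ℂ H] {T : H →L[ℂ] H}
    {S : Finset ℝ} (hS : spectrum ℝ T ⊆ S) (h : ℝ → ℝ) :
    cfc h T = ∑ t ∈ S, h t • cfc (Pi.single t (1 : ℝ)) T := by
  have hc : ∀ f : ℝ → ℝ, ContinuousOn f (spectrum ℝ T) := (spectrum_finite T).continuousOn
  have h1 := cfc_sum (fun t => h t • (Pi.single t (1 : ℝ) : ℝ → ℝ)) T S (fun _ _ => hc _)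
  have h2 : ∀ t ∈ S, cfc (h t • (Pi.single t (1 : ℝ) : ℝ → ℝ)) T =
      h t • cfc (Pi.single t (1 : ℝ)) T := fun t _ => cfc_smul (h t) _ T (hc _)
  rw [← Finset.sum_congr rfl h2, ← h1]
  refine cfc_congr fun u hu => ?_
  rw [Finset.sum_apply, Finset.sum_eq_single_of_mem u (hS hu)]
  · simp
  · intro t _ htu
    simp [htu.symm]

theorem cfc_sub_smul_one [FiniteDimensional ℂ H] {T : H →L[ℂ] H} (hT : IsSelfAdjoint T) (s : ℝ)
    (h : ℝ → ℝ) : cfc h (T - s • 1) = cfc (fun t => h (t - s)) T := by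
  have hc : ∀ f : ℝ → ℝ, ContinuousOn f (spectrum ℝ T) := (spectrum_finite T).continuousOn
  have h1 : cfc (fun t : ℝ => t - s) T = T - s • 1 := by
    rw [cfc_sub (fun t => t) (fun _ => s) T, cfc_id' ℝ T, cfc_const s T,
      Algebra.algebraMap_eq_smul_one]
  rw [← h1, ← cfc_comp h (fun t => t - s) T hT
    (((spectrum_finite T).image _).continuousOn _) (hc _)]
  rfl

/-- The quadratic form of an operator as a real linear functional. -/
noncomputable def quadForm (x : H) : (H →L[ℂ] H) →ₗ[ℝ] ℝ where
  toFun T := (inner ℂ x (T x)).re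
  map_add' S T := by simp
  map_smul' a T := by
    simp only [smul_apply, RingHom.id_apply, smul_eq_mul]
    rw [← Complex.coe_smul, inner_smul_right, Complex.re_ofReal_mul]

theorem quadForm_mono {S T : H →L[ℂ] H} (h : S ≤ T) (x : H) : quadForm x S ≤ quadForm x T := by
  rw [ContinuousLinearMap.le_def] at h
  have := h.re_inner_nonneg_right x
  simp only [sub_apply, inner_sub_right, map_sub, RCLike.re_to_complex] at this
  exact sub_nonneg.mp this

theorem le_of_quadForm_le {S T : H →L[ℂ] H} (hS : IsSelfAdjoint S) (hT : IsSelfAdjoint T)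
    (h : ∀ x, quadForm x S ≤ quadForm x T) : S ≤ T := by
  rw [ContinuousLinearMap.le_def, ContinuousLinearMap.isPositive_def']
  refine ⟨hT.sub hS, fun x => ?_⟩
  have := h x
  simp only [quadForm, LinearMap.coe_mk, AddHom.coe_mk] at this
  rw [ContinuousLinearMap.reApplyInnerSelf_apply, inner_re_symm, RCLike.re_to_complex]
  simp only [sub_apply, inner_sub_right, Complex.sub_re]
  linarith

/-- Midpoint operator concavity on strictly positive operators. -/
def MidpointConcave (H : Type*) [NormedAddCommGroup H] [InnerProductSpace ℂ H]
    [CompleteSpace H] (F : ℝ → ℝ) : Prop :=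
  ∀ X B : H →L[ℂ] H, IsStrictlyPositive (X + B) → IsStrictlyPositive (X - B) →
    cfc F (X + B) + cfc F (X - B) ≤ (2 : ℝ) • cfc F X

theorem ContDiff.exists_abs_sub_taylor_le {F : ℝ → ℝ} {N : ℕ} (hF : ContDiff ℝ N F) (ξ : ℝ) :
    ∃ K r : ℝ, 0 ≤ K ∧ 0 < r ∧ ∀ t, |t| ≤ r →
      |F (t + ξ) - ∑ k ∈ Finset.range N, iteratedDeriv k F ξ / k.factorial * t ^ k| ≤
        K * |t| ^ N := by
  have h1 := (taylor_isLittleO_univ (x₀ := ξ) hF).bound (c := 1) one_pos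
  obtain ⟨ε, hε, h2⟩ := Metric.eventually_nhds_iff.mp h1
  refine ⟨1 + |iteratedDeriv N F ξ / N.factorial|, ε / 2, by positivity, by positivity,
    fun t ht => ?_⟩
  have h3 := h2 (y := t + ξ) (by rw [Real.dist_eq, add_sub_cancel_right]; linarith)
  rw [taylor_within_apply, Finset.sum_range_succ] at h3
  simp only [iteratedDerivWithin_univ, add_sub_cancel_right, smul_eq_mul, Real.norm_eq_abs,
    one_mul, abs_pow] at h3
  have h4 : ∀ k, ((k.factorial : ℝ)⁻¹ * t ^ k) * iteratedDeriv k F ξ =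
      iteratedDeriv k F ξ / k.factorial * t ^ k := fun k => by ring
  simp only [h4] at h3
  calc _ = |(F (t + ξ) - (∑ k ∈ Finset.range N, iteratedDeriv k F ξ / k.factorial * t ^ k +
        iteratedDeriv N F ξ / N.factorial * t ^ N)) +
        iteratedDeriv N F ξ / N.factorial * t ^ N| := by ring_nf
    _ ≤ |t| ^ N + |iteratedDeriv N F ξ / N.factorial * t ^ N| :=
        (abs_add_le _ _).trans (by linarith)
    _ = _ := by rw [abs_mul, abs_pow]; ring

theorem iteratedDeriv_mul_sq_nonpos [FiniteDimensional ℂ H] {m : ℕ}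
    (hn : Module.finrank ℂ H = m + 1) {F : ℝ → ℝ} (hF : ∀ N : ℕ, ContDiff ℝ N F) {ξ r₀ : ℝ}
    (hr₀ : 0 < r₀)
    (hconc : ∀ X B : H →L[ℂ] H, IsSelfAdjoint X → IsSelfAdjoint B → ‖X‖ ≤ r₀ → ‖B‖ ≤ r₀ → ∀ x,
      quadForm x (cfc F ((X + B) + ξ • 1)) + quadForm x (cfc F ((X - B) + ξ • 1)) ≤
        2 * quadForm x (cfc F (X + ξ • 1)))
    {r : ℝ[X]} (hr : r.natDegree < m + 1) :
    iteratedDeriv (2 * (m + 1)) (fun t => F t * r.eval t ^ 2) ξ ≤ 0 := by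
  have hshift : ∀ T : H →L[ℂ] H, IsSelfAdjoint T →
      cfc F (T + ξ • 1) = cfc (fun t => F (t + ξ)) T := fun T hT => by
    have := cfc_sub_smul_one hT (-ξ) F
    simpa using this
  set q := taylor ξ r with hq
  have hqd : q.natDegree ≤ m := by rw [hq, natDegree_taylor]; omega
  have hQd : (reflect m q).natDegree ≤ m := by
    rw [natDegree_le_iff_coeff_eq_zero]
    intro k hk
    rw [coeff_reflect, revAt_eq_self_of_lt hk]
    exact coeff_eq_zero_of_natDegree_lt (by omega)
  have key := sum_coeff_sq_nonpos_of_midpoint_concave hn (G := fun t => F (t + ξ))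
    (c := fun k => iteratedDeriv k F ξ / k.factorial)
    ((hF 0).continuous.comp (by fun_prop)) (fun N => (hF N).exists_abs_sub_taylor_le ξ) hr₀
    (fun X B hX hB hXn hBn x => by
      have := hconc X B hX hB hXn hBn x
      rw [hshift _ (hX.add hB), hshift _ (hX.sub hB), hshift _ hX] at this
      exact this) hQd
  have hcoef : ∀ k ∈ Finset.range (2 * m + 1),
      (reflect m q * reflect m q).coeff k = (q * q).coeff (2 * m - k) := by
    intro k hk
    rw [← reflect_mul q q hqd hqd, coeff_reflect, ← two_mul,
      revAt_le (by simpa [Nat.lt_succ_iff] using hk)]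
  have hev : (fun t => F t * r.eval t ^ 2) = fun t => F t * (r * r).eval t := by
    funext t; rw [eval_mul, sq]
  rw [hev, iteratedDeriv_mul_eval_eq_sum (hF _), taylor_mul, ← hq]
  refine mul_nonpos_of_nonneg_of_nonpos (by positivity) ?_
  have hqq : (q * q).natDegree ≤ 2 * m := natDegree_mul_le.trans (by omega)
  rw [show 2 * (m + 1) + 1 = (2 * m + 1) + 1 + 1 by ring, Finset.sum_range_succ',
    Finset.sum_range_succ', coeff_eq_zero_of_natDegree_lt (n := 2 * (m + 1) - 0) (by omega),
    coeff_eq_zero_of_natDegree_lt (n := 2 * (m + 1) - (0 + 1)) (by omega), mul_zero, mul_zero,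
    add_zero, add_zero]
  refine le_of_eq_of_le (Finset.sum_congr rfl fun k hk => ?_) key
  rw [hcoef k hk]
  congr 2
  omega

open MeasureTheory ContinuousLinearMap Convolution in
theorem quadForm_cfc_convolution [FiniteDimensional ℂ H] {F : ℝ → ℝ} (hF : Continuous F)
    (φ : ContDiffBump (0 : ℝ)) {T : H →L[ℂ] H} (hT : IsSelfAdjoint T) (x : H) :
    Integrable (fun s => φ.normed volume s * quadForm x (cfc F (T - s • 1))) ∧
    quadForm x (cfc (φ.normed volume ⋆[lsmul ℝ ℝ, volume] F) T) =
      ∫ s, φ.normed volume s * quadForm x (cfc F (T - s • 1)) := by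
  have hS : spectrum ℝ T ⊆ (spectrum_finite T).toFinset := by simp
  have hintegrable : ∀ t, Integrable (fun s => φ.normed volume s * F (t - s)) := fun t =>
    (φ.continuous_normed.mul (hF.comp (by fun_prop))).integrable_of_hasCompactSupport
      φ.hasCompactSupport_normed.mul_right
  have h1 : ∀ s, φ.normed volume s * quadForm x (cfc F (T - s • 1)) =
      ∑ t ∈ (spectrum_finite T).toFinset,
        φ.normed volume s * F (t - s) * quadForm x (cfc (Pi.single t (1 : ℝ)) T) := by
    intro s
    rw [cfc_sub_smul_one hT, cfc_eq_sum_single hS, map_sum, Finset.mul_sum]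
    refine Finset.sum_congr rfl fun t _ => ?_
    rw [map_smul, smul_eq_mul, mul_assoc]
  simp only [h1]
  refine ⟨integrable_finsetSum _ fun t _ => (hintegrable t).mul_const _, ?_⟩
  rw [integral_finsetSum _ fun t _ => (hintegrable t).mul_const _, cfc_eq_sum_single hS, map_sum]
  refine Finset.sum_congr rfl fun t _ => ?_
  rw [map_smul, smul_eq_mul, integral_mul_const]
  rfl

theorem cfc_comp_max_eq {F : ℝ → ℝ} {η : ℝ} {T : H →L[ℂ] H} (hT : η • 1 ≤ T) :
    cfc (fun t => F (max t η)) T = cfc F T := by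
  have hsa : IsSelfAdjoint T := by
    have := (IsSelfAdjoint.of_nonneg (sub_nonneg.mpr hT)).add
      ((IsSelfAdjoint.all η).smul (IsSelfAdjoint.one (H →L[ℂ] H)))
    simpa using this
  rw [← Algebra.algebraMap_eq_smul_one, algebraMap_le_iff_le_spectrum (a := T)] at hT
  exact cfc_congr fun t ht => by simp only [max_eq_left (hT t ht)]

theorem neg_smul_one_le_of_norm_le {T : H →L[ℂ] H} (hT : IsSelfAdjoint T) {c : ℝ}
    (h : ‖T‖ ≤ c) : (-c) • 1 ≤ T := by
  have h1 := hT.neg_algebraMap_norm_le_self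
  rw [Algebra.algebraMap_eq_smul_one, ← neg_smul] at h1
  exact (smul_le_smul_of_nonneg_right (neg_le_neg h) zero_le_one).trans h1

open MeasureTheory ContinuousLinearMap Convolution in
theorem dividedDiff_convolution_nonpos [FiniteDimensional ℂ H] {m : ℕ}
    (hn : Module.finrank ℂ H = m + 1) {F : ℝ → ℝ}
    (hconc : MidpointConcave H F) {S : Finset ℝ} {η : ℝ} (hη : 0 < η)
    (hc : Continuous fun t => F (max t η))
    (hS : ∀ t ∈ S, 3 * η ≤ t) (hcard : S.card = 2 * (m + 1) + 1) {r : ℝ[X]}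
    (hr : r.natDegree < m + 1) (φ : ContDiffBump (0 : ℝ)) (hφ : φ.rOut ≤ η) :
    dividedDiff S (fun t => (φ.normed volume ⋆[lsmul ℝ ℝ, volume] fun t => F (max t η)) t *
      r.eval t ^ 2) ≤ 0 := by
  set G := φ.normed volume ⋆[lsmul ℝ ℝ, volume] fun t => F (max t η) with hG
  have hGd : ∀ N : ℕ, ContDiff ℝ N G := fun N =>
    φ.hasCompactSupport_normed.contDiff_convolution_left (n := (N : ℕ∞)) _ φ.contDiff_normed
      hc.locallyIntegrable
  have hGr : ContDiff ℝ (2 * (m + 1) : ℕ) (fun t => G t * r.eval t ^ 2) :=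
    (hGd _).mul ((Polynomial.contDiff_eval r).pow 2)
  obtain ⟨ξ, ⟨t, htS, htξ⟩, hξ⟩ := exists_iteratedDeriv_eq_dividedDiff hGr hcard
  have hξη : 3 * η ≤ ξ := (hS t htS).trans htξ
  have key : iteratedDeriv (2 * (m + 1)) (fun t => G t * r.eval t ^ 2) ξ ≤ 0 := by
    refine iteratedDeriv_mul_sq_nonpos hn hGd (r₀ := η / 2) (by positivity) ?_ hr
    intro X B hX hB hXn hBn x
    have h1 : IsSelfAdjoint (ξ • (1 : H →L[ℂ] H)) :=
      (IsSelfAdjoint.all ξ).smul (IsSelfAdjoint.one _)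
    obtain ⟨i1, e1⟩ := quadForm_cfc_convolution hc φ ((hX.add hB).add h1) x
    obtain ⟨i2, e2⟩ := quadForm_cfc_convolution hc φ ((hX.sub hB).add h1) x
    obtain ⟨i3, e3⟩ := quadForm_cfc_convolution hc φ (hX.add h1) x
    rw [hG, e1, e2, e3, ← integral_add i1 i2, ← integral_const_mul]
    refine integral_mono (i1.add i2) (i3.const_mul 2) fun s => ?_
    by_cases hs : φ.normed volume s = 0
    · simp [hs]
    have hs' : s ∈ Metric.ball (0 : ℝ) φ.rOut := by
      rw [← φ.support_normed_eq (μ := volume)]; exact hs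
    have hsη : s ≤ η := by
      rw [mem_ball_zero_iff, Real.norm_eq_abs] at hs'
      exact ((le_abs_self s).trans hs'.le).trans hφ
    have hlow : ∀ T : H →L[ℂ] H, IsSelfAdjoint T → ‖T‖ ≤ η →
        η • (1 : H →L[ℂ] H) ≤ T + ξ • 1 - s • 1 := by
      intro T hT hTn
      have h2 : (η - (ξ - s)) • (1 : H →L[ℂ] H) ≤ T :=
        (smul_le_smul_of_nonneg_right (by linarith) zero_le_one).trans
          (neg_smul_one_le_of_norm_le hT hTn)
      have h3 := add_le_add_left h2 ((ξ - s) • (1 : H →L[ℂ] H))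
      rw [← add_smul, sub_add_cancel, sub_smul, ← add_sub_assoc] at h3
      exact h3
    have hpos : ∀ T : H →L[ℂ] H, η • (1 : H →L[ℂ] H) ≤ T → IsStrictlyPositive T := fun T hT =>
      IsStrictlyPositive.of_le (IsStrictlyPositive.smul hη isStrictlyPositive_one) hT
    have l1 := hlow _ (hX.add hB) ((norm_add_le _ _).trans (by linarith))
    have l2 := hlow _ (hX.sub hB) ((norm_sub_le _ _).trans (by linarith))
    have l3 := hlow _ hX (by linarith)
    have e : ∀ C : H →L[ℂ] H, X + C + ξ • 1 - s • 1 = (X + ξ • 1 - s • 1) + C := fun C => by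
      abel
    have e' : X - B + ξ • 1 - s • 1 = (X + ξ • 1 - s • 1) - B := by abel
    have hmid := hconc (X + ξ • 1 - s • 1) B (by rw [← e]; exact hpos _ l1)
      (by rw [← e']; exact hpos _ l2)
    have hq := quadForm_mono hmid x
    rw [map_add, map_smul, smul_eq_mul, ← e, ← e'] at hq
    simp only
    rw [cfc_comp_max_eq l1, cfc_comp_max_eq l2, cfc_comp_max_eq l3, ← mul_add, mul_left_comm]
    exact mul_le_mul_of_nonneg_left hq (φ.nonneg_normed _)
  rw [hξ] at key
  exact nonpos_of_mul_nonpos_right key (by positivity)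

open MeasureTheory Filter in
theorem MidpointConcave.dividedDiff_nonpos [FiniteDimensional ℂ H] {m : ℕ}
    (hn : Module.finrank ℂ H = m + 1) {F : ℝ → ℝ} (hF : ContinuousOn F (Set.Ioi 0))
    (hconc : MidpointConcave H F) (S : Finset ℝ) (hS : ∀ t ∈ S, 0 < t)
    (hcard : S.card = 2 * (m + 1) + 1) (r : ℝ[X]) (hr : r.natDegree < m + 1) :
    dividedDiff S (fun t => F t * r.eval t ^ 2) ≤ 0 := by
  have hne : S.Nonempty := Finset.card_pos.mp (by omega)
  set η := S.min' hne / 3 with hη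
  have hη0 : 0 < η := div_pos (hS _ (S.min'_mem hne)) three_pos
  have hSη : ∀ t ∈ S, 3 * η ≤ t := fun t ht => by
    have := S.min'_le t ht
    rw [hη]; linarith
  have hc : Continuous fun t => F (max t η) :=
    hF.comp_continuous (by fun_prop) fun t => lt_of_lt_of_le hη0 (le_max_right t η)
  have hpos : ∀ i : ℕ, 0 < η / ((i : ℝ) + 1) := fun i => by positivity
  let φ : ℕ → ContDiffBump (0 : ℝ) := fun i =>
    ⟨η / ((i : ℝ) + 1) / 2, η / ((i : ℝ) + 1), half_pos (hpos i), half_lt_self (hpos i)⟩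
  have hφ0 : Tendsto (fun i => (φ i).rOut) atTop (nhds 0) :=
    tendsto_const_nhds.div_atTop (tendsto_atTop_add_const_right _ _ tendsto_natCast_atTop_atTop)
  have hφ : ∀ i, (φ i).rOut ≤ η := fun i =>
    div_le_self hη0.le (by linarith [(Nat.cast_nonneg i : (0 : ℝ) ≤ i)])
  have hle := fun i => dividedDiff_convolution_nonpos hn hconc hη0 hc hSη hcard hr (φ i) (hφ i)
  refine le_of_tendsto (x := atTop) (tendsto_finsetSum S fun t ht => ?_)
    (Eventually.of_forall hle)
  have ht : F (max t η) = F t := by rw [max_eq_left (by linarith [hSη t ht])]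
  have := ContDiffBump.convolution_tendsto_right_of_continuous (μ := volume) hφ0 hc t
  rw [ht] at this
  exact (this.mul_const _).div_const _

theorem quadForm_mul_self {T : H →L[ℂ] H} (hT : IsSelfAdjoint T) (x : H) :
    quadForm x (T * T) = ‖T x‖ ^ 2 := by
  change (inner ℂ x (T (T x))).re = _
  rw [← ContinuousLinearMap.adjoint_inner_left, hT.adjoint_eq, inner_self_eq_norm_sq_to_K]
  norm_cast

theorem norm_le_one_of_abs_inner_le {E : Type*} [NormedAddCommGroup E]
    [InnerProductSpace ℂ E] {K : E →L[ℂ] E}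
    (h : ∀ x y, |(inner ℂ y (K x)).re| ≤ (‖x‖ ^ 2 + ‖y‖ ^ 2) / 2) : ‖K‖ ≤ 1 := by
  refine K.opNorm_le_bound zero_le_one fun x => ?_
  rw [one_mul]
  rcases eq_or_ne (K x) 0 with h0 | h0
  · simp [h0]
  have hK : 0 < ‖K x‖ := norm_pos_iff.mpr h0
  have h1 := h x (((‖x‖ / ‖K x‖ : ℝ) : ℂ) • K x)
  have h2 : (inner ℂ (((‖x‖ / ‖K x‖ : ℝ) : ℂ) • K x) (K x)).re = ‖x‖ * ‖K x‖ := by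
    rw [inner_smul_left, Complex.conj_ofReal, Complex.re_ofReal_mul,
      inner_self_eq_norm_sq_to_K]
    norm_cast
    change ‖x‖ / ‖K x‖ * ‖K x‖ ^ 2 = _
    field_simp
  have h3 : ‖((‖x‖ / ‖K x‖ : ℝ) : ℂ) • K x‖ = ‖x‖ := by
    rw [norm_smul, Complex.norm_real, Real.norm_of_nonneg (by positivity)]
    field_simp
  rw [h2, h3, abs_of_nonneg (by positivity)] at h1
  rcases (norm_nonneg x).eq_or_lt with hx | hx
  · rw [norm_eq_zero.mp hx.symm]; simp
  · exact le_of_mul_le_mul_left (by linarith) hx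

theorem norm_geometric_mean_le_one {a₁ a₂ b₁ b₂ p q u v : H →L[ℂ] H}
    (ha₁ : IsSelfAdjoint a₁) (ha₂ : IsSelfAdjoint a₂) (hb₁ : IsSelfAdjoint b₁)
    (hb₂ : IsSelfAdjoint b₂) (hp : IsSelfAdjoint p) (hq : IsSelfAdjoint q)
    (hu : IsSelfAdjoint u) (hpu : p * u = 1) (hqv : q * v = 1)
    (hP : a₁ * a₁ + a₂ * a₂ ≤ (2 : ℝ) • (p * p)) (hQ : b₁ * b₁ + b₂ * b₂ ≤ (2 : ℝ) • (q * q)) :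
    ‖u * ((1 / 2 : ℝ) • (a₁ * b₁ + a₂ * b₂)) * v‖ ≤ 1 := by
  refine norm_le_one_of_abs_inner_le fun x y => ?_
  have e1 : ∀ a b : H →L[ℂ] H, IsSelfAdjoint a →
      inner ℂ y (u (a (b (v x)))) = inner ℂ (a (u y)) (b (v x)) := fun a b ha => by
    rw [← ContinuousLinearMap.adjoint_inner_left, hu.adjoint_eq,
      ← ContinuousLinearMap.adjoint_inner_left, ha.adjoint_eq]
  have e2 : (inner ℂ y ((u * ((1 / 2 : ℝ) • (a₁ * b₁ + a₂ * b₂)) * v) x)).re =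
      (1 / 2) * ((inner ℂ (a₁ (u y)) (b₁ (v x))).re + (inner ℂ (a₂ (u y)) (b₂ (v x))).re) := by
    rw [mul_smul_comm, smul_mul_assoc, smul_apply, ← Complex.coe_smul, inner_smul_right,
      Complex.re_ofReal_mul, mul_add, add_mul, add_apply, inner_add_right, Complex.add_re]
    simp only [mul_apply_eq_comp]
    rw [e1 _ _ ha₁, e1 _ _ ha₂]
  have hPy := quadForm_mono hP (u y)
  have hQx := quadForm_mono hQ (v x)
  rw [map_add, map_smul, quadForm_mul_self ha₁, quadForm_mul_self ha₂, quadForm_mul_self hp,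
    ← mul_apply_eq_comp p u, hpu, one_apply_eq_self, smul_eq_mul] at hPy
  rw [map_add, map_smul, quadForm_mul_self hb₁, quadForm_mul_self hb₂, quadForm_mul_self hq,
    ← mul_apply_eq_comp q v, hqv, one_apply_eq_self, smul_eq_mul] at hQx
  have hcs : ∀ z w : H, |(inner ℂ z w).re| ≤ (‖z‖ ^ 2 + ‖w‖ ^ 2) / 2 := fun z w => by
    have := (Complex.abs_re_le_norm _).trans (norm_inner_le_norm (𝕜 := ℂ) z w)
    nlinarith [sq_nonneg (‖z‖ - ‖w‖)]
  have c1 := hcs (a₁ (u y)) (b₁ (v x))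
  have c2 := hcs (a₂ (u y)) (b₂ (v x))
  rw [e2, abs_mul, abs_of_pos (by norm_num : (0 : ℝ) < 1 / 2)]
  have := abs_add_le (inner ℂ (a₁ (u y)) (b₁ (v x))).re (inner ℂ (a₂ (u y)) (b₂ (v x))).re
  linarith

theorem IsStrictlyPositive.continuousOn_spectrum {F : ℝ → ℝ} (hF : ContinuousOn F (Set.Ioi 0))
    {T : H →L[ℂ] H} (hT : IsStrictlyPositive T) : ContinuousOn F (spectrum ℝ T) :=
  hF.mono fun _ ht => hT.spectrum_pos ht

/-- If `f ^ 2` and `g ^ 2` are midpoint operator concave, so is `f * g`. -/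
theorem MidpointConcave.mul_of_sq {f g : ℝ → ℝ} (hfc : ContinuousOn f (Set.Ioi 0))
    (hgc : ContinuousOn g (Set.Ioi 0)) (hf : ∀ t, 0 < t → 0 < f t) (hg : ∀ t, 0 < t → 0 < g t)
    (hf2 : MidpointConcave H fun t => f t ^ 2) (hg2 : MidpointConcave H fun t => g t ^ 2) :
    MidpointConcave H fun t => f t * g t := by
  intro X B hXB hXB'
  have hX : IsStrictlyPositive X := by
    have h1 : X = (1 / 2 : ℝ) • ((X + B) + (X - B)) := by
      rw [show (X + B) + (X - B) = (2 : ℝ) • X by rw [two_smul]; abel, smul_smul]; norm_num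
    rw [h1]
    exact IsStrictlyPositive.smul (by norm_num) (hXB.add_nonneg hXB'.nonneg)
  have hsq : ∀ {F : ℝ → ℝ}, ContinuousOn F (Set.Ioi 0) → ∀ {T : H →L[ℂ] H},
      IsStrictlyPositive T → cfc (fun t => F t ^ 2) T = cfc F T * cfc F T := fun {F} hF {T} hT => by
    have hc := hT.continuousOn_spectrum hF
    rw [← cfc_mul F F T hc hc]
    simp only [sq]
  have hmul : ∀ {F G : ℝ → ℝ}, ContinuousOn F (Set.Ioi 0) → ContinuousOn G (Set.Ioi 0) →
      ∀ {T : H →L[ℂ] H}, IsStrictlyPositive T →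
      cfc (fun t => F t * G t) T = cfc F T * cfc G T := fun {F G} hF hG {T} hT =>
    cfc_mul _ _ T (hT.continuousOn_spectrum hF) (hT.continuousOn_spectrum hG)
  have hone : ∀ F : ℝ → ℝ, (∀ t, 0 < t → F t = 1) → cfc F X = 1 := fun F hF => by
    rw [cfc_congr (g := fun _ => 1) fun t ht => hF t (hX.spectrum_pos ht), cfc_const_one ℝ X]
  have hP := hf2 X B hXB hXB'
  have hQ := hg2 X B hXB hXB'
  rw [hsq hfc hXB, hsq hfc hXB', hsq hfc hX] at hP
  rw [hsq hgc hXB, hsq hgc hXB', hsq hgc hX] at hQ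
  have hfi : ContinuousOn (fun t => (f t)⁻¹) (Set.Ioi 0) := hfc.inv₀ fun t ht => (hf t ht).ne'
  have hgi : ContinuousOn (fun t => (g t)⁻¹) (Set.Ioi 0) := hgc.inv₀ fun t ht => (hg t ht).ne'
  have hs : ContinuousOn (fun t => √(f t) * √(g t)) (Set.Ioi 0) := hfc.sqrt.mul hgc.sqrt
  have hsi : ContinuousOn (fun t => (√(f t) * √(g t))⁻¹) (Set.Ioi 0) := hs.inv₀ fun t ht =>
    (mul_pos (Real.sqrt_pos.mpr (hf t ht)) (Real.sqrt_pos.mpr (hg t ht))).ne'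
  have he : ContinuousOn (fun t => √(f t) / √(g t)) (Set.Ioi 0) :=
    hfc.sqrt.div hgc.sqrt fun t ht => (Real.sqrt_pos.mpr (hg t ht)).ne'
  have he' : ContinuousOn (fun t => √(g t) / √(f t)) (Set.Ioi 0) :=
    hgc.sqrt.div hfc.sqrt fun t ht => (Real.sqrt_pos.mpr (hf t ht)).ne'
  have hsp : ∀ t, 0 < t → 0 < √(f t) ∧ 0 < √(g t) ∧ √(f t) * √(f t) = f t ∧
      √(g t) * √(g t) = g t := fun t ht =>
    ⟨Real.sqrt_pos.mpr (hf t ht), Real.sqrt_pos.mpr (hg t ht), Real.mul_self_sqrt (hf t ht).le,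
      Real.mul_self_sqrt (hg t ht).le⟩
  set p := cfc f X
  set q := cfc g X
  set u := cfc (fun t => (f t)⁻¹) X with hu
  set v := cfc (fun t => (g t)⁻¹) X with hv
  set s := cfc (fun t => √(f t) * √(g t)) X with hs_def
  set w := cfc (fun t => (√(f t) * √(g t))⁻¹) X with hw
  set e := cfc (fun t => √(f t) / √(g t)) X with he_def
  set d := cfc (fun t => √(g t) / √(f t)) X with hd
  have hpu : p * u = 1 := by
    rw [hu, ← hmul hfc hfi hX]; exact hone _ fun t ht => mul_inv_cancel₀ (hf t ht).ne'
  have hqv : q * v = 1 := by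
    rw [hv, ← hmul hgc hgi hX]; exact hone _ fun t ht => mul_inv_cancel₀ (hg t ht).ne'
  have hed : e * d = 1 := by
    rw [he_def, hd, ← hmul he he' hX]
    refine hone _ fun t ht => ?_
    obtain ⟨h1, h2, -⟩ := hsp t ht
    field_simp
  have hde : d * e = 1 := by
    rw [he_def, hd, ← hmul he' he hX]
    refine hone _ fun t ht => ?_
    obtain ⟨h1, h2, -⟩ := hsp t ht
    field_simp
  have hsw : s * w = 1 := by
    rw [hs_def, hw, ← hmul hs hsi hX]
    refine hone _ fun t ht => ?_
    obtain ⟨h1, h2, -⟩ := hsp t ht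
    field_simp
  have hws : w * s = 1 := by
    rw [hs_def, hw, ← hmul hsi hs hX]
    refine hone _ fun t ht => ?_
    obtain ⟨h1, h2, -⟩ := hsp t ht
    field_simp
  have hss : s * s = p * q := by
    rw [hs_def, ← hmul hs hs hX, ← hmul hfc hgc hX]
    refine cfc_congr fun t ht => ?_
    obtain ⟨h1, h2, h3, h4⟩ := hsp t (hX.spectrum_pos ht)
    rw [mul_mul_mul_comm, h3, h4]
  have heu : e * u = w := by
    rw [he_def, hu, hw, ← hmul he hfi hX]
    refine cfc_congr fun t ht => ?_
    obtain ⟨h1, h2, h3, h4⟩ := hsp t (hX.spectrum_pos ht)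
    nth_rewrite 2 [← h3]
    field_simp
  have hvd : v * d = w := by
    rw [hd, hv, hw, ← hmul hgi he' hX]
    refine cfc_congr fun t ht => ?_
    obtain ⟨h1, h2, h3, h4⟩ := hsp t (hX.spectrum_pos ht)
    nth_rewrite 1 [← h4]
    field_simp
  rw [hmul hfc hgc hXB, hmul hfc hgc hXB', hmul hfc hgc hX, ← hss]
  have hZsa : IsSelfAdjoint (cfc f (X + B) * cfc g (X + B) + cfc f (X - B) * cfc g (X - B)) := by
    rw [← hmul hfc hgc hXB, ← hmul hfc hgc hXB']
    exact IsSelfAdjoint.add (cfc_predicate _ _) (cfc_predicate _ _)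
  have hK := norm_geometric_mean_le_one (cfc_predicate f (X + B)) (cfc_predicate f (X - B))
    (cfc_predicate g (X + B)) (cfc_predicate g (X - B)) (cfc_predicate f X) (cfc_predicate g X)
    (cfc_predicate _ X) hpu hqv hP hQ
  set Z := (1 / 2 : ℝ) • (cfc f (X + B) * cfc g (X + B) + cfc f (X - B) * cfc g (X - B)) with hZ
  have hZ' : IsSelfAdjoint Z := (IsSelfAdjoint.all (1 / 2 : ℝ)).smul hZsa
  have hw_sa : IsSelfAdjoint w := cfc_predicate _ X
  have hs_sa : IsSelfAdjoint s := cfc_predicate _ X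
  have hW : IsSelfAdjoint (w * Z * w) := by
    have := hZ'.conjugate w
    rwa [hw_sa.star_eq] at this
  have hWK : w * Z * w = e * (u * Z * v) * d := by
    rw [← heu, mul_assoc e u, mul_assoc e, mul_assoc e, mul_assoc (u * Z) v d, hvd, heu]
  have hle : w * Z * w ≤ 1 := by
    rw [← map_one (algebraMap ℝ (H →L[ℂ] H)), le_algebraMap_iff_spectrum_le (a := w * Z * w)]
    intro t ht
    rw [hWK] at ht
    have h1 : t ∈ spectrum ℝ (u * Z * v) := by
      have := spectrum.units_conjugate (R := ℝ) (a := u * Z * v) (u := ⟨e, d, hed, hde⟩)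
      rw [← this]
      exact ht
    have h2 := spectrum.norm_le_norm_mul_of_mem h1
    have h3 : ‖(1 : H →L[ℂ] H)‖ ≤ 1 := ContinuousLinearMap.norm_id_le
    have h4 := mul_le_one₀ hK (norm_nonneg _) h3
    exact (le_abs_self t).trans (h2.trans h4)
  have hfin := star_left_conjugate_le_conjugate hle s
  rw [hs_sa.star_eq, mul_one] at hfin
  have h5 : s * (w * Z * w) * s = Z := by
    rw [mul_assoc w, ← mul_assoc s, hsw, one_mul, mul_assoc, hws, mul_one]
  rw [h5] at hfin
  have h6 := smul_le_smul_of_nonneg_left hfin (zero_le_two (α := ℝ))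
  rw [hZ, smul_smul] at h6
  norm_num at h6
  exact h6

theorem smul_one_le_sum_smul {T : Finset ℝ} {C : ℝ → H →L[ℂ] H} (hC : ∀ t ∈ T, 0 ≤ C t)
    (hsum : ∑ t ∈ T, C t = 1) {w : ℝ → ℝ} {η : ℝ} (hη : ∀ t ∈ T, η ≤ w t) :
    η • 1 ≤ ∑ t ∈ T, w t • C t := by
  rw [← hsum, Finset.smul_sum]
  exact Finset.sum_le_sum fun t ht => smul_le_smul_of_nonneg_right (hη t ht) (hC t ht)

theorem isStrictlyPositive_sum_smul {T : Finset ℝ} {C : ℝ → H →L[ℂ] H} (hC : ∀ t ∈ T, 0 ≤ C t)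
    (hsum : ∑ t ∈ T, C t = 1) {w : ℝ → ℝ} (hw : ∀ t ∈ T, 0 < w t) :
    IsStrictlyPositive (∑ t ∈ T, w t • C t) := by
  obtain ⟨η, hη, hle⟩ : ∃ η > 0, ∀ t ∈ T, η ≤ w t := by
    rcases T.eq_empty_or_nonempty with rfl | hne
    · exact ⟨1, one_pos, by simp⟩
    · obtain ⟨t, ht, hmin⟩ := T.exists_min_image w hne
      exact ⟨w t, hw t ht, hmin⟩
  exact IsStrictlyPositive.of_le (IsStrictlyPositive.smul hη isStrictlyPositive_one)
    (smul_one_le_sum_smul hC hsum hle)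

theorem inv_sum_smul_le {T : Finset ℝ} {C : ℝ → H →L[ℂ] H} (hC : ∀ t ∈ T, 0 ≤ C t)
    (hsum : ∑ t ∈ T, C t = 1) {w : ℝ → ℝ} (hw : ∀ t ∈ T, 0 < w t) {R : H →L[ℂ] H}
    (hR : IsSelfAdjoint R) (hRw : R * ∑ t ∈ T, w t • C t = 1) :
    R ≤ ∑ t ∈ T, (w t)⁻¹ • C t := by
  have h1 : 0 ≤ ∑ t ∈ T, (w t)⁻¹ • ((1 - w t • R) * C t * (1 - w t • R)) := by
    refine Finset.sum_nonneg fun t ht => smul_nonneg (inv_nonneg.mpr (hw t ht).le) ?_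
    have hsa : IsSelfAdjoint (1 - w t • R) :=
      (IsSelfAdjoint.one _).sub ((IsSelfAdjoint.all (w t)).smul hR)
    have := star_left_conjugate_nonneg (hC t ht) (1 - w t • R)
    rwa [hsa.star_eq] at this
  have h2 : ∀ t ∈ T, (w t)⁻¹ • ((1 - w t • R) * C t * (1 - w t • R)) =
      (w t)⁻¹ • C t - R * C t - C t * R + R * (w t • C t) * R := by
    intro t ht
    have hne := (hw t ht).ne'
    simp only [sub_mul, mul_sub, one_mul, mul_one, smul_mul_assoc, mul_smul_comm, smul_sub,
      smul_smul, inv_mul_cancel₀ hne, one_smul]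
    rw [← mul_assoc, inv_mul_cancel₀ hne, one_mul]
    abel
  rw [Finset.sum_congr rfl h2, Finset.sum_add_distrib, Finset.sum_sub_distrib,
    Finset.sum_sub_distrib, ← Finset.mul_sum, ← Finset.sum_mul, ← Finset.sum_mul,
    ← Finset.mul_sum, hRw, hsum, mul_one, one_mul, sub_add_cancel] at h1
  exact sub_nonneg.mp h1

theorem sum_div_add_smul_le_cfc {T : Finset ℝ} {C : ℝ → H →L[ℂ] H} (hT : ∀ t ∈ T, 0 < t)
    (hC : ∀ t ∈ T, 0 ≤ C t) (hsum : ∑ t ∈ T, C t = 1) {s : ℝ} (hs : 0 < s) :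
    ∑ t ∈ T, (t / (t + s)) • C t ≤ cfc (fun t => t / (t + s)) (∑ t ∈ T, t • C t) := by
  have hY : IsStrictlyPositive (∑ t ∈ T, t • C t) := isStrictlyPositive_sum_smul hC hsum hT
  set Y := ∑ t ∈ T, t • C t with hYdef
  have hYsa : IsSelfAdjoint Y := hY.isSelfAdjoint
  have hc : ContinuousOn (fun t : ℝ => (t + s)⁻¹) (spectrum ℝ Y) :=
    ContinuousOn.inv₀ (by fun_prop) fun t ht => by
      have := hY.spectrum_pos ht
      positivity
  have hYs : ∑ t ∈ T, (t + s) • C t = Y + s • 1 := by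
    simp only [add_smul, Finset.sum_add_distrib, ← Finset.smul_sum, hsum, hYdef]
  have hcY : cfc (fun t : ℝ => t + s) Y = Y + s • 1 := by
    rw [cfc_add Y (fun t => t) (fun _ => s), cfc_id' ℝ Y, cfc_const s Y,
      Algebra.algebraMap_eq_smul_one]
  have hR : cfc (fun t : ℝ => (t + s)⁻¹) Y * ∑ t ∈ T, (t + s) • C t = 1 := by
    rw [hYs, ← hcY, ← cfc_mul _ _ Y hc (by fun_prop),
      cfc_congr (g := fun _ => 1) fun t ht => ?_, cfc_const_one ℝ Y]
    have := hY.spectrum_pos ht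
    exact inv_mul_cancel₀ (by positivity)
  have h1 := inv_sum_smul_le hC hsum (fun t ht => add_pos (hT t ht) hs) (cfc_predicate _ Y) hR
  have h2 : cfc (fun t => t / (t + s)) Y = 1 - s • cfc (fun t : ℝ => (t + s)⁻¹) Y := by
    rw [← cfc_const_one ℝ Y, ← cfc_smul s _ Y hc, ← cfc_sub (fun _ => (1 : ℝ)) (fun t => s • (t + s)⁻¹) Y
      (by fun_prop) (hc.const_smul s)]
    refine cfc_congr fun t ht => ?_
    have := hY.spectrum_pos ht
    simp only [smul_eq_mul]
    field_simp
    ring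
  have h3 : ∑ t ∈ T, (t / (t + s)) • C t = 1 - s • ∑ t ∈ T, (t + s)⁻¹ • C t := by
    rw [← hsum, Finset.smul_sum, ← Finset.sum_sub_distrib]
    refine Finset.sum_congr rfl fun t ht => ?_
    have := hT t ht
    have e : t / (t + s) = 1 - s * (t + s)⁻¹ := by
      field_simp
      ring
    rw [smul_smul, e, sub_smul, one_smul]
  rw [h2, h3]
  exact sub_le_sub_left (smul_le_smul_of_nonneg_left h1 hs.le) 1

theorem exists_weights_eq_quadForm [FiniteDimensional ℂ H] {n : ℕ}
    (hn : Module.finrank ℂ H = n) (hn0 : n ≠ 0) {T : Finset ℝ} {C : ℝ → H →L[ℂ] H}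
    (hT : ∀ t ∈ T, 0 < t) (hcard : T.card ≤ n) {Y : H →L[ℂ] H} (hY : IsStrictlyPositive Y)
    (x : H) :
    ∃ (S : Finset ℝ) (a : ℝ → ℝ), (∀ t ∈ S, 0 < t) ∧ S.card = 2 * n ∧ ∀ h : ℝ → ℝ,
      ∑ t ∈ S, a t * h t = quadForm x (cfc h Y) - quadForm x (∑ t ∈ T, h t • C t) := by
  classical
  set P := (spectrum_finite Y).toFinset with hP
  have hPn : P.card ≤ n := hn ▸ card_le_finrank_of_subset_spectrum (T := Y) (by simp [hP])
  obtain ⟨S', hsub, hS'pos, hS'card⟩ := (Set.Ioi_infinite (0 : ℝ)).exists_superset_ncard_eq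
    (s := ((P ∪ T : Finset ℝ) : Set ℝ)) (k := 2 * n)
    (by
      intro t ht
      rcases Finset.mem_union.mp ht with h | h
      · exact hY.spectrum_pos (by simpa [hP] using h)
      · exact hT t h)
    (Finset.finite_toSet _)
    (by
      rw [Set.ncard_coe_finset]
      exact (Finset.card_union_le _ _).trans (by omega))
  have hfin : S'.Finite := Set.finite_of_ncard_ne_zero (by omega)
  have hTS : T ⊆ hfin.toFinset := fun t ht => by
    rw [Set.Finite.mem_toFinset]; exact hsub (Finset.mem_union_right _ ht)
  refine ⟨hfin.toFinset, fun t => quadForm x (cfc (Pi.single t (1 : ℝ)) Y) -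
    if t ∈ T then quadForm x (C t) else 0, fun t ht => hS'pos (by simpa using ht),
    by rw [← Set.ncard_eq_toFinset_card S' hfin, hS'card], fun h => ?_⟩
  have hsp : spectrum ℝ Y ⊆ hfin.toFinset := fun t ht => by
    rw [Set.Finite.coe_toFinset]
    exact hsub (Finset.mem_union_left _ (by simpa [hP] using ht))
  have hTsum : ∑ t ∈ T, quadForm x (h t • C t) =
      ∑ t ∈ hfin.toFinset, if t ∈ T then quadForm x (h t • C t) else 0 := by
    rw [Finset.sum_ite_mem, Finset.inter_eq_right.mpr hTS]
  rw [cfc_eq_sum_single hsp, map_sum, map_sum, hTsum, ← Finset.sum_sub_distrib]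
  refine Finset.sum_congr rfl fun t _ => ?_
  rw [map_smul, smul_eq_mul, sub_mul, mul_comm]
  split_ifs <;> simp [mul_comm]

theorem MidpointConcave.sum_smul_le_cfc [FiniteDimensional ℂ H] {m : ℕ}
    (hn : Module.finrank ℂ H = m + 1) {F : ℝ → ℝ} (hF : ContinuousOn F (Set.Ioi 0))
    (hFpos : ∀ t, 0 < t → 0 < F t) (hconc : MidpointConcave H F)
    {T : Finset ℝ} {C : ℝ → H →L[ℂ] H} (hT : ∀ t ∈ T, 0 < t) (hcard : T.card ≤ m + 1)
    (hC : ∀ t ∈ T, 0 ≤ C t) (hsum : ∑ t ∈ T, C t = 1) :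
    ∑ t ∈ T, F t • C t ≤ cfc F (∑ t ∈ T, t • C t) := by
  have hY : IsStrictlyPositive (∑ t ∈ T, t • C t) := isStrictlyPositive_sum_smul hC hsum hT
  refine le_of_quadForm_le (isSelfAdjoint_sum _ fun t ht =>
    (IsSelfAdjoint.all (F t)).smul (.of_nonneg (hC t ht))) (cfc_predicate _ _) fun x => ?_
  obtain ⟨S, a, hS, hSc, ha⟩ := exists_weights_eq_quadForm (C := C) hn (by omega) hT hcard hY x
  have := sum_mul_nonneg_of_dividedDiff_nonpos hFpos (hconc.dividedDiff_nonpos hn hF) hS hSc a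
    fun s hs => by
      rw [ha fun t => t / (t + s)]
      exact sub_nonneg.mpr (quadForm_mono (sum_div_add_smul_le_cfc hT hC hsum hs) x)
  rw [ha F] at this
  exact sub_nonneg.mp this

theorem MidpointConcave.cfc_mul_le_sum_smul [FiniteDimensional ℂ H] {m : ℕ}
    (hn : Module.finrank ℂ H = m + 1) {F : ℝ → ℝ} (hF : ContinuousOn F (Set.Ioi 0))
    (hFpos : ∀ t, 0 < t → 0 < F t) (hconc : MidpointConcave H F)
    {T : Finset ℝ} {C : ℝ → H →L[ℂ] H} (hT : ∀ t ∈ T, 0 < t) (hcard : T.card ≤ m + 1)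
    (hC : ∀ t ∈ T, 0 ≤ C t) (hsum : ∑ t ∈ T, C t = 1) :
    cfc (fun t => t * F t) (∑ t ∈ T, t • C t) ≤ ∑ t ∈ T, (t * F t) • C t := by
  have hY : IsStrictlyPositive (∑ t ∈ T, t • C t) := isStrictlyPositive_sum_smul hC hsum hT
  refine le_of_quadForm_le (cfc_predicate _ _) (isSelfAdjoint_sum _ fun t ht =>
    (IsSelfAdjoint.all (t * F t)).smul (.of_nonneg (hC t ht))) fun x => ?_
  obtain ⟨S, a, hS, hSc, ha⟩ := exists_weights_eq_quadForm (C := C) hn (by omega) hT hcard hY x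
  have hid := ha fun t => t
  rw [cfc_id' ℝ _ hY.isSelfAdjoint, sub_self] at hid
  have := sum_mul_nonneg_of_dividedDiff_nonpos hFpos (hconc.dividedDiff_nonpos hn hF) hS hSc
    (fun t => -(a t * t)) fun s hs => by
      have e : ∀ t ∈ S, -(a t * t) * (t / (t + s)) = s * (a t * (t / (t + s))) - a t * t := by
        intro t ht
        have := hS t ht
        field_simp
        ring
      rw [Finset.sum_congr rfl e, Finset.sum_sub_distrib, hid, sub_zero, ← Finset.mul_sum,
        ha fun t => t / (t + s)]
      exact mul_nonneg hs.le
        (sub_nonneg.mpr (quadForm_mono (sum_div_add_smul_le_cfc hT hC hsum hs) x))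
  have h2 := ha fun t => t * F t
  have e2 : ∑ t ∈ S, -(a t * t) * F t = -∑ t ∈ S, a t * (t * F t) := by
    rw [← Finset.sum_neg_distrib]
    exact Finset.sum_congr rfl fun t _ => by ring
  rw [e2, h2] at this
  linarith

/-- An infinite-dimensional Hilbert space carries finitely many isometries with mutually
orthogonal ranges. -/
theorem exists_orthogonal_isometries (hH : ¬ FiniteDimensional ℂ H) (κ : Type) [Finite κ]
    [DecidableEq κ] :
    ∃ W : κ → H →L[ℂ] H, ∀ i j, star (W i) * W j = if i = j then 1 else 0 := by
  classical
  obtain ⟨ι, b, -⟩ := exists_hilbertBasis ℂ H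
  have hι : Infinite ι := by
    by_contra h
    rw [not_infinite_iff_finite] at h
    have := Fintype.ofFinite ι
    exact hH b.toOrthonormalBasis.toBasis.finiteDimensional_of_finite
  obtain ⟨e⟩ : Nonempty (ι × κ ↪ ι) := by
    rw [← Cardinal.lift_mk_le']
    simp only [Cardinal.mk_prod, Cardinal.lift_id]
    refine (Cardinal.mul_le_max_of_aleph0_le_left (by simp)).trans (max_le (by simp) ?_)
    exact (Cardinal.lift_lt_aleph0.mpr (Cardinal.lt_aleph0_of_finite κ)).le.trans (by simp)
  have hv : ∀ i : κ, Orthonormal ℂ fun a => b (e (a, i)) := fun i =>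
    b.orthonormal.comp _ fun a c h => (Prod.mk.inj (e.injective h)).1
  let W : κ → H →ₗᵢ[ℂ] H := fun i =>
    (hv i).orthogonalFamily.linearIsometry.comp b.repr.toLinearIsometry
  have hW : ∀ i a, W i (b a) = b (e (a, i)) := fun i a => by
    change (hv i).orthogonalFamily.linearIsometry (b.repr (b a)) = _
    rw [b.repr_self, OrthogonalFamily.linearIsometry_apply_single]
    simp
  refine ⟨fun i => (W i).toContinuousLinearMap, fun i j => ?_⟩
  refine ContinuousLinearMap.ext_on (s := Set.range b)
    (Submodule.dense_iff_topologicalClosure_eq_top.mpr b.dense_span) ?_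
  rintro _ ⟨a, rfl⟩
  refine b.repr.injective (lp.ext (funext fun c => ?_))
  rw [b.repr_apply_apply, b.repr_apply_apply, mul_apply_eq_comp,
    ContinuousLinearMap.star_eq_adjoint, ContinuousLinearMap.adjoint_inner_right]
  change inner ℂ (W i (b c)) (W j (b a)) = _
  rw [hW, hW, orthonormal_iff_ite.mp b.orthonormal]
  by_cases hij : i = j
  · subst hij
    simp [orthonormal_iff_ite.mp b.orthonormal]
  · simp [hij]

theorem aeval_mul_eq_mul_aeval {A : Type*} [Ring A] [Algebra ℝ A] {E V Y : A}
    (h : E * V = V * Y) (p : ℝ[X]) :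
    aeval E p * V = V * aeval Y p := by
  have hpow : ∀ k : ℕ, E ^ k * V = V * Y ^ k := fun k =>
    ((SemiconjBy.pow_right (a := V) (x := Y) (y := E) h.symm k)).symm
  simp only [aeval_eq_sum_range, Finset.sum_mul, Finset.mul_sum, smul_mul_assoc, mul_smul_comm,
    hpow]

theorem IsStrictlyPositive.exists_spectrum_subset_Icc {T : H →L[ℂ] H}
    (hT : IsStrictlyPositive T) : ∃ a > 0, spectrum ℝ T ⊆ Set.Icc a ‖T‖ := by
  rcases subsingleton_or_nontrivial (H →L[ℂ] H) with h | h
  · exact ⟨1, one_pos, by simp [spectrum.of_subsingleton]⟩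
  obtain ⟨a, ha, haT⟩ := (CFC.exists_pos_algebraMap_le_iff hT.isSelfAdjoint).mpr
    fun t ht => hT.spectrum_pos ht
  exact ⟨a, ha, fun t ht => ⟨(algebraMap_le_iff_le_spectrum (a := T)).mp haT t ht,
    (le_algebraMap_iff_spectrum_le (a := T)).mp hT.isSelfAdjoint.le_algebraMap_norm_self t ht⟩⟩

theorem cfc_mul_eq_mul_cfc {F : ℝ → ℝ} (hF : ContinuousOn F (Set.Ioi 0)) {E V Y : H →L[ℂ] H}
    (hE : IsStrictlyPositive E) (hY : IsStrictlyPositive Y) (h : E * V = V * Y) :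
    cfc F E * V = V * cfc F Y := by
  obtain ⟨a, ha, haE⟩ := hE.exists_spectrum_subset_Icc
  obtain ⟨c, hc, hcY⟩ := hY.exists_spectrum_subset_Icc
  have hEsub : spectrum ℝ E ⊆ Set.Icc (min a c) (max ‖E‖ ‖Y‖) :=
    haE.trans (Set.Icc_subset_Icc (min_le_left _ _) (le_max_left _ _))
  have hYsub : spectrum ℝ Y ⊆ Set.Icc (min a c) (max ‖E‖ ‖Y‖) :=
    hcY.trans (Set.Icc_subset_Icc (min_le_right _ _) (le_max_right _ _))
  have hFc : ContinuousOn F (Set.Icc (min a c) (max ‖E‖ ‖Y‖)) :=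
    hF.mono fun t ht => (lt_min ha hc).trans_le ht.1
  have hbound : ∀ ε > 0, ‖cfc F E * V - V * cfc F Y‖ ≤ ε * (2 * ‖V‖) := by
    intro ε hε
    obtain ⟨p, hp⟩ := exists_polynomial_near_of_continuousOn _ _ F hFc ε hε
    have key : ∀ T : H →L[ℂ] H, IsSelfAdjoint T →
        spectrum ℝ T ⊆ Set.Icc (min a c) (max ‖E‖ ‖Y‖) → ‖cfc F T - aeval T p‖ ≤ ε := by
      intro T hT hTs
      rw [← cfc_polynomial p T, ← cfc_sub F p.eval T (hFc.mono hTs)]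
      refine norm_cfc_le hε.le fun t ht => ?_
      rw [← norm_neg, neg_sub]
      exact (hp t (hTs ht)).le
    have e : cfc F E * V - V * cfc F Y =
        (cfc F E - aeval E p) * V - V * (cfc F Y - aeval Y p) := by
      rw [sub_mul, mul_sub, aeval_mul_eq_mul_aeval h]
      abel
    rw [e]
    refine (norm_sub_le _ _).trans ?_
    have h1 := (norm_mul_le (cfc F E - aeval E p) V).trans
      (mul_le_mul_of_nonneg_right (key E hE.isSelfAdjoint hEsub) (norm_nonneg V))
    have h2 := (norm_mul_le V (cfc F Y - aeval Y p)).trans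
      (mul_le_mul_of_nonneg_left (key Y hY.isSelfAdjoint hYsub) (norm_nonneg V))
    linarith
  rw [← sub_eq_zero, ← norm_le_zero_iff]
  refine le_of_forall_pos_le_add fun δ hδ => ?_
  have := hbound (δ / (2 * ‖V‖ + 1)) (by positivity)
  refine this.trans ?_
  rw [zero_add, div_mul_eq_mul_div, div_le_iff₀ (by positivity)]
  nlinarith

theorem cfc_smul_one (F : ℝ → ℝ) (t : ℝ) : cfc F (t • (1 : H →L[ℂ] H)) = F t • 1 := by
  rw [← Algebra.algebraMap_eq_smul_one, cfc_algebraMap, Algebra.algebraMap_eq_smul_one]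

theorem sum_smul_le_cfc_of_isometry {F : ℝ → ℝ} (hF : ContinuousOn F (Set.Ioi 0))
    (hconc : MidpointConcave H F) {D V Y : H →L[ℂ] H} (hD : IsStrictlyPositive D)
    (hY : IsStrictlyPositive Y) (hV : star V * V = 1) (hVD : star V * (D * V) = Y) :
    star V * (cfc F D * V) ≤ cfc F Y := by
  set R : H →L[ℂ] H := (2 : ℝ) • (V * star V) - 1 with hR
  have hRV : R * V = V := by
    rw [hR, sub_mul, smul_mul_assoc, mul_assoc, hV, mul_one, one_mul, two_smul]
    abel
  have hRsa : star R = R := by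
    rw [hR, star_sub, star_smul, star_mul, star_star, star_one, star_trivial]
  have hVR : star V * R = star V := by
    rw [← hRsa, ← star_mul, hRV]
  have hRR : R * R = 1 := by
    nth_rewrite 2 [hR]
    rw [mul_sub, mul_smul_comm, ← mul_assoc, hRV, mul_one, hR]
    abel
  have hRu : IsUnit R := ⟨⟨R, R, hRR, hRR⟩, rfl⟩
  have hRDR : IsStrictlyPositive (R * D * R) := by
    refine ⟨?_, (hRu.mul hD.isUnit).mul hRu⟩
    have := star_left_conjugate_nonneg hD.nonneg R
    rwa [hRsa] at this
  set E := (1 / 2 : ℝ) • (D + R * D * R) with hE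
  set B := (1 / 2 : ℝ) • (D - R * D * R) with hB
  have hEB : E + B = D := by
    rw [hE, hB, ← smul_add, show D + R * D * R + (D - R * D * R) = (2 : ℝ) • D by
      rw [two_smul]; abel, smul_smul]
    norm_num
  have hEB' : E - B = R * D * R := by
    rw [hE, hB, ← smul_sub, show D + R * D * R - (D - R * D * R) = (2 : ℝ) • (R * D * R) by
      rw [two_smul]; abel, smul_smul]
    norm_num
  have hEpos : IsStrictlyPositive E :=
    IsStrictlyPositive.smul (by norm_num) (hD.add_nonneg hRDR.nonneg)
  have hEV : E * V = V * Y := by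
    rw [hE, smul_mul_assoc, add_mul, mul_assoc (R * D), hRV, mul_assoc R, hR, sub_mul,
      one_mul, smul_mul_assoc, mul_assoc V, hVD, add_sub_cancel, smul_smul]
    norm_num
  have hmid := hconc E B (hEB ▸ hD) (hEB' ▸ hRDR)
  rw [hEB, hEB'] at hmid
  have hcR : cfc F (R * D * R) * R = R * cfc F D :=
    cfc_mul_eq_mul_cfc hF hRDR hD (by rw [mul_assoc (R * D), hRR, mul_one])
  have hcR' : star V * (cfc F (R * D * R) * V) = star V * (cfc F D * V) := by
    rw [show cfc F (R * D * R) * V = R * (cfc F D * V) by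
      rw [← mul_assoc, ← hcR, mul_assoc (cfc F _), hRV], ← mul_assoc, hVR]
  have hcE : star V * (cfc F E * V) = cfc F Y := by
    rw [cfc_mul_eq_mul_cfc hF hEpos hY hEV, ← mul_assoc, hV, one_mul]
  have hconj := star_left_conjugate_le_conjugate hmid V
  rw [mul_assoc (star V), mul_assoc (star V), add_mul, mul_add, hcR', smul_mul_assoc, mul_smul_comm, hcE,
    ← two_smul ℝ (star V * (cfc F D * V))] at hconj
  have := smul_le_smul_of_nonneg_left hconj (by norm_num : (0 : ℝ) ≤ 1 / 2)
  rw [smul_smul, smul_smul] at this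
  norm_num at this
  exact this

/-- The operator Jensen inequality in infinite dimensions, by dilation to orthogonal isometries. -/
theorem MidpointConcave.sum_smul_le_cfc_of_infinite (hH : ¬ FiniteDimensional ℂ H) {F : ℝ → ℝ}
    (hF : ContinuousOn F (Set.Ioi 0)) (hconc : MidpointConcave H F)
    {T : Finset ℝ} {C : ℝ → H →L[ℂ] H} (hT : ∀ t ∈ T, 0 < t)
    (hC : ∀ t ∈ T, 0 ≤ C t) (hsum : ∑ t ∈ T, C t = 1) :
    ∑ t ∈ T, F t • C t ≤ cfc F (∑ t ∈ T, t • C t) := by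
  obtain ⟨W', hW'⟩ := exists_orthogonal_isometries hH T
  let W : ℝ → H →L[ℂ] H := fun t => if h : t ∈ T then W' ⟨t, h⟩ else 0
  have hW : ∀ s ∈ T, ∀ t ∈ T, star (W s) * W t = if s = t then 1 else 0 := by
    intro s hs t ht
    simp only [W, hs, ht, dif_pos, hW', Subtype.mk.injEq]
  set Q : H →L[ℂ] H := 1 - ∑ t ∈ T, W t * star (W t) with hQ
  have hQW : ∀ t ∈ T, Q * W t = 0 := by
    intro t ht
    rw [hQ, sub_mul, one_mul, Finset.sum_mul, Finset.sum_eq_single_of_mem t ht, mul_assoc,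
      hW t ht t ht, if_pos rfl, mul_one, sub_self]
    intro s hs hst
    rw [mul_assoc, hW s hs t ht, if_neg hst, mul_zero]
  have hQsa : star Q = Q := by
    simp only [hQ, star_sub, star_one, star_sum, star_mul, star_star]
  have hQ0 : 0 ≤ Q := by
    have h1 : star Q * Q = Q := by
      rw [hQsa]
      nth_rewrite 2 [hQ]
      rw [mul_sub, mul_one, Finset.mul_sum, Finset.sum_eq_zero, sub_zero]
      intro t ht
      rw [← mul_assoc, hQW t ht, zero_mul]
    rw [← h1]
    exact star_mul_self_nonneg Q
  set D := ∑ t ∈ T, t • (W t * star (W t)) + Q with hDdef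
  have hDW : ∀ t ∈ T, D * W t = W t * (t • 1) := by
    intro t ht
    rw [hDdef, add_mul, hQW t ht, add_zero, Finset.sum_mul, Finset.sum_eq_single_of_mem t ht,
      smul_mul_assoc, mul_assoc, hW t ht t ht, if_pos rfl, mul_one, mul_smul_comm, mul_one]
    intro s hs hst
    rw [smul_mul_assoc, mul_assoc, hW s hs t ht, if_neg hst, mul_zero, smul_zero]
  obtain ⟨η, hη, hη1, hle⟩ : ∃ η > (0 : ℝ), η ≤ 1 ∧ ∀ t ∈ T, η ≤ t := by
    rcases T.eq_empty_or_nonempty with rfl | hne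
    · exact ⟨1, one_pos, le_rfl, by simp⟩
    · exact ⟨min 1 (T.min' hne), lt_min one_pos (hT _ (T.min'_mem hne)), min_le_left _ _,
        fun t ht => (min_le_right _ _).trans (T.min'_le t ht)⟩
  have hD : IsStrictlyPositive D := by
    refine IsStrictlyPositive.of_le (IsStrictlyPositive.smul hη isStrictlyPositive_one) ?_
    have e : (1 : H →L[ℂ] H) = ∑ t ∈ T, W t * star (W t) + Q := by rw [hQ]; abel
    rw [e, hDdef, smul_add, Finset.smul_sum]
    refine add_le_add (Finset.sum_le_sum fun t ht =>
      smul_le_smul_of_nonneg_right (hle t ht) (mul_star_self_nonneg _)) ?_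
    simpa using smul_le_smul_of_nonneg_right hη1 hQ0
  have hcD : ∀ t ∈ T, cfc F D * W t = F t • W t := by
    intro t ht
    rw [cfc_mul_eq_mul_cfc hF hD (IsStrictlyPositive.smul (hT t ht) isStrictlyPositive_one)
      (hDW t ht), cfc_smul_one, mul_smul_comm, mul_one]
  set V := ∑ t ∈ T, W t * CFC.sqrt (C t) with hVdef
  have hsa : ∀ t, star (CFC.sqrt (C t)) = CFC.sqrt (C t) := fun t =>
    (IsSelfAdjoint.of_nonneg (CFC.sqrt_nonneg (C t))).star_eq
  have hstarV : star V = ∑ t ∈ T, CFC.sqrt (C t) * star (W t) := by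
    simp only [hVdef, star_sum, star_mul, hsa]
  have hcomp : ∀ c : ℝ → ℝ, star V * ∑ t ∈ T, c t • (W t * CFC.sqrt (C t)) =
      ∑ t ∈ T, c t • C t := by
    intro c
    rw [hstarV, Finset.sum_mul]
    refine Finset.sum_congr rfl fun s hs => ?_
    rw [Finset.mul_sum, Finset.sum_eq_single_of_mem s hs]
    · rw [mul_smul_comm, mul_assoc, ← mul_assoc (star (W s)), hW s hs s hs, if_pos rfl, one_mul,
        CFC.sqrt_mul_sqrt_self (C s) (hC s hs)]
    · intro t ht hts
      rw [mul_smul_comm, mul_assoc, ← mul_assoc (star (W s)), hW s hs t ht, if_neg hts.symm,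
        zero_mul, mul_zero, smul_zero]
  have hVV : star V * V = 1 := by
    have := hcomp fun _ => 1
    simpa only [one_smul, hsum] using this
  have hVD : star V * (D * V) = ∑ t ∈ T, t • C t := by
    rw [← hcomp fun t => t, hVdef, Finset.mul_sum]
    congr 1
    refine Finset.sum_congr rfl fun t ht => ?_
    rw [← mul_assoc, hDW t ht, mul_smul_comm, mul_one, smul_mul_assoc]
  have hVF : star V * (cfc F D * V) = ∑ t ∈ T, F t • C t := by
    rw [← hcomp F, hVdef, Finset.mul_sum]
    congr 1
    refine Finset.sum_congr rfl fun t ht => ?_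
    rw [← mul_assoc, hcD t ht, smul_mul_assoc]
  rw [← hVF]
  exact sum_smul_le_cfc_of_isometry hF hconc hD (isStrictlyPositive_sum_smul hC hsum hT) hVV hVD

theorem norm_le_of_neg_smul_one_le {T : H →L[ℂ] H} {ε : ℝ} (hε : 0 ≤ ε) (hT : IsSelfAdjoint T)
    (h₁ : -ε • (1 : H →L[ℂ] H) ≤ T) (h₂ : T ≤ ε • (1 : H →L[ℂ] H)) : ‖T‖ ≤ ε := by
  rw [← Algebra.algebraMap_eq_smul_one] at h₁ h₂
  rw [← cfc_id' ℝ T]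
  exact norm_cfc_le hε fun x hx => abs_le.mpr ⟨(algebraMap_le_iff_le_spectrum (a := T)).mp h₁ x hx,
    (le_algebraMap_iff_spectrum_le (a := T)).mp h₂ x hx⟩

namespace IsUnitalPositiveMap

variable {Φ : (H →L[ℂ] H) →ₗ[ℂ] (H →L[ℂ] H)}

theorem map_le_map (hΦ : IsUnitalPositiveMap Φ) {X Y : H →L[ℂ] H} (h : X ≤ Y) : Φ X ≤ Φ Y := by
  rw [← sub_nonneg, ← map_sub]
  exact hΦ.2 _ (sub_nonneg.mpr h)

theorem map_smul_one (hΦ : IsUnitalPositiveMap Φ) (c : ℝ) :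
    Φ (c • (1 : H →L[ℂ] H)) = c • (1 : H →L[ℂ] H) := by
  rw [LinearMap.map_smul_of_tower, hΦ.1]

theorem map_isStrictlyPositive (hΦ : IsUnitalPositiveMap Φ) {X : H →L[ℂ] H}
    (hX : IsStrictlyPositive X) : IsStrictlyPositive (Φ X) := by
  obtain ⟨a, ha, hsub⟩ := hX.exists_spectrum_subset_Icc
  have h : a • (1 : H →L[ℂ] H) ≤ X := by
    rw [← Algebra.algebraMap_eq_smul_one]
    exact (algebraMap_le_iff_le_spectrum (a := X) hX.isSelfAdjoint).mpr fun t ht => (hsub ht).1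
  refine IsStrictlyPositive.of_le (IsStrictlyPositive.smul ha isStrictlyPositive_one) ?_
  rw [← hΦ.map_smul_one]
  exact hΦ.map_le_map h

theorem isSelfAdjoint_map_cfc (hΦ : IsUnitalPositiveMap Φ) (h : ℝ → ℝ) (A : H →L[ℂ] H) :
    IsSelfAdjoint (Φ (cfc h A)) := by
  have hX : IsSelfAdjoint (cfc h A) := cfc_predicate h A
  have h₁ : 0 ≤ cfc h A + ‖cfc h A‖ • (1 : H →L[ℂ] H) := by
    have := hX.neg_algebraMap_norm_le_self
    rw [Algebra.algebraMap_eq_smul_one] at this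
    exact neg_le_iff_add_nonneg.mp this
  have h₂ := (hΦ.2 _ h₁).isSelfAdjoint
  rw [map_add, hΦ.map_smul_one] at h₂
  simpa using h₂.sub ((IsSelfAdjoint.all ‖cfc h A‖).smul (.one (H →L[ℂ] H)))

theorem norm_map_cfc_le (hΦ : IsUnitalPositiveMap Φ) {h : ℝ → ℝ} {A : H →L[ℂ] H}
    (hA : IsSelfAdjoint A) (hc : ContinuousOn h (spectrum ℝ A)) {ε : ℝ} (hε : 0 ≤ ε)
    (hle : ∀ t ∈ spectrum ℝ A, |h t| ≤ ε) : ‖Φ (cfc h A)‖ ≤ ε := by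
  refine norm_le_of_neg_smul_one_le hε (hΦ.isSelfAdjoint_map_cfc h A) ?_ ?_
  · rw [← hΦ.map_smul_one]
    refine hΦ.map_le_map ?_
    rw [← Algebra.algebraMap_eq_smul_one]
    exact (algebraMap_le_cfc_iff h _ A hc hA).mpr fun t ht => (abs_le.mp (hle t ht)).1
  · rw [← hΦ.map_smul_one]
    refine hΦ.map_le_map ?_
    rw [← Algebra.algebraMap_eq_smul_one]
    exact (cfc_le_algebraMap_iff h _ A hc hA).mpr fun t ht => (abs_le.mp (hle t ht)).2

/-- A unital positive map on the functional calculus of `A` is approximated by finite positive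
partitions of unity supported on the spectrum. -/
theorem exists_sum_smul_approx (hΦ : IsUnitalPositiveMap Φ) {A : H →L[ℂ] H}
    (hA : IsSelfAdjoint A) {h₁ h₂ : ℝ → ℝ} (hc₁ : ContinuousOn h₁ (spectrum ℝ A))
    (hc₂ : ContinuousOn h₂ (spectrum ℝ A)) {ε : ℝ} (hε : 0 < ε) :
    ∃ (T : Finset ℝ) (C : ℝ → H →L[ℂ] H), (T : Set ℝ) ⊆ spectrum ℝ A ∧ (∀ t ∈ T, 0 ≤ C t) ∧
      ∑ t ∈ T, C t = 1 ∧ ‖Φ (cfc h₁ A) - ∑ t ∈ T, h₁ t • C t‖ ≤ ε ∧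
      ‖Φ (cfc h₂ A) - ∑ t ∈ T, h₂ t • C t‖ ≤ ε := by
  have hK : IsCompact (spectrum ℝ A) := spectrum.isCompact A
  obtain ⟨δ₁, hδ₁, hu₁⟩ := Metric.uniformContinuousOn_iff_le.mp
    (hK.uniformContinuousOn_of_continuous hc₁) ε hε
  obtain ⟨δ₂, hδ₂, hu₂⟩ := Metric.uniformContinuousOn_iff_le.mp
    (hK.uniformContinuousOn_of_continuous hc₂) ε hε
  set δ := min δ₁ δ₂
  have hδ : 0 < δ := lt_min hδ₁ hδ₂
  obtain ⟨T', hT', hfin, hcov⟩ := finite_cover_balls_of_compact hK hδ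
  obtain ⟨T, rfl⟩ := hfin.exists_finset_coe
  let ψ : ℝ → ℝ → ℝ := fun t u => max 0 (δ - |u - t|)
  have hψ : ∀ t u, 0 ≤ ψ t u := fun t u => le_max_left _ _
  have hψc : ∀ t, Continuous (ψ t) := fun t => by fun_prop
  have hS : ∀ u ∈ spectrum ℝ A, 0 < ∑ t ∈ T, ψ t u := fun u hu => by
    obtain ⟨t, ht, hut⟩ := Set.mem_iUnion₂.mp (hcov hu)
    refine Finset.sum_pos' (fun t _ => hψ t u) ⟨t, ht, lt_max_of_lt_right (sub_pos.mpr ?_)⟩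
    simpa [Real.dist_eq] using hut
  let φ : ℝ → ℝ → ℝ := fun t u => ψ t u / ∑ t ∈ T, ψ t u
  have hφc : ∀ t, ContinuousOn (φ t) (spectrum ℝ A) := fun t =>
    (hψc t).continuousOn.div (continuous_finsetSum _ fun t _ => hψc t).continuousOn
      fun u hu => (hS u hu).ne'
  have hφ : ∀ t, ∀ u ∈ spectrum ℝ A, 0 ≤ φ t u := fun t u hu => div_nonneg (hψ t u) (hS u hu).le
  have hφsum : ∀ u ∈ spectrum ℝ A, ∑ t ∈ T, φ t u = 1 := fun u hu => by
    rw [← Finset.sum_div, div_self (hS u hu).ne']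
  have hwc : ∀ w : ℝ → ℝ, ContinuousOn (fun u => ∑ t ∈ T, w t * φ t u) (spectrum ℝ A) := fun w =>
    continuousOn_finsetSum _ fun t _ => (hφc t).const_mul _
  have hw : ∀ w : ℝ → ℝ, ∑ t ∈ T, w t • Φ (cfc (φ t) A) =
      Φ (cfc (fun u => ∑ t ∈ T, w t * φ t u) A) := fun w => by
    have hsum : (fun u => ∑ t ∈ T, w t * φ t u) = ∑ t ∈ T, fun u => w t * φ t u := by
      ext u
      simp
    rw [hsum, cfc_sum (fun t u => w t * φ t u) A T fun t _ => (hφc t).const_mul _, map_sum]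
    refine Finset.sum_congr rfl fun t _ => ?_
    rw [cfc_const_mul _ _ A (hφc t), LinearMap.map_smul_of_tower]
  have happrox : ∀ h : ℝ → ℝ, ContinuousOn h (spectrum ℝ A) →
      (∀ u ∈ spectrum ℝ A, ∀ t ∈ spectrum ℝ A, dist u t ≤ δ → dist (h u) (h t) ≤ ε) →
      ‖Φ (cfc h A) - ∑ t ∈ T, h t • Φ (cfc (φ t) A)‖ ≤ ε := fun h hc hu => by
    rw [hw, ← map_sub, ← cfc_sub _ _ A hc (hwc h)]
    refine hΦ.norm_map_cfc_le hA (hc.sub (hwc h)) hε.le fun u hus => ?_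
    have : h u - ∑ t ∈ T, h t * φ t u = ∑ t ∈ T, (h u - h t) * φ t u := by
      simp_rw [sub_mul, Finset.sum_sub_distrib, ← Finset.mul_sum, hφsum u hus, mul_one]
    change |h u - ∑ t ∈ T, h t * φ t u| ≤ ε
    rw [this]
    calc |∑ t ∈ T, (h u - h t) * φ t u| ≤ ∑ t ∈ T, |(h u - h t) * φ t u| :=
          Finset.abs_sum_le_sum_abs _ _
      _ ≤ ∑ t ∈ T, ε * φ t u := by
          refine Finset.sum_le_sum fun t ht => ?_
          rw [abs_mul, abs_of_nonneg (hφ t u hus)]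
          rcases le_total |u - t| δ with hut | hut
          · exact mul_le_mul_of_nonneg_right (hu u hus t (hT' ht) hut) (hφ t u hus)
          · have : φ t u = 0 := by simp [φ, ψ, hut]
            simp [this]
      _ = ε := by rw [← Finset.mul_sum, hφsum u hus, mul_one]
  refine ⟨T, fun t => Φ (cfc (φ t) A), hT', fun t _ => hΦ.2 _ (cfc_nonneg (hφ t)), ?_,
    happrox h₁ hc₁ fun u hu t ht h => hu₁ u hu t ht (h.trans (min_le_left _ _)),
    happrox h₂ hc₂ fun u hu t ht h => hu₂ u hu t ht (h.trans (min_le_right _ _))⟩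
  have h1 := hw fun _ => 1
  simp only [one_smul, one_mul] at h1
  rw [h1, cfc_congr (g := fun _ => 1) hφsum, cfc_const_one ℝ A, hΦ.1]

end IsUnitalPositiveMap

theorem spectrum_subset_Icc_of_smul_one_le {T : H →L[ℂ] H} (hT : IsSelfAdjoint T) {a b : ℝ}
    (h₁ : a • (1 : H →L[ℂ] H) ≤ T) (h₂ : T ≤ b • (1 : H →L[ℂ] H)) :
    spectrum ℝ T ⊆ Set.Icc a b := by
  rw [← Algebra.algebraMap_eq_smul_one] at h₁ h₂
  exact fun x hx => ⟨(algebraMap_le_iff_le_spectrum (a := T)).mp h₁ x hx,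
    (le_algebraMap_iff_spectrum_le (a := T)).mp h₂ x hx⟩

theorem sum_smul_mul_self_le {T : Finset ℝ} {C : ℝ → H →L[ℂ] H} (hC : ∀ t ∈ T, 0 ≤ C t)
    (hsum : ∑ t ∈ T, C t = 1) (w : ℝ → ℝ) :
    (∑ t ∈ T, w t • C t) * (∑ t ∈ T, w t • C t) ≤ ∑ t ∈ T, w t ^ 2 • C t := by
  set M := ∑ t ∈ T, w t • C t with hM
  have hMsa : IsSelfAdjoint M := isSelfAdjoint_sum _ fun t ht =>
    (IsSelfAdjoint.all (w t)).smul (hC t ht).isSelfAdjoint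
  have key : ∑ t ∈ T, (w t • (1 : H →L[ℂ] H) - M) * C t * (w t • (1 : H →L[ℂ] H) - M) =
      ∑ t ∈ T, w t ^ 2 • C t - M * M := by
    have h : ∀ t ∈ T, (w t • (1 : H →L[ℂ] H) - M) * C t * (w t • (1 : H →L[ℂ] H) - M) =
        w t ^ 2 • C t - (w t • C t) * M - M * (w t • C t) + M * C t * M := fun t _ => by
      simp only [sub_mul, mul_sub, smul_mul_assoc, mul_smul_comm, one_mul, mul_one, smul_sub,
        smul_smul, pow_two]
      abel
    rw [Finset.sum_congr rfl h, Finset.sum_add_distrib, Finset.sum_sub_distrib,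
      Finset.sum_sub_distrib, ← Finset.sum_mul, ← Finset.mul_sum, ← Finset.sum_mul,
      ← Finset.mul_sum, hsum, ← hM, mul_one]
    abel
  rw [← sub_nonneg, ← key]
  refine Finset.sum_nonneg fun t ht => ?_
  have hsa : IsSelfAdjoint (w t • (1 : H →L[ℂ] H) - M) :=
    ((IsSelfAdjoint.all (w t)).smul (.one (H →L[ℂ] H))).sub hMsa
  simpa only [hsa.star_eq] using star_left_conjugate_nonneg (hC t ht) (w t • (1 : H →L[ℂ] H) - M)

theorem tendsto_of_norm_sub_le_one_div {E : Type*} [NormedAddCommGroup E] {x : ℕ → E} {y : E}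
    (h : ∀ n, ‖y - x n‖ ≤ 1 / ((n : ℝ) + 1)) : Filter.Tendsto x Filter.atTop (nhds y) := by
  rw [tendsto_iff_norm_sub_tendsto_zero]
  exact squeeze_zero (fun n => norm_nonneg _) (fun n => by rw [norm_sub_rev]; exact h n)
    tendsto_one_div_add_atTop_nhds_zero_nat

namespace IsUnitalPositiveMap

variable {Φ : (H →L[ℂ] H) →ₗ[ℂ] (H →L[ℂ] H)}

/-- The Kadison inequality on the functional calculus of a self-adjoint operator. -/
theorem map_cfc_mul_self_le (hΦ : IsUnitalPositiveMap Φ) {A : H →L[ℂ] H}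
    (hA : IsSelfAdjoint A) {f : ℝ → ℝ} (hf : ContinuousOn f (spectrum ℝ A)) :
    Φ (cfc f A) * Φ (cfc f A) ≤ Φ (cfc (fun t => f t ^ 2) A) := by
  choose T C _ hC hsum h₁ h₂ using fun n : ℕ =>
    hΦ.exists_sum_smul_approx hA hf (hf.pow 2) (Nat.one_div_pos_of_nat (α := ℝ) (n := n))
  have l₁ := tendsto_of_norm_sub_le_one_div h₁
  have l₂ := tendsto_of_norm_sub_le_one_div h₂
  exact le_of_tendsto_of_tendsto' (l₁.mul l₁) l₂ fun n => sum_smul_mul_self_le (hC n) (hsum n) f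

/-- The Choi-Davis inequality, reduced to finite positive partitions of unity. -/
theorem map_cfc_le_cfc_map (hΦ : IsUnitalPositiveMap Φ) {A : H →L[ℂ] H}
    (hA : IsStrictlyPositive A) {F : ℝ → ℝ} (hF : ContinuousOn F (Set.Ioi 0))
    (hJ : ∀ (T : Finset ℝ) (C : ℝ → H →L[ℂ] H), (T : Set ℝ) ⊆ spectrum ℝ A →
      (∀ t ∈ T, 0 ≤ C t) → ∑ t ∈ T, C t = 1 →
      ∑ t ∈ T, F t • C t ≤ cfc F (∑ t ∈ T, t • C t)) :
    Φ (cfc F A) ≤ cfc F (Φ A) := by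
  choose T C hT hC hsum h₁ h₂ using fun n : ℕ =>
    hΦ.exists_sum_smul_approx hA.isSelfAdjoint (continuousOn_id' _)
      (hA.continuousOn_spectrum hF) (Nat.one_div_pos_of_nat (α := ℝ) (n := n))
  rw [cfc_id' ℝ A hA.isSelfAdjoint] at h₁
  have l₁ := tendsto_of_norm_sub_le_one_div h₁
  have l₂ := tendsto_of_norm_sub_le_one_div h₂
  obtain ⟨a, ha, hsub⟩ := hA.exists_spectrum_subset_Icc
  have hlo : ∀ n, a • (1 : H →L[ℂ] H) ≤ ∑ t ∈ T n, t • C n t := fun n =>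
    smul_one_le_sum_smul (hC n) (hsum n) fun t ht => (hsub (hT n ht)).1
  have hhi : ∀ n, ∑ t ∈ T n, t • C n t ≤ ‖A‖ • (1 : H →L[ℂ] H) := fun n => by
    have := smul_one_le_sum_smul (hC n) (hsum n) (w := fun t => -t) (η := -‖A‖)
      fun t ht => neg_le_neg (hsub (hT n ht)).2
    simpa only [neg_smul, Finset.sum_neg_distrib, neg_le_neg_iff] using this
  have hsa : ∀ n, IsSelfAdjoint (∑ t ∈ T n, t • C n t) := fun n =>
    isSelfAdjoint_sum _ fun t ht => (IsSelfAdjoint.all t).smul (hC n t ht).isSelfAdjoint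
  have hΦA := (hΦ.map_isStrictlyPositive hA).isSelfAdjoint
  refine le_of_tendsto_of_tendsto' l₂ (l₁.cfc isCompact_Icc F
    (.of_forall fun n => spectrum_subset_Icc_of_smul_one_le (hsa n) (hlo n) (hhi n))
    (.of_forall hsa) (spectrum_subset_Icc_of_smul_one_le hΦA (ge_of_tendsto' l₁ hlo)
    (le_of_tendsto' l₁ hhi)) hΦA (hF.mono fun t ht => ha.trans_le ht.1))
    fun n => hJ (T n) (C n) (hT n) (hC n) (hsum n)

end IsUnitalPositiveMap

theorem exists_partialIsometry_opAbs_le {X Y Z p q M : H →L[ℂ] H} (hX : IsSelfAdjoint X)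
    (hY : IsStrictlyPositive Y) (hZ : IsStrictlyPositive Z) (hp : IsStrictlyPositive p)
    (hq : IsStrictlyPositive q) (hYp : Commute Y p) (hYq : Commute Y q) (hpq : Commute p q)
    (hXp : X * X ≤ p * p) (hZq : Z * Z ≤ q * q) (hM : Y * p * q ≤ M) :
    ∃ U : H →L[ℂ] H, U * star U * U = U ∧ opAbs (X * Y * Z) ≤ star U * M * U := by
  set S := p * Y * Z with hS
  have hSu : IsUnit S := (hp.isUnit.mul hY.isUnit).mul hZ.isUnit
  have hpsa := hp.isSelfAdjoint.star_eq
  have hqsa := hq.isSelfAdjoint.star_eq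
  have hYsa := hY.isSelfAdjoint.star_eq
  have hZsa := hZ.isSelfAdjoint.star_eq
  have hSstar : star S = Z * Y * p := by
    simp only [hS, star_mul, hpsa, hYsa, hZsa, mul_assoc]
  set a := CFC.sqrt (star S * S) with ha
  have hSS : 0 ≤ star S * S := star_mul_self_nonneg S
  have haa : a * a = star S * S := CFC.sqrt_mul_sqrt_self _ hSS
  have ha0 : 0 ≤ a := CFC.sqrt_nonneg _
  have hau : IsUnit a := (CFC.isUnit_sqrt_iff _ hSS).mpr (hSu.star.mul hSu)
  have hasa := ha0.isSelfAdjoint.star_eq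
  obtain ⟨u, hu⟩ := hau
  set b : H →L[ℂ] H := ↑u⁻¹ with hb
  have hab : a * b = 1 := by rw [← hu, hb, Units.mul_inv]
  have hba : b * a = 1 := by rw [← hu, hb, Units.inv_mul]
  have hbsa : star b = b := by
    calc star b = star b * (a * b) := by rw [hab, mul_one]
      _ = star (a * b) * b := by rw [star_mul, hasa, mul_assoc]
      _ = b := by rw [hab, star_one, one_mul]
  set V := S * b with hV
  have hVV : star V * V = 1 := by
    calc star V * V = b * (star S * S) * b := by rw [hV, star_mul, hbsa]; simp only [mul_assoc]
      _ = b * a * (a * b) := by rw [← haa]; simp only [mul_assoc]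
      _ = 1 := by rw [hba, hab, one_mul]
  have hVa : V * a = S := by rw [hV, mul_assoc, hba, mul_one]
  have hsqrt : CFC.sqrt (S * star S) = V * a * star V := by
    refine CFC.sqrt_unique ?_ (star_right_conjugate_nonneg ha0 V)
    calc V * a * star V * (V * a * star V) = V * a * (star V * V) * (a * star V) := by
          simp only [mul_assoc]
      _ = (V * a) * star (V * a) := by rw [hVV, mul_one, star_mul V a, hasa]
      _ = S * star S := by rw [hVa]
  have hYpq0 : 0 ≤ Y * p * q :=
    ((hYq.mul_left hpq).mul_nonneg (hYp.mul_nonneg hY.nonneg hp.nonneg) hq.nonneg)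
  have hSle : S * star S ≤ Y * p * q * (Y * p * q) := by
    have h := star_right_conjugate_le_conjugate hZq (p * Y)
    rw [star_mul, hYsa, hpsa] at h
    have h₁ : p * Y * (Z * Z) * (Y * p) = S * star S := by
      rw [hSstar, hS]; simp only [mul_assoc]
    have h₂ : p * Y * (q * q) * (Y * p) = Y * p * q * (Y * p * q) := by
      rw [← hYp.eq]
      have : Commute (Y * p) q := hYq.mul_left hpq
      calc Y * p * (q * q) * (Y * p) = Y * p * q * (q * (Y * p)) := by simp only [mul_assoc]
        _ = _ := by rw [← this.eq]
    rwa [h₁, h₂] at h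
  have hle : V * a * star V ≤ M := by
    rw [← hsqrt]
    refine (CFC.monotone_sqrt hSle).trans ?_
    rwa [CFC.sqrt_mul_self _ hYpq0]
  refine ⟨V, by rw [mul_assoc, hVV, mul_one], ?_⟩
  have hXYZ : opAbs (X * Y * Z) ≤ a := by
    refine CFC.monotone_sqrt ?_
    have h := star_left_conjugate_le_conjugate hXp (Y * Z)
    have e : ∀ W : H →L[ℂ] H, IsSelfAdjoint W →
        star (W * Y * Z) * (W * Y * Z) = star (Y * Z) * (W * W) * (Y * Z) := fun W hW => by
      simp only [star_mul, hW.star_eq, mul_assoc]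
    rwa [← e X hX, ← e p hp.isSelfAdjoint] at h
  refine hXYZ.trans ?_
  calc a = star V * V * a * (star V * V) := by rw [hVV, one_mul, mul_one]
    _ = star V * (V * a * star V) * V := by simp only [mul_assoc]
    _ ≤ star V * M * V := star_left_conjugate_le_conjugate hle V

theorem IsOperatorConvexOn.midpointConcave_neg {h : ℝ → ℝ} (hh : IsOperatorConvexOn H h) :
    MidpointConcave H fun t => -h t := by
  intro X B h₁ h₂
  have := hh (X + B) (X - B) h₁.nonneg h₁.isUnit h₂.nonneg h₂.isUnit (1 / 2) (by norm_num)
  have e : (1 / 2 : ℝ) • (X + B) + (1 - 1 / 2 : ℝ) • (X - B) = X := by module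
  rw [e] at this
  rw [cfc_neg, cfc_neg, cfc_neg]
  have h2 := smul_le_smul_of_nonneg_left this (zero_le_two (α := ℝ))
  have e' : (2 : ℝ) • ((1 / 2 : ℝ) • cfc h (X + B) + (1 - 1 / 2 : ℝ) • cfc h (X - B)) =
      cfc h (X + B) + cfc h (X - B) := by module
  rw [e'] at h2
  rw [smul_neg, ← neg_add]
  exact neg_le_neg h2

theorem IsOperatorConcaveOn.midpointConcave {F : ℝ → ℝ} (hF : IsOperatorConcaveOn H F) :
    MidpointConcave H F := by
  simpa only [neg_neg] using IsOperatorConvexOn.midpointConcave_neg hF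

end Auxiliary

/-- **Theorem 2.5 (2.9).** If `f, g : (0,∞) → (0,∞)` are continuous, `f²` and `g²` are operator
concave, and `t ↦ t f(t) g(t)` is operator convex, then for every positive invertible `A` there
is a partial isometry `U` with `|Φ(f(A)) Φ(A) Φ(g(A))| ≤ U* Φ(f(A) A g(A)) U`. -/
theorem asymmetric_choi_davis
    (Φ : (H →L[ℂ] H) →ₗ[ℂ] (H →L[ℂ] H)) (hΦ : IsUnitalPositiveMap Φ)
    (f g : ℝ → ℝ)
    (hfc : ContinuousOn f (Set.Ioi 0)) (hgc : ContinuousOn g (Set.Ioi 0))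
    (hfpos : ∀ t ∈ Set.Ioi (0 : ℝ), 0 < f t) (hgpos : ∀ t ∈ Set.Ioi (0 : ℝ), 0 < g t)
    (hf2 : IsOperatorConcaveOn H (fun t => f t ^ 2))
    (hg2 : IsOperatorConcaveOn H (fun t => g t ^ 2))
    (hfg : IsOperatorConvexOn H (fun t => t * f t * g t))
    (A : H →L[ℂ] H) (hA : 0 ≤ A) (hAu : IsUnit A) :
    ∃ U : H →L[ℂ] H, U * star U * U = U ∧
      opAbs (Φ (cfc f A) * Φ A * Φ (cfc g A)) ≤ star U * Φ (cfc f A * A * cfc g A) * U := by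
  rcases subsingleton_or_nontrivial H with hH | hH
  · exact ⟨1, Subsingleton.elim _ _, (Subsingleton.elim _ _).le⟩
  have hAp : IsStrictlyPositive A := ⟨hA, hAu⟩
  have hY := hΦ.map_isStrictlyPositive hAp
  have hTpos : ∀ T : Finset ℝ, (T : Set ℝ) ⊆ spectrum ℝ A → ∀ t ∈ T, 0 < t := fun T hT t ht =>
    hAp.spectrum_pos (hT ht)
  have hkc : ContinuousOn (fun t => t * (f t * g t)) (Set.Ioi 0) :=
    continuousOn_id.mul (hfc.mul hgc)
  have hmul : (fun t => t * f t * g t) = fun t => t * (f t * g t) := funext fun t => mul_assoc _ _ _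
  rw [hmul] at hfg
  have hsq : ∀ F : ℝ → ℝ, ContinuousOn F (Set.Ioi 0) → (∀ t, 0 < t → 0 < F t) →
      MidpointConcave H F → Φ (cfc F A) ≤ cfc F (Φ A) := fun F hF hFpos hconc =>
    hΦ.map_cfc_le_cfc_map hAp hF fun T C hT hC hsum => by
      by_cases hfin : FiniteDimensional ℂ H
      · have hn : Module.finrank ℂ H = (Module.finrank ℂ H - 1) + 1 :=
          (Nat.sub_add_cancel Module.finrank_pos).symm
        exact MidpointConcave.sum_smul_le_cfc hn hF hFpos hconc (hTpos T hT)
          ((card_le_finrank_of_subset_spectrum hT).trans hn.le) hC hsum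
      · exact MidpointConcave.sum_smul_le_cfc_of_infinite hfin hF hconc (hTpos T hT) hC hsum
  have hprod : cfc (fun t => t * (f t * g t)) (Φ A) ≤ Φ (cfc (fun t => t * (f t * g t)) A) := by
    have h : Φ (cfc (fun t => -(t * (f t * g t))) A) ≤ cfc (fun t => -(t * (f t * g t))) (Φ A) :=
      hΦ.map_cfc_le_cfc_map hAp hkc.neg fun T C hT hC hsum => by
        by_cases hfin : FiniteDimensional ℂ H
        · have hn : Module.finrank ℂ H = (Module.finrank ℂ H - 1) + 1 :=
            (Nat.sub_add_cancel Module.finrank_pos).symm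
          have := MidpointConcave.cfc_mul_le_sum_smul (F := fun t => f t * g t) hn (hfc.mul hgc)
            (fun t ht => mul_pos (hfpos t ht) (hgpos t ht))
            (MidpointConcave.mul_of_sq hfc hgc hfpos hgpos hf2.midpointConcave hg2.midpointConcave)
            (hTpos T hT) ((card_le_finrank_of_subset_spectrum hT).trans hn.le) hC hsum
          simpa only [neg_smul, Finset.sum_neg_distrib, cfc_neg, neg_le_neg_iff] using this
        · exact MidpointConcave.sum_smul_le_cfc_of_infinite hfin hkc.neg hfg.midpointConcave_neg
            (hTpos T hT) hC hsum
    simpa only [cfc_neg, map_neg, neg_le_neg_iff] using h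
  have hcfcpos : ∀ (F : ℝ → ℝ) (B : H →L[ℂ] H), ContinuousOn F (Set.Ioi 0) →
      (∀ t ∈ Set.Ioi (0 : ℝ), 0 < F t) → IsStrictlyPositive B → IsStrictlyPositive (cfc F B) :=
    fun F B hF hFpos hB => by
      rw [cfc_isStrictlyPositive_iff F B (hB.continuousOn_spectrum hF) hB.isSelfAdjoint]
      exact fun t ht => hFpos t (hB.spectrum_pos ht)
  have hfactor : ∀ B : H →L[ℂ] H, IsStrictlyPositive B →
      cfc (fun t => t * (f t * g t)) B = B * cfc f B * cfc g B := fun B hB => by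
    have hf := hB.continuousOn_spectrum hfc
    have hg := hB.continuousOn_spectrum hgc
    rw [cfc_mul (fun t => t) (fun t => f t * g t) B (continuousOn_id' _) (hf.mul hg),
      cfc_mul f g B hf hg, cfc_id' ℝ B hB.isSelfAdjoint, mul_assoc]
  have hsquare : ∀ F : ℝ → ℝ, ContinuousOn F (Set.Ioi 0) →
      (∀ t ∈ Set.Ioi (0 : ℝ), 0 < F t) → IsOperatorConcaveOn H (fun t => F t ^ 2) →
      Φ (cfc F A) * Φ (cfc F A) ≤ cfc F (Φ A) * cfc F (Φ A) := fun F hF hFpos hF2 => by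
    refine (hΦ.map_cfc_mul_self_le hAp.isSelfAdjoint (hAp.continuousOn_spectrum hF)).trans ?_
    refine (hsq _ (hF.pow 2) (fun t ht => pow_pos (hFpos t ht) 2) hF2.midpointConcave).trans ?_
    have hFY := hY.continuousOn_spectrum hF
    rw [← cfc_mul F F (Φ A) hFY hFY]
    simp only [pow_two]
    exact le_rfl
  have hcomm : ∀ (F : ℝ → ℝ) (B : H →L[ℂ] H), IsStrictlyPositive B → Commute B (cfc F B) :=
    fun F B hB => by
      simpa only [cfc_id' ℝ B hB.isSelfAdjoint] using cfc_commute_cfc (fun t => t) F B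
  have hM : cfc f A * A * cfc g A = cfc (fun t => t * (f t * g t)) A := by
    rw [hfactor A hAp, (hcomm f A hAp).eq]
  rw [hM]
  exact exists_partialIsometry_opAbs_le (hΦ.isSelfAdjoint_map_cfc f A) hY
    (hΦ.map_isStrictlyPositive (hcfcpos g A hgc hgpos hAp)) (hcfcpos f _ hfc hfpos hY)
    (hcfcpos g _ hgc hgpos hY) (hcomm f _ hY) (hcomm g _ hY) (cfc_commute_cfc f g _)
    (hsquare f hfc hfpos hf2) (hsquare g hgc hgpos hg2) (hfactor _ hY ▸ hprod)
end

section
/- Let Φ be a unital positive linear map on B(H), let X ∈ B(H) be a positive invertible operator, and let γ ∈ [1/2, 1). Then Φ(X)^{1+γ} ≥ |Φ(X^γ) Φ(X)| + ( ‖Φ(X)^{1+γ}‖ − ‖ Φ(X)^{2+γ} − ω(X, γ) · ‖Φ(X)^{−γ}‖^{−2/γ} ‖^{(1+γ)/(2+γ)} ) · I. -/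
open scoped NNReal

variable {H : Type*} [NormedAddCommGroup H] [InnerProductSpace ℂ H] [CompleteSpace H]

/-- The constant `ω(A,r)` (relative to the unital positive linear map `Φ`):
`ω(A,r) = ‖Φ(A)‖^r − (‖Φ(A)‖ − inf_{n ≥ 1} ‖(Φ(A) + n⁻¹ I − Φ(A^r)^(1/r))⁻¹‖⁻¹)^r`. -/
noncomputable def omegaConst (Φ : (H →L[ℂ] H) →ₗ[ℂ] (H →L[ℂ] H)) (A : H →L[ℂ] H) (r : ℝ) : ℝ :=
  ‖Φ A‖ ^ r -
    (‖Φ A‖ - ⨅ n : ℕ+, ‖Ring.inverse (Φ A + ((n : ℕ) : ℝ)⁻¹ • (1 : H →L[ℂ] H) -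
        CFC.rpow (Φ (CFC.rpow A r)) (1 / r))‖⁻¹) ^ r

section PositiveMap

variable {𝓐 𝓑 : Type*} [CStarAlgebra 𝓐] [PartialOrder 𝓐] [StarOrderedRing 𝓐]
  [CStarAlgebra 𝓑] [PartialOrder 𝓑] [StarOrderedRing 𝓑]

theorem aeval_bernsteinPolynomial_nonneg {a : 𝓐} (ha : 0 ≤ a) (ha1 : a ≤ 1) (n k : ℕ) :
    0 ≤ Polynomial.aeval a (bernsteinPolynomial ℝ n k) := by
  rw [← cfc_polynomial (R := ℝ) (p := IsSelfAdjoint) _ a ha.isSelfAdjoint]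
  refine cfc_nonneg fun x hx => ?_
  have hx0 : 0 ≤ x := spectrum_nonneg_of_nonneg ha hx
  have hx1 : x ≤ 1 := by
    have h : a ≤ algebraMap ℝ 𝓐 1 := by simpa using ha1
    exact (le_algebraMap_iff_spectrum_le (R := ℝ) (ha := ha.isSelfAdjoint)).1 h x hx
  simp only [bernsteinPolynomial, Polynomial.eval_mul, Polynomial.eval_pow, Polynomial.eval_X,
    Polynomial.eval_sub, Polynomial.eval_one, Polynomial.eval_natCast]
  have : 0 ≤ 1 - x := by linarith
  positivity

theorem PositiveLinearMap.quadratic_add_smul_nonneg (Φ : 𝓐 →ₚ[ℂ] 𝓑) {a : 𝓐} (ha : 0 ≤ a)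
    (ha1 : a ≤ 1) (c : 𝓑) (n : ℕ) :
    0 ≤ Φ (a ^ 2) - star c * Φ a - Φ a * c + star c * Φ 1 * c
      + ((n : ℝ) + 1)⁻¹ • (Φ a - Φ (a ^ 2)) := by
  set N : ℕ := n + 1 with hN
  let E : ℕ → 𝓑 := fun k => Φ (Polynomial.aeval a (bernsteinPolynomial ℝ N k))
  have h0 : ∑ k ∈ Finset.range (N + 1), E k = Φ 1 := by
    rw [← map_sum, ← map_sum, bernsteinPolynomial.sum, map_one]
  have h1 : ∑ k ∈ Finset.range (N + 1), (k : ℝ) • E k = (N : ℝ) • Φ a := by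
    have := congrArg (fun p => Φ (Polynomial.aeval a p)) (bernsteinPolynomial.sum_smul ℝ N)
    simpa only [map_sum, map_nsmul, Polynomial.aeval_X, Nat.cast_smul_eq_nsmul] using this
  have h2' : ∑ k ∈ Finset.range (N + 1), ((k * (k - 1) : ℕ) : ℝ) • E k
      = ((N * (N - 1) : ℕ) : ℝ) • Φ (a ^ 2) := by
    have := congrArg (fun p => Φ (Polynomial.aeval a p)) (bernsteinPolynomial.sum_mul_smul ℝ N)
    simpa only [map_sum, map_nsmul, map_pow, Polynomial.aeval_X, Nat.cast_smul_eq_nsmul] using this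
  have hk : ∀ k : ℕ, ((k * (k - 1) : ℕ) : ℝ) = (k : ℝ) ^ 2 - k := by
    intro k
    cases k with
    | zero => simp
    | succ k => push_cast [Nat.add_sub_cancel]; ring
  have h2 : ∑ k ∈ Finset.range (N + 1), ((k : ℝ) ^ 2) • E k
      = ((N : ℝ) ^ 2 - N) • Φ (a ^ 2) + (N : ℝ) • Φ a := by
    rw [← hk, ← h2', ← h1, ← Finset.sum_add_distrib]
    refine Finset.sum_congr rfl fun k _ => ?_
    rw [hk]; module
  have hpos : 0 ≤ ∑ k ∈ Finset.range (N + 1),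
      star ((k : ℝ) • (1 : 𝓑) - (N : ℝ) • c) * E k * ((k : ℝ) • (1 : 𝓑) - (N : ℝ) • c) := by
    refine Finset.sum_nonneg fun k _ => star_left_conjugate_nonneg ?_ _
    exact map_nonneg Φ (aeval_bernsteinPolynomial_nonneg ha ha1 N k)
  have hsum : ∑ k ∈ Finset.range (N + 1),
      star ((k : ℝ) • (1 : 𝓑) - (N : ℝ) • c) * E k * ((k : ℝ) • (1 : 𝓑) - (N : ℝ) • c)
      = ∑ k ∈ Finset.range (N + 1), ((k : ℝ) ^ 2) • E k
        - (N : ℝ) • (star c * ∑ k ∈ Finset.range (N + 1), (k : ℝ) • E k)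
        - (N : ℝ) • ((∑ k ∈ Finset.range (N + 1), (k : ℝ) • E k) * c)
        + (N : ℝ) ^ 2 • (star c * (∑ k ∈ Finset.range (N + 1), E k) * c) := by
    simp only [Finset.mul_sum, Finset.sum_mul, Finset.smul_sum, ← Finset.sum_sub_distrib,
      ← Finset.sum_add_distrib]
    refine Finset.sum_congr rfl fun k _ => ?_
    simp only [star_sub, star_smul, star_one, star_trivial, sub_mul, mul_sub, smul_mul_assoc,
      mul_smul_comm, one_mul, mul_one]
    module
  rw [hsum, h0, h1, h2] at hpos
  have hNr : (N : ℝ) = (n : ℝ) + 1 := by simp [hN]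
  have hN0 : (N : ℝ) ≠ 0 := by rw [hNr]; positivity
  have key := smul_nonneg (show (0 : ℝ) ≤ ((N : ℝ) ^ 2)⁻¹ by positivity) hpos
  convert key using 1
  rw [← hNr]
  simp only [smul_mul_assoc, mul_smul_comm]
  match_scalars <;> field_simp
  ring

theorem PositiveLinearMap.quadratic_nonneg_of_le_one (Φ : 𝓐 →ₚ[ℂ] 𝓑) {a : 𝓐} (ha : 0 ≤ a)
    (ha1 : a ≤ 1) (c : 𝓑) :
    0 ≤ Φ (a ^ 2) - star c * Φ a - Φ a * c + star c * Φ 1 * c := by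
  have hlim : Filter.Tendsto (fun n : ℕ => Φ (a ^ 2) - star c * Φ a - Φ a * c + star c * Φ 1 * c
      + ((n : ℝ) + 1)⁻¹ • (Φ a - Φ (a ^ 2))) Filter.atTop
      (nhds (Φ (a ^ 2) - star c * Φ a - Φ a * c + star c * Φ 1 * c
      + (0 : ℝ) • (Φ a - Φ (a ^ 2)))) := by
    refine tendsto_const_nhds.add (Filter.Tendsto.smul_const ?_ _)
    simpa [one_div] using tendsto_one_div_add_atTop_nhds_zero_nat (𝕜 := ℝ)
  rw [zero_smul, add_zero] at hlim
  exact ge_of_tendsto' hlim fun n => Φ.quadratic_add_smul_nonneg ha ha1 c n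

/-- The quadratic form attached to a positive map and a positive element is nonnegative. -/
theorem PositiveLinearMap.quadratic_nonneg (Φ : 𝓐 →ₚ[ℂ] 𝓑) {a : 𝓐} (ha : 0 ≤ a) (c : 𝓑) :
    0 ≤ Φ (a ^ 2) - star c * Φ a - Φ a * c + star c * Φ 1 * c := by
  set r : ℝ := ‖a‖ + 1
  have hr : 0 < r := by positivity
  have hle : r⁻¹ • a ≤ 1 := by
    rw [← CStarAlgebra.norm_le_one_iff_of_nonneg _ (smul_nonneg (by positivity) ha), norm_smul,
      norm_inv, Real.norm_of_nonneg hr.le, inv_mul_le_one₀ hr]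
    simp [r]
  have h := Φ.quadratic_nonneg_of_le_one (smul_nonneg (inv_nonneg.2 hr.le) ha) hle (r⁻¹ • c)
  have key := smul_nonneg (show (0 : ℝ) ≤ r ^ 2 by positivity) h
  have hsm : ∀ (s : ℝ) (x : 𝓐), Φ (s • x) = s • Φ x := fun s x => by
    rw [← Complex.coe_smul, ← Complex.coe_smul, map_smul]
  convert key using 1
  simp only [smul_pow, hsm, star_smul, star_trivial, smul_mul_assoc, mul_smul_comm]
  match_scalars <;> field_simp

theorem PositiveLinearMap.kadison (Φ : 𝓐 →ₚ[ℂ] 𝓑) (hΦ : Φ 1 = 1) {a : 𝓐} (ha : 0 ≤ a) :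
    Φ a ^ 2 ≤ Φ (a ^ 2) := by
  have h := Φ.quadratic_nonneg ha (Φ a)
  rw [(map_nonneg Φ ha).isSelfAdjoint.star_eq, hΦ, mul_one] at h
  rw [← sub_nonneg]
  convert h using 1
  noncomm_ring

theorem PositiveLinearMap.isStrictlyPositive_map (Φ : 𝓐 →ₚ[ℂ] 𝓑) (hΦ : Φ 1 = 1) {a : 𝓐}
    (ha : IsStrictlyPositive a) : IsStrictlyPositive (Φ a) := by
  nontriviality 𝓑
  have h1 : Nontrivial 𝓐 := by
    by_contra h
    rw [not_nontrivial_iff_subsingleton] at h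
    exact one_ne_zero (α := 𝓑) (by rw [← hΦ, Subsingleton.elim (1 : 𝓐) 0, map_zero])
  obtain ⟨r, hr, hra⟩ := (CFC.exists_pos_algebraMap_le_iff (a := a)
    ha.isSelfAdjoint).2 fun x hx => ha.spectrum_pos hx
  have hmono : algebraMap ℝ 𝓑 r ≤ Φ a := by
    have := OrderHomClass.mono Φ hra
    rwa [Algebra.algebraMap_eq_smul_one, ← Complex.coe_smul, map_smul, hΦ, Complex.coe_smul,
      ← Algebra.algebraMap_eq_smul_one] at this
  refine IsStrictlyPositive.of_le ?_ hmono
  rw [IsStrictlyPositive.iff_of_unital]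
  exact ⟨algebraMap_nonneg _ hr.le, (IsUnit.mk0 r hr.ne').map (algebraMap ℝ 𝓑)⟩

/-- Choi's inequality. -/
theorem PositiveLinearMap.inverse_map_le (Φ : 𝓐 →ₚ[ℂ] 𝓑) (hΦ : Φ 1 = 1) {a : 𝓐}
    (ha : IsStrictlyPositive a) : Ring.inverse (Φ a) ≤ Φ (Ring.inverse a) := by
  let s := CFC.sqrt a
  have hs : 0 ≤ s := CFC.sqrt_nonneg a
  have hss : s * s = a := CFC.sqrt_mul_sqrt_self a ha.nonneg
  let b := Ring.inverse a
  have hab : a * b = 1 := Ring.mul_inverse_cancel _ ha.isUnit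
  have hba : b * a = 1 := Ring.inverse_mul_cancel _ ha.isUnit
  have hb : 0 ≤ b := ha.ringInverse.nonneg
  have hcomm : s * b = b * s := by
    calc s * b = (b * a) * (s * b) := by rw [hba, one_mul]
      _ = b * s * (a * b) := by rw [← hss]; noncomm_ring
      _ = b * s := by rw [hab, mul_one]
  let Ψ : 𝓐 →ₚ[ℂ] 𝓑 := PositiveLinearMap.mk₀
    (Φ.toLinearMap ∘ₗ LinearMap.mulLeftRight ℂ (s, s)) (fun x hx => by
      have : 0 ≤ Φ (s * x * s) := map_nonneg Φ (hs.isSelfAdjoint.conjugate_nonneg hx)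
      simpa using this)
  have hΨ : ∀ x, Ψ x = Φ (s * x * s) := fun x => by
    change (Φ.toLinearMap ∘ₗ LinearMap.mulLeftRight ℂ (s, s)) x = _
    simp
  have hu := (Φ.isStrictlyPositive_map hΦ ha)
  have h := Ψ.quadratic_nonneg hb (Ring.inverse (Φ a))
  have e1 : s * b * s = 1 := by rw [hcomm, mul_assoc, hss, hba]
  have e2 : s * b ^ 2 * s = b := by
    rw [pow_two, ← mul_assoc, hcomm, mul_assoc, mul_assoc, ← mul_assoc s, e1, mul_one]
  rw [hΨ, hΨ, hΨ, e1, e2, mul_one, hss, hΦ, mul_one, one_mul,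
    hu.ringInverse.isSelfAdjoint.star_eq, Ring.inverse_mul_cancel _ hu.isUnit, one_mul] at h
  rw [← sub_nonneg]
  convert h using 1
  noncomm_ring

open CFC Real in
theorem cfcₙ_rpowIntegrand₁₂_eq {p t : ℝ} (ht : 0 < t) {a : 𝓐} (ha : 0 ≤ a) :
    cfcₙ (rpowIntegrand₁₂ p t) a =
      t ^ (p - 1) • (t⁻¹ • a + t • Ring.inverse (algebraMap ℝ 𝓐 t + a) - 1) := by
  have hg : ContinuousOn (fun z : ℝ => (t + z)⁻¹) (spectrum ℝ a) := by
    fun_prop (disch := grind -abstractProof)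
  have hspectrum : ∀ r ∈ spectrum ℝ a, t + r ≠ 0 := by grind
  have hc : ContinuousOn (rpowIntegrand₁₂ p t) (spectrum ℝ a) := by
    unfold rpowIntegrand₁₂
    fun_prop
  have hq : ContinuousOn (rpowIntegrand₁₂ p t) (quasispectrum ℝ a) := by
    unfold rpowIntegrand₁₂
    fun_prop (disch := grind -abstractProof)
  rw [cfcₙ_eq_cfc hq (rpowIntegrand₁₂_zero ht)]
  have h1 : cfc (fun x : ℝ => t⁻¹ * x) a = t⁻¹ • a := by
    rw [cfc_const_mul t⁻¹ (fun x : ℝ => x) a (by fun_prop), cfc_id' ℝ a]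
  have h2 : cfc (fun x : ℝ => t * (t + x)⁻¹) a = t • Ring.inverse (algebraMap ℝ 𝓐 t + a) := by
    rw [cfc_const_mul t (fun x : ℝ => (t + x)⁻¹) a hg,
      cfc_inv (fun x : ℝ => t + x) a hspectrum (by fun_prop),
      cfc_const_add t (fun x : ℝ => x) a (by fun_prop), cfc_id' ℝ a]
  have h12 := cfc_add (a := a) (fun x : ℝ => t⁻¹ * x) (fun x : ℝ => t * (t + x)⁻¹)
    (by fun_prop) (by fun_prop)
  have h3 := cfc_sub (a := a) (fun x : ℝ => t⁻¹ * x + t * (t + x)⁻¹) (fun _ : ℝ => (1 : ℝ))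
    (by fun_prop) (by fun_prop)
  rw [h12, h1, h2, cfc_const_one ℝ a] at h3
  rw [← h3]
  exact cfc_const_mul (t ^ (p - 1)) _ a (by fun_prop)

open CFC Real in
theorem PositiveLinearMap.cfcₙ_rpowIntegrand₁₂_map_le (Φ : 𝓐 →ₚ[ℂ] 𝓑) (hΦ : Φ 1 = 1) {p t : ℝ}
    (ht : 0 < t) {a : 𝓐} (ha : 0 ≤ a) :
    cfcₙ (rpowIntegrand₁₂ p t) (Φ a) ≤ Φ (cfcₙ (rpowIntegrand₁₂ p t) a) := by
  have hsm : ∀ (s : ℝ) (x : 𝓐), Φ (s • x) = s • Φ x := fun s x => by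
    rw [← Complex.coe_smul, ← Complex.coe_smul, map_smul]
  have hsp : IsStrictlyPositive (algebraMap ℝ 𝓐 t + a) := by grind
  have h := Φ.inverse_map_le hΦ hsp
  rw [map_add, Algebra.algebraMap_eq_smul_one, hsm, hΦ] at h
  rw [cfcₙ_rpowIntegrand₁₂_eq ht ha, cfcₙ_rpowIntegrand₁₂_eq ht (map_nonneg Φ ha), hsm, map_sub,
    map_add, hsm, hsm, hΦ, Algebra.algebraMap_eq_smul_one, Algebra.algebraMap_eq_smul_one]
  have := Real.rpow_nonneg ht.le (p - 1)
  gcongr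

open CFC Real MeasureTheory in
theorem PositiveLinearMap.nnrpow_map_le (Φ : 𝓐 →ₚ[ℂ] 𝓐) (hΦ : Φ 1 = 1) {p : ℝ≥0}
    (hp : p ∈ Set.Ioo 1 2) {a : 𝓐} (ha : 0 ≤ a) : Φ a ^ p ≤ Φ (a ^ p) := by
  obtain ⟨μ, hμ⟩ := CFC.exists_measure_nnrpow_eq_integral_cfcₙ_rpowIntegrand₁₂ 𝓐 hp
  let L : 𝓐 →L[ℂ] 𝓐 := ⟨Φ.toLinearMap, map_continuous Φ⟩
  have hL : ∀ x, L x = Φ x := fun _ => rfl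
  rw [(hμ _ (map_nonneg Φ ha)).2, (hμ a ha).2, ← hL (∫ _ in _, _ ∂_),
    ← L.integral_comp_comm (hμ a ha).1]
  refine integral_mono_ae (hμ _ (map_nonneg Φ ha)).1 (L.integrable_comp (hμ a ha).1) ?_
  filter_upwards [ae_restrict_mem measurableSet_Ioi] with t ht
  exact Φ.cfcₙ_rpowIntegrand₁₂_map_le hΦ ht ha

/-- Jensen's operator inequality for powers with exponents in `(1, 2]`. -/
theorem PositiveLinearMap.rpow_map_le (Φ : 𝓐 →ₚ[ℂ] 𝓐) (hΦ : Φ 1 = 1) {p : ℝ}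
    (hp1 : 1 < p) (hp2 : p ≤ 2) {a : 𝓐} (ha : 0 ≤ a) : Φ a ^ p ≤ Φ (a ^ p) := by
  rcases hp2.eq_or_lt with rfl | hp2
  · have h1 : a ^ (2 : ℝ) = a ^ 2 := by exact_mod_cast CFC.rpow_natCast a 2 ha
    have h2 : Φ a ^ (2 : ℝ) = Φ a ^ 2 := by
      exact_mod_cast CFC.rpow_natCast (Φ a) 2 (map_nonneg Φ ha)
    rw [h1, h2]
    exact Φ.kadison hΦ ha
  · lift p to ℝ≥0 using by linarith
    have hp0 : 0 < p := by exact_mod_cast one_pos.trans hp1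
    rw [← CFC.nnrpow_eq_rpow hp0, ← CFC.nnrpow_eq_rpow hp0]
    exact Φ.nnrpow_map_le hΦ ⟨by exact_mod_cast hp1, by exact_mod_cast hp2⟩ ha

end PositiveMap

section Furuta

variable {𝓐 : Type*} [CStarAlgebra 𝓐] [PartialOrder 𝓐] [StarOrderedRing 𝓐]

theorem isStrictlyPositive_star_mul_self {y : 𝓐} (hy : IsUnit y) :
    IsStrictlyPositive (star y * y) := by
  rw [IsStrictlyPositive.iff_of_unital]
  exact ⟨star_mul_self_nonneg y, hy.star.mul hy⟩

theorem isStrictlyPositive_mul_star_self {y : 𝓐} (hy : IsUnit y) :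
    IsStrictlyPositive (y * star y) := by
  simpa using isStrictlyPositive_star_mul_self hy.star

theorem rpow_unitary_conj (u : unitary 𝓐) {a : 𝓐} (ha : IsStrictlyPositive a) (s : ℝ) :
    ((u : 𝓐) * a * star (u : 𝓐)) ^ s = u * a ^ s * star (u : 𝓐) := by
  have hpos : 0 ≤ (u : 𝓐) * a * star (u : 𝓐) := star_right_conjugate_nonneg ha.nonneg _
  have h := StarAlgHomClass.map_cfc (S := ℂ) (Unitary.conjStarAlgAut ℂ 𝓐 u) (fun x : ℝ => x ^ s) a
    (by
      refine ContinuousOn.rpow_const continuousOn_id fun x hx => Or.inl ?_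
      exact (ha.spectrum_pos hx).ne')
    (by
      change Continuous fun x : 𝓐 => (u : 𝓐) * x * star (u : 𝓐)
      fun_prop)
    ha.isSelfAdjoint hpos.isSelfAdjoint
  rw [← CFC.rpow_eq_cfc_real ha.nonneg, Unitary.conjStarAlgAut_apply, Unitary.conjStarAlgAut_apply,
    ← CFC.rpow_eq_cfc_real hpos] at h
  exact h.symm

theorem star_mul_self_rpow {y : 𝓐} (hy : IsUnit y) (s : ℝ) :
    (star y * y) ^ s = star y * (y * star y) ^ (s - 1) * y := by
  set P := star y * y with hP
  have hPs : IsStrictlyPositive P := isStrictlyPositive_star_mul_self hy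
  have hPu := hPs.isUnit
  set h := P ^ (1 / 2 : ℝ)
  set k := P ^ (-(1 / 2) : ℝ)
  have hhk : h * k = 1 := CFC.rpow_mul_rpow_neg _ hPs
  have hkh : k * h = 1 := CFC.rpow_neg_mul_rpow _ hPs
  have hhh : h * h = P := by
    rw [← CFC.rpow_add hPu, add_halves, CFC.rpow_one P hPs.nonneg]
  have hhs : star h = h := (CFC.rpow_nonneg (a := P)).isSelfAdjoint.star_eq
  have hks : star k = k := (CFC.rpow_nonneg (a := P)).isSelfAdjoint.star_eq
  have hku : IsUnit k := hPu.cfcRpow _ hPs.nonneg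
  have hleft : star (y * k) * (y * k) = 1 := by
    calc star (y * k) * (y * k) = k * (star y * y) * k := by rw [star_mul, hks]; noncomm_ring
      _ = (k * h) * (h * k) := by rw [← hP, ← hhh]; noncomm_ring
      _ = 1 := by rw [hhk, hkh, one_mul]
  have hright : (y * k) * star (y * k) = 1 := by
    obtain ⟨w, hw⟩ := hy.mul hku
    rw [← hw] at hleft ⊢
    exact (Units.mul_eq_one_iff_inv_eq (u := w)).2 (Units.inv_eq_of_mul_eq_one_left hleft)
  obtain ⟨u, hu⟩ : ∃ u : unitary 𝓐, (u : 𝓐) = y * k := ⟨⟨y * k, hleft, hright⟩, rfl⟩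
  have huy : (u : 𝓐) * h = y := by rw [hu, mul_assoc, hkh, mul_one]
  have huy' : h * star (u : 𝓐) = star y := by
    have := congrArg star huy
    rwa [star_mul, hhs] at this
  have huu : star (u : 𝓐) * (u : 𝓐) = 1 := hu ▸ hleft
  have hQ : y * star y = u * P * star (u : 𝓐) := by
    calc y * star y = (u * h) * (h * star (u : 𝓐)) := by rw [huy, huy']
      _ = u * (h * h) * star (u : 𝓐) := by noncomm_ring
      _ = u * P * star (u : 𝓐) := by rw [hhh]
  rw [hQ, rpow_unitary_conj u hPs]
  calc P ^ s = P ^ (1 / 2 + (s - 1) + 1 / 2 : ℝ) := by congr 1; ring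
    _ = h * P ^ (s - 1) * h := by rw [CFC.rpow_add hPu, CFC.rpow_add hPu]
    _ = h * (star (u : 𝓐) * u) * P ^ (s - 1) * (star (u : 𝓐) * u) * h := by
      rw [huu, mul_one, mul_one]
    _ = (h * star (u : 𝓐)) * (u * P ^ (s - 1) * star (u : 𝓐)) * (u * h) := by noncomm_ring
    _ = _ := by rw [huy, huy']

theorem rpow_le_rpow_of_exponent_neg {a b : 𝓐} (ha : IsStrictlyPositive a) (hab : a ≤ b) {q : ℝ}
    (hq : q ∈ Set.Icc (-1) 0) : b ^ q ≤ a ^ q := by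
  have hb : IsStrictlyPositive b := ha.of_le hab
  rcases hq.2.eq_or_lt with rfl | hq0
  · rw [CFC.rpow_zero a ha.nonneg, CFC.rpow_zero b hb.nonneg]
  have h := CFC.rpow_le_rpow (p := -q) ⟨by linarith, by linarith [hq.1]⟩ hab
  have h2 := CStarAlgebra.rpow_neg_one_le_rpow_neg_one h (ha.rpow _ _)
  rwa [CFC.rpow_rpow _ _ _ (by linarith) ha, CFC.rpow_rpow _ _ _ (by linarith) hb,
    neg_mul_neg, mul_one] at h2

theorem le_rpow_sqrt_conj {a b : 𝓐} (hb : IsStrictlyPositive b) (hba : b ≤ a) {p : ℝ}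
    (hp : 1 ≤ p) :
    b ≤ (b ^ (1 / 2 : ℝ) * a ^ p * b ^ (1 / 2 : ℝ)) ^ (1 / (p + 1)) := by
  have ha : IsStrictlyPositive a := hb.of_le hba
  have hau := ha.isUnit
  set h := b ^ (1 / 2 : ℝ)
  set g := a ^ (p / 2)
  have hhh : h * h = b := by
    rw [← CFC.rpow_add hb.isUnit, add_halves, CFC.rpow_one b hb.nonneg]
  have hgg : g * g = a ^ p := by rw [← CFC.rpow_add hau, add_halves]
  have hhs : IsSelfAdjoint h := (CFC.rpow_nonneg (a := b)).isSelfAdjoint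
  have hgs : IsSelfAdjoint g := (CFC.rpow_nonneg (a := a)).isSelfAdjoint
  have hy : IsUnit (g * h) := (hau.cfcRpow _ ha.nonneg).mul (hb.isUnit.cfcRpow _ hb.nonneg)
  have hyy : star (g * h) * (g * h) = h * a ^ p * h := by
    rw [star_mul, hhs.star_eq, hgs.star_eq, ← hgg]; noncomm_ring
  have hyy' : (g * h) * star (g * h) = g * b * g := by
    rw [star_mul, hhs.star_eq, hgs.star_eq, ← hhh]; noncomm_ring
  have hps : IsStrictlyPositive (h * a ^ p * h) := hyy ▸ isStrictlyPositive_star_mul_self hy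
  have hps' : IsStrictlyPositive (g * b * g) := hyy' ▸ isStrictlyPositive_mul_star_self hy
  have hle : g * b * g ≤ a ^ (p + 1) := by
    calc g * b * g ≤ g * a * g := hgs.conjugate_le_conjugate hba
      _ = a ^ (p / 2) * a ^ (1 : ℝ) * a ^ (p / 2) := by rw [CFC.rpow_one a ha.nonneg]
      _ = a ^ (p + 1) := by
        rw [← CFC.rpow_add hau, ← CFC.rpow_add hau]; congr 1; ring
  have hp1 : (0 : ℝ) < p + 1 := by linarith
  have hinv : a ^ (1 - p) ≤ (g * b * g) ^ (2 / (p + 1) - 1) := by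
    have := rpow_le_rpow_of_exponent_neg hps' hle (q := 2 / (p + 1) - 1)
      ⟨by have : 0 < 2 / (p + 1) := by positivity
          linarith,
        by rw [sub_nonpos, div_le_one hp1]; linarith⟩
    rwa [CFC.rpow_rpow _ _ _ hp1.ne' ha,
      show (p + 1) * (2 / (p + 1) - 1) = 1 - p by field_simp; ring] at this
  have hsq : b ^ (2 : ℝ) ≤ (h * a ^ p * h) ^ (2 / (p + 1)) := by
    rw [← hyy, star_mul_self_rpow hy, hyy']
    calc b ^ (2 : ℝ) = h * b * h := by
          rw [← hhh, show h * (h * h) * h = (h * h) * (h * h) by noncomm_ring, hhh,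
            show (2 : ℝ) = 1 + 1 by norm_num, CFC.rpow_add hb.isUnit, CFC.rpow_one b hb.nonneg]
      _ ≤ h * a * h := hhs.conjugate_le_conjugate hba
      _ = star (g * h) * a ^ (1 - p) * (g * h) := by
        rw [star_mul, hhs.star_eq, hgs.star_eq]
        have : g * a ^ (1 - p) * g = a := by
          rw [← CFC.rpow_add hau, ← CFC.rpow_add hau]
          ring_nf
          exact CFC.rpow_one a ha.nonneg
        conv_lhs => rw [← this]
        noncomm_ring
      _ ≤ _ := star_left_conjugate_le_conjugate hinv _
  have := CFC.rpow_le_rpow (p := 1 / 2) (by norm_num) hsq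
  rwa [CFC.rpow_rpow _ _ _ (by norm_num) hb, CFC.rpow_rpow _ _ _ (by positivity) hps,
    mul_one_div_cancel (two_ne_zero), CFC.rpow_one b hb.nonneg,
    show 2 / (p + 1) * (1 / 2) = 1 / (p + 1) by ring] at this

/-- A case of Furuta's inequality. -/
theorem le_rpow_conj {a b : 𝓐} (hb : IsStrictlyPositive b) (hba : b ≤ a) {p : ℝ}
    (hp : 1 ≤ p) : b ≤ (b * a ^ p * b) ^ (1 / (p + 2)) := by
  have ha : IsStrictlyPositive a := hb.of_le hba
  have h1 := le_rpow_sqrt_conj hb hba hp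
  have h2 := le_rpow_sqrt_conj hb h1 (p := p + 1) (by linarith)
  set h := b ^ (1 / 2 : ℝ)
  have hhh : h * h = b := by
    rw [← CFC.rpow_add hb.isUnit, add_halves, CFC.rpow_one b hb.nonneg]
  have hp1 : p + 1 ≠ 0 := by linarith
  have hhs : IsSelfAdjoint h := (CFC.rpow_nonneg (a := b)).isSelfAdjoint
  have hnn : 0 ≤ h * a ^ p * h := hhs.conjugate_nonneg CFC.rpow_nonneg
  rw [CFC.rpow_rpow_of_exponent_nonneg _ _ _ (by positivity) (by linarith) hnn,
    one_div_mul_cancel hp1, CFC.rpow_one _ hnn,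
    show h * (h * a ^ p * h) * h = (h * h) * a ^ p * (h * h) by noncomm_ring, hhh,
    add_assoc, one_add_one_eq_two] at h2
  exact h2

theorem rpow_conj_sq_le {a b : 𝓐} (ha : IsStrictlyPositive a) (hb : IsStrictlyPositive b) {γ : ℝ}
    (hγ0 : 0 < γ) (hγ : γ ≤ 2) (hba : b ≤ a ^ γ) :
    (a * b * b * a) ^ ((2 + γ) / (2 + 2 * γ)) ≤ a * b * a := by
  have hy : IsUnit (b * a) := hb.isUnit.mul ha.isUnit
  have has := ha.isSelfAdjoint
  have hbs := hb.isSelfAdjoint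
  have hyy : star (b * a) * (b * a) = a * b * b * a := by
    rw [star_mul, has.star_eq, hbs.star_eq]; noncomm_ring
  have hyy' : (b * a) * star (b * a) = b * (a ^ γ) ^ (2 / γ) * b := by
    rw [star_mul, has.star_eq, hbs.star_eq, CFC.rpow_rpow _ _ _ hγ0.ne' ha,
      mul_div_cancel₀ _ hγ0.ne', show (2 : ℝ) = 1 + 1 by norm_num, CFC.rpow_add ha.isUnit,
      CFC.rpow_one a ha.nonneg]
    noncomm_ring
  have hps' := isStrictlyPositive_mul_star_self hy
  have h := le_rpow_conj hb hba (p := 2 / γ) (by rwa [le_div_iff₀ hγ0, one_mul])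
  rw [← hyy'] at h
  have h2 := CStarAlgebra.rpow_neg_one_le_rpow_neg_one h hb
  rw [CFC.rpow_rpow _ _ _ (by positivity) hps',
    show 1 / (2 / γ + 2) * (-1) = (2 + γ) / (2 + 2 * γ) - 1 by field_simp; ring] at h2
  have h3 := star_left_conjugate_le_conjugate h2 (b * a)
  rw [← star_mul_self_rpow hy, hyy, star_mul, has.star_eq, hbs.star_eq] at h3
  refine h3.trans_eq ?_
  have hbb : b * b ^ (-1 : ℝ) = 1 := by
    conv_lhs => rw [← CFC.rpow_one b hb.nonneg, CFC.rpow_rpow _ _ _ one_ne_zero hb]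
    simpa using CFC.rpow_mul_rpow_neg (a := b) 1 hb
  calc a * b * b ^ (-1 : ℝ) * (b * a) = a * (b * b ^ (-1 : ℝ)) * (b * a) := by noncomm_ring
    _ = a * b * a := by rw [hbb]; noncomm_ring

end Furuta

section SpectralGap

theorem Real.rpow_sub_rpow_sub_le {m t N s : ℝ} (hm : 0 ≤ m) (hmt : m ≤ t) (htN : t ≤ N)
    (hs0 : 0 ≤ s) (hs1 : s ≤ 1) : N ^ s - (N - m) ^ s ≤ t ^ s - (t - m) ^ s := by
  rcases hm.eq_or_lt with rfl | hm
  · simp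
  have hc := Real.concaveOn_rpow hs0 hs1
  set d := N - t + m with hd
  have hd0 : 0 < d := by linarith
  have hx : t - m ∈ Set.Ici (0 : ℝ) := by simp; linarith
  have hy : N ∈ Set.Ici (0 : ℝ) := by simp; linarith
  have hsum : m / d + (N - t) / d = 1 := by field_simp; linarith
  have hw : 0 ≤ (N - t) / d := div_nonneg (by linarith) hd0.le
  have h1 := hc.2 hx hy hw (div_nonneg hm.le hd0.le) (by linarith)
  have h2 := hc.2 hx hy (div_nonneg hm.le hd0.le) hw hsum
  simp only [smul_eq_mul] at h1 h2
  have e1 : (N - t) / d * (t - m) + m / d * N = t := by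
    rw [hd] at hd0 ⊢; field_simp; ring
  have e2 : m / d * (t - m) + (N - t) / d * N = N - m := by
    rw [hd] at hd0 ⊢; field_simp; ring
  rw [e1] at h1
  rw [e2] at h2
  have e3 : (N - t) / d = 1 - m / d := by linarith
  rw [e3] at h1 h2
  linarith

variable {𝓐 : Type*} [CStarAlgebra 𝓐] [PartialOrder 𝓐] [StarOrderedRing 𝓐]

theorem rpow_sub_smul_one_le {q : 𝓐} (hq : 0 ≤ q) {m s : ℝ} (hs0 : 0 ≤ s) (hs1 : s ≤ 1)
    (hm : 0 ≤ m) (hmq : m • (1 : 𝓐) ≤ q) :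
    (q - m • (1 : 𝓐)) ^ s ≤ q ^ s - (‖q‖ ^ s - (‖q‖ - m) ^ s) • (1 : 𝓐) := by
  have hsa := hq.isSelfAdjoint
  have hlow : ∀ x ∈ spectrum ℝ q, m ≤ x := by
    rw [← algebraMap_le_iff_le_spectrum (R := ℝ), Algebra.algebraMap_eq_smul_one]
    exact hmq
  have hupp : ∀ x ∈ spectrum ℝ q, x ≤ ‖q‖ := by
    rw [← le_algebraMap_iff_spectrum_le (R := ℝ)]
    exact hsa.le_algebraMap_norm_self
  have hcont : Continuous fun x : ℝ => x ^ s := Real.continuous_rpow_const hs0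
  have e1 : (q - m • (1 : 𝓐)) ^ s = cfc (fun x : ℝ => (x - m) ^ s) q := by
    rw [CFC.rpow_eq_cfc_real (sub_nonneg.2 hmq)]
    have : q - m • (1 : 𝓐) = cfc (fun x : ℝ => x - m) q := by
      rw [cfc_sub (fun x : ℝ => x) (fun _ => m) q, cfc_id' ℝ q, cfc_const m q,
        Algebra.algebraMap_eq_smul_one]
    rw [this, ← cfc_comp' (fun x : ℝ => x ^ s) (fun x : ℝ => x - m) q hcont.continuousOn]
  have e2 : q ^ s - (‖q‖ ^ s - (‖q‖ - m) ^ s) • (1 : 𝓐) =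
      cfc (fun x : ℝ => x ^ s - (‖q‖ ^ s - (‖q‖ - m) ^ s)) q := by
    rw [cfc_sub (fun x : ℝ => x ^ s) (fun _ => _) q hcont.continuousOn, ← CFC.rpow_eq_cfc_real hq,
      cfc_const _ q, Algebra.algebraMap_eq_smul_one]
  rw [e1, e2]
  refine cfc_mono (fun x hx => ?_) (hcont.comp (continuous_id.sub continuous_const)).continuousOn
    (hcont.sub continuous_const).continuousOn
  have := Real.rpow_sub_rpow_sub_le hm (hlow x hx) (hupp x hx) hs0 hs1
  linarith

theorem IsStrictlyPositive.norm_ringInverse_inv_smul_one_le [Nontrivial 𝓐] {d : 𝓐}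
    (hd : IsStrictlyPositive d) : ‖Ring.inverse d‖⁻¹ • (1 : 𝓐) ≤ d := by
  have hi : IsStrictlyPositive (Ring.inverse d) := hd.ringInverse
  have hn : 0 < ‖Ring.inverse d‖ := norm_pos_iff.2 hi.isUnit.ne_zero
  have h : Ring.inverse d ≤ ‖Ring.inverse d‖ • (1 : 𝓐) := by
    rw [← Algebra.algebraMap_eq_smul_one]
    exact hi.isSelfAdjoint.le_algebraMap_norm_self
  have h2 := CStarAlgebra.ringInverse_le_ringInverse h hi
  obtain ⟨u, rfl⟩ := hd.isUnit
  let v : 𝓐ˣ := (Units.mk0 _ hn.ne').map (algebraMap ℝ 𝓐).toMonoidHom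
  have hv : (‖Ring.inverse (u : 𝓐)‖ • (1 : 𝓐)) = v := (Algebra.algebraMap_eq_smul_one _).symm
  rw [hv, Ring.inverse_unit, Ring.inverse_unit, Ring.inverse_unit, inv_inv] at h2
  rw [← Algebra.algebraMap_eq_smul_one]
  exact h2

theorem iInf_norm_ringInverse_inv_smul_one_le [Nontrivial 𝓐] {c : 𝓐} (hc : 0 ≤ c) :
    (⨅ n : ℕ+, ‖Ring.inverse (c + ((n : ℕ) : ℝ)⁻¹ • (1 : 𝓐))‖⁻¹) • (1 : 𝓐) ≤ c := by
  set m := ⨅ n : ℕ+, ‖Ring.inverse (c + ((n : ℕ) : ℝ)⁻¹ • (1 : 𝓐))‖⁻¹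
  have hle : ∀ n : ℕ, m • (1 : 𝓐) ≤ c + (1 / ((n : ℝ) + 1)) • (1 : 𝓐) := by
    intro n
    have hpos : 0 < (1 / ((n : ℝ) + 1)) := by positivity
    have hsp : IsStrictlyPositive (c + (1 / ((n : ℝ) + 1)) • (1 : 𝓐)) :=
      .nonneg_add hc (isStrictlyPositive_one.smul hpos)
    refine le_trans ?_ hsp.norm_ringInverse_inv_smul_one_le
    refine smul_le_smul_of_nonneg_right ?_ zero_le_one
    have : BddBelow (Set.range fun n : ℕ+ =>
        ‖Ring.inverse (c + ((n : ℕ) : ℝ)⁻¹ • (1 : 𝓐))‖⁻¹) :=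
      ⟨0, by rintro _ ⟨n, rfl⟩; positivity⟩
    simpa using ciInf_le this n.succPNat
  have hlim : Filter.Tendsto (fun n : ℕ => c + (1 / ((n : ℝ) + 1)) • (1 : 𝓐)) Filter.atTop
      (nhds c) := by
    simpa using (tendsto_one_div_add_atTop_nhds_zero_nat (𝕜 := ℝ)).smul_const (1 : 𝓐)
      |>.const_add c
  exact ge_of_tendsto' hlim hle

theorem norm_rpow_neg_rpow_smul_one_le [Nontrivial 𝓐] {a : 𝓐} (ha : IsStrictlyPositive a) {γ : ℝ}
    (hγ : 0 < γ) : ‖a ^ (-γ)‖ ^ (-(2 / γ)) • (1 : 𝓐) ≤ a ^ (2 : ℝ) := by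
  have h2 : IsStrictlyPositive (a ^ (2 : ℝ)) := ha.rpow _ _
  have e : a ^ (-γ) = Ring.inverse (a ^ (2 : ℝ)) ^ (γ / 2) := by
    rw [CFC.inverse_rpow a 2 two_ne_zero ha, CFC.rpow_rpow _ _ _ (by norm_num) ha]
    congr 1
    ring
  rw [e, CFC.norm_rpow _ (by positivity) h2.ringInverse.nonneg, ← Real.rpow_mul (norm_nonneg _),
    show γ / 2 * -(2 / γ) = -1 by field_simp, Real.rpow_neg_one]
  exact h2.norm_ringInverse_inv_smul_one_le

theorem sqrt_conj_sq_add_smul_one_le [Nontrivial 𝓐] {a b : 𝓐} (ha : IsStrictlyPositive a)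
    (hb : IsStrictlyPositive b) {γ w : ℝ} (hγ0 : 0 < γ) (hγ : γ ≤ 2) (hw : 0 ≤ w)
    (hba : b ≤ a ^ γ - w • (1 : 𝓐)) :
    CFC.sqrt (a * b * b * a) + (‖a ^ (1 + γ)‖ - ‖a ^ (2 + γ) -
      (w * ‖a ^ (-γ)‖ ^ (-(2 / γ))) • (1 : 𝓐)‖ ^ ((1 + γ) / (2 + γ))) • (1 : 𝓐) ≤
      a ^ (1 + γ) := by
  have hau := ha.isUnit
  have has := ha.isSelfAdjoint
  set d := w * ‖a ^ (-γ)‖ ^ (-(2 / γ)) with hd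
  set q := a ^ (2 + γ) with hq
  set s := (1 + γ) / (2 + γ) with hs
  have hd0 : 0 ≤ d := by positivity
  have hq0 : 0 ≤ q := CFC.rpow_nonneg
  have hs0 : 0 < s := by positivity
  have hs1 : s ≤ 1 := by rw [hs, div_le_one (by linarith)]; linarith
  have hnn : 0 ≤ a * b * b * a := by
    have := star_mul_self_nonneg (b * a)
    rwa [star_mul, has.star_eq, hb.isSelfAdjoint.star_eq, ← mul_assoc] at this
  have hone : w • (1 : 𝓐) ≥ 0 := smul_nonneg hw zero_le_one
  have ha2 : a ^ (2 : ℝ) = a * a := by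
    rw [show (2 : ℝ) = 1 + 1 by norm_num, CFC.rpow_add hau, CFC.rpow_one a ha.nonneg]
  have hle : (a * b * b * a) ^ ((2 + γ) / (2 + 2 * γ)) ≤ q - d • (1 : 𝓐) := by
    calc (a * b * b * a) ^ ((2 + γ) / (2 + 2 * γ)) ≤ a * b * a :=
          rpow_conj_sq_le ha hb hγ0 hγ (hba.trans (sub_le_self _ hone))
      _ ≤ a * (a ^ γ - w • (1 : 𝓐)) * a := has.conjugate_le_conjugate hba
      _ = a ^ (1 : ℝ) * a ^ γ * a ^ (1 : ℝ) - w • a ^ (2 : ℝ) := by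
        rw [ha2, CFC.rpow_one a ha.nonneg, mul_sub, sub_mul, mul_smul_comm, smul_mul_assoc, mul_one]
      _ = q - w • a ^ (2 : ℝ) := by
        rw [← CFC.rpow_add hau, ← CFC.rpow_add hau, hq]
        congr 2
        ring
      _ ≤ q - d • (1 : 𝓐) := by
        rw [hd, mul_smul]
        exact sub_le_sub_left
          (smul_le_smul_of_nonneg_left (norm_rpow_neg_rpow_smul_one_le ha hγ0) hw) _
  have hdq : d • (1 : 𝓐) ≤ q := sub_nonneg.1 (CFC.rpow_nonneg.trans hle)
  have hroot := CFC.rpow_le_rpow (p := s) ⟨hs0.le, hs1⟩ hle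
  rw [CFC.rpow_rpow_of_exponent_nonneg _ _ _ (by positivity) hs0.le hnn,
    show (2 + γ) / (2 + 2 * γ) * s = 1 / 2 by rw [hs]; field_simp,
    ← CFC.sqrt_eq_rpow] at hroot
  have hgap := hroot.trans (rpow_sub_smul_one_le hq0 hs0.le hs1 hd0 hdq)
  have hqs : q ^ s = a ^ (1 + γ) := by
    rw [hq, CFC.rpow_rpow _ _ _ (by positivity) ha, hs, mul_div_cancel₀ _ (by positivity)]
  have hdn : ‖d • (1 : 𝓐)‖ = d := by rw [norm_smul, norm_one, mul_one, Real.norm_of_nonneg hd0]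
  have hnorm : (‖q‖ - d) ^ s ≤ ‖q - d • (1 : 𝓐)‖ ^ s := by
    refine Real.rpow_le_rpow ?_ ?_ hs0.le
    · have := CStarAlgebra.norm_le_norm_of_nonneg_of_le (smul_nonneg hd0 zero_le_one) hdq
      rw [hdn] at this
      linarith
    · have := norm_sub_norm_le q (d • (1 : 𝓐))
      rwa [hdn] at this
  rw [← CFC.norm_rpow q hs0 hq0, hqs] at hgap
  rw [← le_sub_iff_add_le]
  exact hgap.trans (sub_le_sub_left (smul_le_smul_of_nonneg_right (by linarith) zero_le_one) _)

/-- A unital positive map `Φ` satisfies `Φ (x ^ γ) ≤ Φ x ^ γ - ω` for `1 / 2 ≤ γ < 1`. -/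
theorem PositiveLinearMap.map_rpow_le_sub [Nontrivial 𝓐] (Φ : 𝓐 →ₚ[ℂ] 𝓐) (hΦ : Φ 1 = 1) {x : 𝓐}
    (hx : IsStrictlyPositive x) {γ m : ℝ} (hγ1 : 1 / 2 ≤ γ) (hγ2 : γ < 1)
    (hm : m = ⨅ n : ℕ+, ‖Ring.inverse (Φ x + ((n : ℕ) : ℝ)⁻¹ • (1 : 𝓐) -
      Φ (x ^ γ) ^ (1 / γ))‖⁻¹) :
    0 ≤ ‖Φ x‖ ^ γ - (‖Φ x‖ - m) ^ γ ∧
      Φ (x ^ γ) ≤ Φ x ^ γ - (‖Φ x‖ ^ γ - (‖Φ x‖ - m) ^ γ) • (1 : 𝓐) := by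
  have hγ0 : 0 < γ := by linarith
  have hA := Φ.isStrictlyPositive_map hΦ hx
  have hB := Φ.isStrictlyPositive_map hΦ (hx.rpow x γ)
  have hc : 0 ≤ Φ x - Φ (x ^ γ) ^ (1 / γ) := by
    have := Φ.rpow_map_le hΦ (p := 1 / γ) (by rw [lt_div_iff₀ hγ0]; linarith)
      (by rw [div_le_iff₀ hγ0]; linarith) (hx.rpow x γ).nonneg
    rwa [CFC.rpow_rpow x _ _ hγ0.ne' hx, mul_one_div_cancel hγ0.ne', CFC.rpow_one x hx.nonneg,
      ← sub_nonneg] at this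
  have hm0 : 0 ≤ m := hm ▸ Real.iInf_nonneg fun _ => by positivity
  have hmc : m • (1 : 𝓐) ≤ Φ x - Φ (x ^ γ) ^ (1 / γ) := by
    have := iInf_norm_ringInverse_inv_smul_one_le hc
    simpa only [hm, sub_add_eq_add_sub] using this
  have hBm : Φ (x ^ γ) ^ (1 / γ) ≤ Φ x - m • (1 : 𝓐) := le_sub_comm.1 hmc
  have hmA : m • (1 : 𝓐) ≤ Φ x := sub_nonneg.1 (CFC.rpow_nonneg.trans hBm)
  have hmn : m ≤ ‖Φ x‖ := by
    have := CStarAlgebra.norm_le_norm_of_nonneg_of_le (smul_nonneg hm0 zero_le_one) hmA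
    rwa [norm_smul, norm_one, mul_one, Real.norm_of_nonneg hm0] at this
  refine ⟨sub_nonneg.2 (Real.rpow_le_rpow (by linarith) (by linarith) hγ0.le), ?_⟩
  have h := CFC.rpow_le_rpow (p := γ) ⟨hγ0.le, hγ2.le⟩ hBm
  rw [CFC.rpow_rpow _ _ _ (by positivity) hB, one_div_mul_cancel hγ0.ne',
    CFC.rpow_one _ hB.nonneg] at h
  exact h.trans (rpow_sub_smul_one_le hA.nonneg hγ0.le hγ2.le hm0 hmA)

end SpectralGap

/-- **Corollary 3.9.** If `X` is positive invertible and `γ ∈ [1/2, 1)`, then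
`Φ(X)^(1+γ) ≥ |Φ(X^γ) Φ(X)| + (‖Φ(X)^(1+γ)‖ −
  ‖Φ(X)^(2+γ) − ω(X,γ) ‖Φ(X)^(−γ)‖^(−2/γ)‖^((1+γ)/(2+γ))) · I`. -/
theorem refined_asymmetric_kadison_cor
    (Φ : (H →L[ℂ] H) →ₗ[ℂ] (H →L[ℂ] H)) (hΦ : IsUnitalPositiveMap Φ)
    (X : H →L[ℂ] H) (hX : 0 ≤ X) (hXu : IsUnit X)
    (γ : ℝ) (hγ1 : 1 / 2 ≤ γ) (hγ2 : γ < 1) :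
    opAbs (Φ (CFC.rpow X γ) * Φ X) +
        (‖CFC.rpow (Φ X) (1 + γ)‖ -
            ‖CFC.rpow (Φ X) (2 + γ) -
                (omegaConst Φ X γ * ‖CFC.rpow (Φ X) (-γ)‖ ^ (-(2 / γ))) •
                  (1 : H →L[ℂ] H)‖ ^ ((1 + γ) / (2 + γ))) • (1 : H →L[ℂ] H) ≤
      CFC.rpow (Φ X) (1 + γ) := by
  rcases subsingleton_or_nontrivial (H →L[ℂ] H) with _ | _
  · exact le_of_eq (Subsingleton.elim _ _)
  let Ψ : (H →L[ℂ] H) →ₚ[ℂ] (H →L[ℂ] H) := PositiveLinearMap.mk₀ Φ hΦ.2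
  have hXs : IsStrictlyPositive X := IsStrictlyPositive.iff_of_unital.2 ⟨hX, hXu⟩
  have hA : IsStrictlyPositive (Φ X) := Ψ.isStrictlyPositive_map hΦ.1 hXs
  have hB : IsStrictlyPositive (Φ (X ^ γ)) := Ψ.isStrictlyPositive_map hΦ.1 (hXs.rpow X γ)
  obtain ⟨hw, hle⟩ := Ψ.map_rpow_le_sub hΦ.1 hXs hγ1 hγ2 rfl
  have h := sqrt_conj_sq_add_smul_one_le hA hB (by linarith) (by linarith) hw hle
  have habs : opAbs (Φ (X ^ γ) * Φ X) = CFC.sqrt (Φ X * Φ (X ^ γ) * Φ (X ^ γ) * Φ X) := by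
    rw [opAbs, star_mul, hA.isSelfAdjoint.star_eq, hB.isSelfAdjoint.star_eq, ← mul_assoc]
  rw [← habs] at h
  exact h
end
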